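/- For every ε > 0 there exists x_ε such that for all real x > x_ε, S(x) ≥ (x / log x) · exp((0.8178 − ε) · (log log log x)²). -/

import Mathlib

/-- A Hadamard matrix of order `n`: an `n × n` real matrix with entries in `{-1, +1}`
satisfying `H * Hᵀ = n • I`. -/
def IsHadamardMatrix {n : ℕ} (H : Matrix (Fin n) (Fin n) ℝ) : Prop :=
  (∀ i j, H i j = 1 ∨ H i j = -1) ∧ H * H.transpose = (n : ℝ) • 1

/-- There exists a Hadamard matrix of order `n`. -/
def HadamardOrder (n : ℕ) : Prop :=
  ∃ H : Matrix (Fin n) (Fin n) ℝ, IsHadamardMatrix H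


/-- `S x` is the number of positive integers `n ≤ x` for which a Hadamard matrix
of order `n` exists. -/
noncomputable def S (x : ℝ) : ℕ :=
  {n : ℕ | 0 < n ∧ (n : ℝ) ≤ x ∧ HadamardOrder n}.ncard

open scoped Matrix

theorem HadamardOrder.of_fintype {ι : Type} [Fintype ι] [DecidableEq ι] (H : Matrix ι ι ℝ)
    (h1 : ∀ i j, H i j = 1 ∨ H i j = -1) (h2 : H * Hᵀ = (Fintype.card ι : ℝ) • 1) :
    HadamardOrder (Fintype.card ι) := by
  let e := Fintype.equivFin ι
  refine ⟨H.submatrix e.symm e.symm, fun i j => h1 _ _, ?_⟩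
  rw [Matrix.transpose_submatrix, Matrix.submatrix_mul_equiv, h2]
  ext i j
  simp [Matrix.one_apply]

theorem HadamardOrder.mul {m n : ℕ} (hm : HadamardOrder m) (hn : HadamardOrder n) :
    HadamardOrder (m * n) := by
  obtain ⟨A, hA1, hA2⟩ := hm
  obtain ⟨B, hB1, hB2⟩ := hn
  have := HadamardOrder.of_fintype (Matrix.kroneckerMap (· * ·) A B) (fun i j => by
    rcases hA1 i.1 j.1 with h | h <;> rcases hB1 i.2 j.2 with h' | h' <;>
      simp [Matrix.kroneckerMap_apply, h, h']) (by
    rw [← Matrix.kroneckerMap_transpose, ← Matrix.mul_kronecker_mul, hA2, hB2]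
    ext ⟨i, i'⟩ ⟨j, j'⟩
    simp [Matrix.kroneckerMap_apply, Matrix.one_apply]
    grind)
  simpa using this

theorem HadamardOrder.prod {ι : Type*} (s : Finset ι) (f : ι → ℕ)
    (h : ∀ i ∈ s, HadamardOrder (f i)) : HadamardOrder (∏ i ∈ s, f i) := by
  classical
  induction s using Finset.induction_on with
  | empty =>
    rw [Finset.prod_empty]
    exact ⟨1, fun i j => Or.inl (by rw [Subsingleton.elim i j, Matrix.one_apply_eq]), by simp⟩
  | insert a s ha ih =>
    rw [Finset.prod_insert ha]
    exact (h _ (by simp)).mul (ih fun i hi => h i (by simp [hi]))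

theorem quadraticChar_correlation (p : ℕ) [Fact p.Prime] (hp : p ≠ 2) (a b : ZMod p) :
    ∑ k, quadraticChar (ZMod p) (a - k) * quadraticChar (ZMod p) (b - k) =
      if a = b then (p : ℤ) - 1 else -1 := by
  have hchar : ringChar (ZMod p) ≠ 2 := by rwa [ZMod.ringChar_zmod_n]
  set χ := quadraticChar (ZMod p)
  split_ifs with hab
  · subst hab
    have h : ∀ k, χ (a - k) * χ (a - k) = 1 - if k = a then 1 else 0 := by
      intro k
      split_ifs with hk
      · subst hk; simp [χ.map_zero]
      · rw [← pow_two, quadraticChar_sq_one (sub_ne_zero.2 (Ne.symm hk))]; simp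
    simp [h, ZMod.card]
  · have hd : b - a ≠ 0 := sub_ne_zero.2 (Ne.symm hab)
    have key := jacobiSum_nontrivial_inv (χ := χ) (quadraticChar_ne_one hchar)
    rw [(quadraticChar_isQuadratic (ZMod p)).inv, jacobiSum] at key
    -- substitute `k = a + (b - a) x`
    have e : ∑ k, χ (a - k) * χ (b - k) = ∑ x, χ (-(b - a) * x) * χ ((b - a) * (1 - x)) := by
      symm
      refine Fintype.sum_bijective (fun x => a + (b - a) * x)
        ⟨fun x y h => by simpa [hd] using h, fun y => ⟨(y - a) / (b - a), by field_simp; ring⟩⟩ _ _ ?_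
      intro x
      congr 2 <;> ring
    rw [e]
    have e2 : ∀ x, χ (-(b - a) * x) * χ ((b - a) * (1 - x)) = χ (-1) * (χ x * χ (1 - x)) := by
      intro x
      have : χ (b - a) * χ (b - a) = 1 := by rw [← pow_two, quadraticChar_sq_one hd]
      rw [show -(b - a) * x = (-1) * ((b - a) * x) by ring, map_mul, map_mul, map_mul]
      linear_combination χ (-1) * χ x * χ (1 - x) * this
    rw [Finset.sum_congr rfl fun x _ => e2 x, ← Finset.mul_sum, key]
    have : χ (-1) * χ (-1) = 1 := by rw [← map_mul]; simp
    linarith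

/-- The matrix of a conference matrix of order `p + 1` built from the quadratic character. -/
def paleyConference (p : ℕ) [Fact p.Prime] : Matrix (Unit ⊕ ZMod p) (Unit ⊕ ZMod p) ℝ :=
  Matrix.fromBlocks 0 (Matrix.of fun _ _ => 1) (Matrix.of fun _ _ => 1)
    (Matrix.of fun i j => ((quadraticChar (ZMod p) (i - j) : ℤ) : ℝ))

theorem paleyConference_mul_transpose (p : ℕ) [Fact p.Prime] (hp : p ≠ 2) :
    paleyConference p * (paleyConference p)ᵀ = (p : ℝ) • 1 := by
  have hchar : ringChar (ZMod p) ≠ 2 := by rwa [ZMod.ringChar_zmod_n]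
  have hs : ∀ a : ZMod p, ∑ k, quadraticChar (ZMod p) (a - k) = 0 := fun a => by
    rw [← quadraticChar_sum_zero hchar]
    exact Fintype.sum_equiv (Equiv.subLeft a) _ _ fun x => rfl
  ext i j
  rcases i with i | i <;> rcases j with j | j
  · simp [paleyConference, Matrix.mul_apply]
  · simp [paleyConference, Matrix.mul_apply]
    exact_mod_cast hs j
  · simp [paleyConference, Matrix.mul_apply]
    exact_mod_cast hs i
  · simp [paleyConference, Matrix.mul_apply, Matrix.one_apply]
    have := quadraticChar_correlation p hp i j
    have h2 : ((∑ k, quadraticChar (ZMod p) (i - k) * quadraticChar (ZMod p) (j - k) : ℤ) : ℝ)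
      = ((if i = j then (p : ℤ) - 1 else -1 : ℤ) : ℝ) := by rw [this]
    push_cast at h2
    simp only [quadraticChar_apply] at h2
    rw [h2]
    split_ifs <;> simp

theorem paleyConference_diag (p : ℕ) [Fact p.Prime] (i) : paleyConference p i i = 0 := by
  rcases i with i | i <;> simp [paleyConference]

theorem paleyConference_offDiag (p : ℕ) [Fact p.Prime] (i j) (h : i ≠ j) :
    paleyConference p i j = 1 ∨ paleyConference p i j = -1 := by
  rcases i with i | i <;> rcases j with j | j
  · exact absurd rfl h
  · simp [paleyConference]
  · simp [paleyConference]
  · have : i - j ≠ 0 := sub_ne_zero.2 fun e => h (by rw [e])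
    simp only [paleyConference, Matrix.fromBlocks_apply₂₂, Matrix.of_apply]
    rcases quadraticChar_dichotomy this with h | h <;> simp [h]

theorem HadamardOrder.two_mul_prime_add_one {p : ℕ} (hp : p.Prime) (hp2 : p ≠ 2) :
    HadamardOrder (2 * (p + 1)) := by
  have : Fact p.Prime := ⟨hp⟩
  set C := paleyConference p with hC
  have h1 : C * Cᵀ = (p : ℝ) • 1 := paleyConference_mul_transpose p hp2
  have hp0 : (p : ℝ) ≠ 0 := by exact_mod_cast hp.ne_zero
  have h2 : Cᵀ * C = (p : ℝ) • 1 := by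
    have : C * ((p : ℝ)⁻¹ • Cᵀ) = 1 := by rw [Matrix.mul_smul, h1, smul_smul]; simp [hp0]
    have := mul_eq_one_comm.1 this
    rw [Matrix.smul_mul] at this
    rw [← this, smul_smul]; simp [hp0]
  have := HadamardOrder.of_fintype
    (Matrix.fromBlocks (C + 1) (C - 1) (C - 1)ᵀ (-(C + 1)ᵀ)) (by
      have hpm : ∀ i j, ((C + 1) i j = 1 ∨ (C + 1) i j = -1) ∧
          ((C - 1) i j = 1 ∨ (C - 1) i j = -1) := by
        intro i j
        by_cases h : i = j
        · subst h; simp [hC, paleyConference_diag]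
        · simpa [Matrix.one_apply, h] using paleyConference_offDiag p i j h
      intro i j
      rcases i with i | i <;> rcases j with j | j
      · exact (hpm i j).1
      · exact (hpm i j).2
      · exact (hpm j i).2
      · rcases (hpm j i).1 with h | h
        · right
          simp only [Matrix.fromBlocks_apply₂₂, Matrix.neg_apply, Matrix.transpose_apply, h]
        · left
          simp only [Matrix.fromBlocks_apply₂₂, Matrix.neg_apply, Matrix.transpose_apply, h]
          norm_num) (by
    rw [Matrix.fromBlocks_transpose, Matrix.fromBlocks_multiply]
    have c : (Fintype.card ((Unit ⊕ ZMod p) ⊕ (Unit ⊕ ZMod p)) : ℝ) = 2 * (p + 1) := by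
      simp [ZMod.card]; ring
    rw [c]
    have e1 : (C + 1) * (C + 1)ᵀ + (C - 1) * (C - 1)ᵀ = (2 * ((p : ℝ) + 1)) • 1 := by
      simp only [Matrix.transpose_add, Matrix.transpose_sub, Matrix.transpose_one]
      rw [show (C + 1) * (Cᵀ + 1) + (C - 1) * (Cᵀ - 1) = 2 * (C * Cᵀ) + 2 * 1 by noncomm_ring, h1]
      rw [mul_smul, add_smul, two_smul, two_mul, one_smul, two_mul]; abel
    have e2 : (C + 1) * (C - 1) + (C - 1) * (-(C + 1)) = 0 := by noncomm_ring
    have e3 : (C - 1)ᵀ * (C - 1) + (C + 1)ᵀ * (C + 1) = (2 * ((p : ℝ) + 1)) • 1 := by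
      simp only [Matrix.transpose_add, Matrix.transpose_sub, Matrix.transpose_one]
      rw [show (Cᵀ - 1) * (C - 1) + (Cᵀ + 1) * (C + 1) = 2 * (Cᵀ * C) + 2 * 1 by noncomm_ring, h2]
      rw [mul_smul, add_smul, two_smul, two_mul, one_smul, two_mul]; abel
    have e4 : (C - 1)ᵀ * (C + 1)ᵀ + (-(C + 1)ᵀ) * (C - 1)ᵀ = 0 := by
      simp only [Matrix.transpose_add, Matrix.transpose_sub, Matrix.transpose_one]
      noncomm_ring
    simp only [Matrix.transpose_neg, Matrix.transpose_transpose]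
    rw [e1, e2, e4, neg_mul_neg, e3]
    ext i j
    rcases i with i | i <;> rcases j with j | j <;> simp [Matrix.one_apply])
  convert this using 1
  simp [ZMod.card]; ring

/-- The primes up to `N`. -/
def primesUpTo (N : ℕ) : Finset ℕ := (Finset.Ioc 0 N).filter Nat.Prime

theorem mem_primesUpTo {N p : ℕ} : p ∈ primesUpTo N ↔ p.Prime ∧ p ≤ N := by
  simp only [primesUpTo, Finset.mem_filter, Finset.mem_Ioc]
  exact ⟨fun h => ⟨h.2, h.1.2⟩, fun h => ⟨⟨h.1.pos, h.2⟩, h.1⟩⟩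

theorem log_factorial_eq_sum_primes (N : ℕ) :
    Real.log (N.factorial) =
      ∑ p ∈ primesUpTo N, (N.factorial.factorization p : ℝ) * Real.log p := by
  rw [Real.log_nat_eq_sum_factorization, Finsupp.sum]
  refine Finset.sum_subset ?_ ?_
  · intro p hp
    rw [Nat.support_factorization, Nat.mem_primeFactors] at hp
    exact mem_primesUpTo.2 ⟨hp.1, (hp.1.dvd_factorial).1 hp.2.1⟩
  · intro p _ hp
    simp [Finsupp.notMem_support_iff.1 hp]

theorem sum_primes_log_div_le (N : ℕ) (hN : 1 ≤ N) :
    ∑ p ∈ primesUpTo N, Real.log p / p ≤ Real.log N + Real.log 4 := by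
  have hN0 : (0 : ℝ) < N := by exact_mod_cast hN
  have h1 : Real.log (N.factorial) ≤ N * Real.log N := by
    rw [← Real.log_pow]
    exact Real.log_le_log (by exact_mod_cast N.factorial_pos) (by exact_mod_cast N.factorial_le_pow)
  have h2 : ∑ p ∈ primesUpTo N, Real.log p ≤ Real.log 4 * N := by
    have := Chebyshev.theta_le_log4_mul_x (x := N) hN0.le
    simpa [Chebyshev.theta, primesUpTo] using this
  have h3 : ∑ p ∈ primesUpTo N, (N / p - 1 : ℝ) * Real.log p ≤ Real.log (N.factorial) := by
    rw [log_factorial_eq_sum_primes]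
    refine Finset.sum_le_sum fun p hp => ?_
    obtain ⟨hp, hpN⟩ := mem_primesUpTo.1 hp
    refine mul_le_mul_of_nonneg_right ?_ (Real.log_natCast_nonneg p)
    have h : N / p ≤ N.factorial.factorization p := by
      rw [Nat.factorization_factorial hp (Nat.lt_add_one _)]
      have : N / p ^ 1 ≤ ∑ i ∈ Finset.Ico 1 (Nat.log p N + 1), N / p ^ i :=
        Finset.single_le_sum (f := fun i => N / p ^ i) (fun _ _ => Nat.zero_le _)
          (Finset.mem_Ico.2 ⟨le_rfl, Nat.lt_succ_of_le (Nat.log_pos hp.one_lt hpN)⟩)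
      simpa using this
    have h' : (N : ℝ) / p < (N / p : ℕ) + 1 := by
      rw [div_lt_iff₀ (by exact_mod_cast hp.pos)]
      have := Nat.lt_mul_div_succ N hp.pos
      rw [mul_comm]; exact_mod_cast this
    have : ((N / p : ℕ) : ℝ) ≤ N.factorial.factorization p := by exact_mod_cast h
    linarith
  have h4 : ∑ p ∈ primesUpTo N, (N / p - 1 : ℝ) * Real.log p =
      N * ∑ p ∈ primesUpTo N, Real.log p / p - ∑ p ∈ primesUpTo N, Real.log p := by
    rw [Finset.mul_sum, ← Finset.sum_sub_distrib]
    exact Finset.sum_congr rfl fun p _ => by ring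
  have : N * ∑ p ∈ primesUpTo N, Real.log p / p ≤ N * (Real.log N + Real.log 4) := by linarith
  exact le_of_mul_le_mul_left this hN0

theorem sum_log_div_mul_le (N : ℕ) :
    ∑ p ∈ primesUpTo N, Real.log p / (p * (p - 1)) ≤ 8 := by
  have key : ∀ N : ℕ, ∑ n ∈ Finset.Icc 2 N, Real.log n / (n * (n - 1)) ≤ 8 - 4 / Real.sqrt (N + 1) := by
    intro N
    induction N with
    | zero => norm_num
    | succ N ih =>
      rcases Nat.eq_zero_or_pos N with rfl | hN
      · simp
        have : (4 : ℝ) / √(1 + 1) ≤ 4 := div_le_self (by norm_num) (Real.one_le_sqrt.2 (by norm_num))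
        linarith
      rw [Finset.sum_Icc_succ_top (by omega)]
      refine (add_le_add_left ih _).trans ?_
      have hn : (1 : ℝ) ≤ N := by exact_mod_cast hN
      set s := Real.sqrt ((N : ℝ) + 1) with hs
      set t := Real.sqrt (((N + 1 : ℕ) : ℝ) + 1) with ht
      have hs2 : s ^ 2 = N + 1 := Real.sq_sqrt (by positivity)
      have ht2 : t ^ 2 = N + 2 := by rw [ht, Real.sq_sqrt (by positivity)]; push_cast; ring
      have hs0 : 0 < s := Real.sqrt_pos.2 (by positivity)
      have ht0 : 0 < t := Real.sqrt_pos.2 (by positivity)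
      have hlog : Real.log ((N + 1 : ℕ) : ℝ) ≤ 2 * (s - 1) := by
        have : ((N + 1 : ℕ) : ℝ) = s ^ 2 := by rw [hs2]; push_cast; ring
        rw [this, Real.log_pow]
        have := Real.log_le_sub_one_of_pos hs0
        push_cast; linarith
      have hst : s ≤ t := Real.sqrt_le_sqrt (by push_cast; linarith)
      have hN' : ((N + 1 : ℕ) : ℝ) * (((N + 1 : ℕ) : ℝ) - 1) = s ^ 2 * (s ^ 2 - 1) := by
        rw [hs2]; push_cast; ring
      rw [hN']
      have hs1 : 1 < s ^ 2 := by rw [hs2]; linarith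
      have hs1' : 1 < s := by nlinarith
      have h1 : Real.log ((N + 1 : ℕ) : ℝ) / (s ^ 2 * (s ^ 2 - 1)) ≤ 2 / (s ^ 2 * (s + 1)) := by
        rw [div_le_div_iff₀ (by nlinarith) (by positivity)]
        have : 0 < s ^ 2 * (s + 1) := by positivity
        calc Real.log ((N + 1 : ℕ) : ℝ) * (s ^ 2 * (s + 1)) ≤ 2 * (s - 1) * (s ^ 2 * (s + 1)) := by gcongr
          _ = _ := by ring
      have h2 : 2 / (s ^ 2 * (s + 1)) ≤ 4 / s - 4 / t := by
        have e : 4 / s - 4 / t = 4 / (s * t * (s + t)) := by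
          have : (t - s) * (s + t) = 1 := by nlinarith
          have h3 : t - s = 1 / (s + t) := by field_simp; linarith
          rw [div_sub_div _ _ hs0.ne' ht0.ne', show 4 * t - s * 4 = 4 * (t - s) by ring, h3]
          field_simp
        rw [e, div_le_div_iff₀ (by positivity) (by positivity)]
        have ht' : t ≤ 2 * s := by nlinarith
        have ht'' : t ≤ s + 1 := by nlinarith
        have h4 : t * (s + t) ≤ 2 * (s * (s + 1)) := by nlinarith
        nlinarith
      linarith
  have : ∑ p ∈ primesUpTo N, Real.log p / (p * (p - 1)) ≤
      ∑ n ∈ Finset.Icc 2 N, Real.log n / (n * (n - 1)) := by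
    refine Finset.sum_le_sum_of_subset_of_nonneg ?_ ?_
    · intro p hp
      obtain ⟨hp, hpN⟩ := mem_primesUpTo.1 hp
      exact Finset.mem_Icc.2 ⟨hp.two_le, hpN⟩
    · intro n hn _
      have : (2 : ℝ) ≤ n := by exact_mod_cast (Finset.mem_Icc.1 hn).1
      exact div_nonneg (Real.log_natCast_nonneg n) (mul_nonneg (by linarith) (by linarith))
  have h4 : 0 ≤ 4 / Real.sqrt (N + 1) := by positivity
  linarith [key N]

theorem le_sum_primes_log_div (N : ℕ) (hN : 1 ≤ N) :
    Real.log N - 9 ≤ ∑ p ∈ primesUpTo N, Real.log p / p := by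
  have hN0 : (0 : ℝ) < N := by exact_mod_cast hN
  have h1 : N * Real.log N - N ≤ Real.log (N.factorial) := by
    have := Real.exp_pos N
    have h : (N : ℝ) ^ N / N.factorial ≤ Real.exp N := Real.pow_div_factorial_le_exp _ hN0.le _
    have h' := Real.log_le_log (by positivity) h
    rw [Real.log_exp, Real.log_div (by positivity) (by positivity), Real.log_pow] at h'
    linarith
  have h2 : Real.log (N.factorial) ≤ ∑ p ∈ primesUpTo N, (N / (p - 1) : ℝ) * Real.log p := by
    rw [log_factorial_eq_sum_primes]
    refine Finset.sum_le_sum fun p hp => ?_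
    obtain ⟨hp, hpN⟩ := mem_primesUpTo.1 hp
    refine mul_le_mul_of_nonneg_right ?_ (Real.log_natCast_nonneg p)
    have h := Nat.factorization_factorial_le_div_pred hp N
    have h' : ((N / (p - 1) : ℕ) : ℝ) ≤ N / ((p - 1 : ℕ) : ℝ) := Nat.cast_div_le
    rw [Nat.cast_sub hp.one_le, Nat.cast_one] at h'
    exact le_trans (by exact_mod_cast h) h'
  have h3 : ∑ p ∈ primesUpTo N, (N / (p - 1) : ℝ) * Real.log p =
      N * (∑ p ∈ primesUpTo N, Real.log p / p + ∑ p ∈ primesUpTo N, Real.log p / (p * (p - 1))) := by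
    rw [← Finset.sum_add_distrib, Finset.mul_sum]
    refine Finset.sum_congr rfl fun p hp => ?_
    obtain ⟨hp, hpN⟩ := mem_primesUpTo.1 hp
    have h2 : (2 : ℝ) ≤ p := by exact_mod_cast hp.two_le
    have : (p : ℝ) - 1 ≠ 0 := by linarith
    have : (p : ℝ) ≠ 0 := by linarith
    field_simp
    ring
  have h4 : N * (Real.log N - 1) ≤ N * (∑ p ∈ primesUpTo N, Real.log p / p +
      ∑ p ∈ primesUpTo N, Real.log p / (p * (p - 1))) := by linarith
  have := le_of_mul_le_mul_left h4 hN0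
  linarith [sum_log_div_mul_le N]

theorem exists_abs_sum_primes_inv_sub_log_log_le :
    ∃ M : ℝ, 0 ≤ M ∧ ∀ N : ℕ, 2 ≤ N →
      |∑ p ∈ primesUpTo N, (1 : ℝ) / p - Real.log (Real.log N)| ≤ M := by
  set A : ℕ → ℝ := fun N => ∑ p ∈ primesUpTo N, Real.log p / p with hA
  set R : ℕ → ℝ := fun N => ∑ p ∈ primesUpTo N, (1 : ℝ) / p with hR
  have hE : ∀ N, 1 ≤ N → |A N - Real.log N| ≤ 9 := by
    intro N hN
    have h4 : Real.log 4 ≤ 9 := by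
      have := Real.log_le_sub_one_of_pos (show (0 : ℝ) < 4 by norm_num); linarith
    rw [abs_le]
    exact ⟨by linarith [le_sum_primes_log_div N hN], by linarith [sum_primes_log_div_le N hN]⟩
  set F : ℕ → ℝ := fun N => R N - Real.log (Real.log N) - (A N - Real.log N) / Real.log N with hF
  have hl2 : (1 / 2 : ℝ) ≤ Real.log 2 := by linarith [Real.log_two_gt_d9]
  have step : ∀ N, 2 ≤ N → |F (N + 1) - F N| ≤
      9 * (1 / Real.log N - 1 / Real.log (N + 1 : ℕ)) + 4 * (1 / ((N : ℝ) - 1) - 1 / N) := by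
    intro N hN
    have hN2 : (2 : ℝ) ≤ N := by exact_mod_cast hN
    have hmem : N + 1 ∉ primesUpTo N := fun h => by have := (mem_primesUpTo.1 h).2; omega
    set u := Real.log N with hu
    set v := Real.log (N + 1 : ℕ) with hv
    have huv : u ≤ v := Real.log_le_log (by linarith) (by push_cast; linarith)
    have hu2 : 1 / 2 ≤ u := hl2.trans (Real.log_le_log (by norm_num) hN2)
    have hu0 : 0 < u := by linarith
    have hv0 : 0 < v := by linarith
    -- `R` and `A` increase compatibly
    have hRA : R (N + 1) - R N = (A (N + 1) - A N) / v := by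
      by_cases hp : (N + 1).Prime
      · have : primesUpTo (N + 1) = insert (N + 1) (primesUpTo N) := by
          ext q; simp only [mem_primesUpTo, Finset.mem_insert]; grind
        simp only [hR, hA, this, Finset.sum_insert hmem]
        rw [add_sub_cancel_right, add_sub_cancel_right, div_div, mul_comm, ← div_div, div_self hv0.ne']
      · have : primesUpTo (N + 1) = primesUpTo N := by
          ext q; simp only [mem_primesUpTo]; grind
        simp [hR, hA, this]
    have e : F (N + 1) - F N = (A N - u) * (1 / u - 1 / v) +
        ((1 - u / v) - (Real.log v - Real.log u)) := by
      have : F (N + 1) - F N = (R (N + 1) - R N) - (Real.log v - Real.log u)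
        - (A (N + 1) - v) / v + (A N - u) / u := by simp only [hF]; ring
      rw [this, hRA]
      field_simp
      ring
    have hd : v - u ≤ 1 / N := by
      rw [hv, hu, ← Real.log_div (by positivity) (by positivity)]
      have := Real.log_le_sub_one_of_pos (show (0 : ℝ) < ((N + 1 : ℕ) : ℝ) / N by positivity)
      refine this.trans (le_of_eq ?_)
      push_cast; field_simp; ring
    have hlog : Real.log v - Real.log u = Real.log (v / u) := by
      rw [Real.log_div hv0.ne' hu0.ne']
    have hup : Real.log (v / u) ≤ v / u - 1 := Real.log_le_sub_one_of_pos (by positivity)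
    have hlo : 1 - (v / u)⁻¹ ≤ Real.log (v / u) := Real.one_sub_inv_le_log_of_pos (by positivity)
    rw [inv_div] at hlo
    have hmain : |(1 - u / v) - (Real.log v - Real.log u)| ≤ 4 * (1 / ((N : ℝ) - 1) - 1 / N) := by
      rw [hlog, abs_le]
      have hpos : 0 ≤ 1 / ((N : ℝ) - 1) - 1 / N := by
        rw [sub_nonneg]; exact one_div_le_one_div_of_le (by linarith) (by linarith)
      refine ⟨?_, by linarith⟩
      have h1 : v / u - 1 - (1 - u / v) = (v - u) ^ 2 / (u * v) := by field_simp
      have h2 : (v - u) ^ 2 / (u * v) ≤ 4 * (1 / N) ^ 2 := by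
        rw [div_le_iff₀ (by positivity)]
        have a1 : (v - u) ^ 2 ≤ (1 / (N : ℝ)) ^ 2 := pow_le_pow_left₀ (by linarith) hd 2
        have a2 : 1 / 4 ≤ u * v := by nlinarith
        nlinarith [sq_nonneg (1 / (N : ℝ))]
      have h3 : (1 / (N : ℝ)) ^ 2 ≤ 1 / ((N : ℝ) - 1) - 1 / N := by
        rw [div_sub_div _ _ (by linarith) (by linarith), div_pow,
          div_le_div_iff₀ (by positivity) (by nlinarith)]
        nlinarith
      linarith
    have hfirst : |(A N - u) * (1 / u - 1 / v)| ≤ 9 * (1 / u - 1 / v) := by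
      have : 0 ≤ 1 / u - 1 / v := by
        rw [sub_nonneg]; exact one_div_le_one_div_of_le hu0 huv
      rw [abs_mul, abs_of_nonneg this]
      exact mul_le_mul_of_nonneg_right (hE N (by omega)) this
    rw [e]
    exact (abs_add_le _ _).trans (add_le_add hfirst hmain)
  have bound : ∀ N, 2 ≤ N → |F N| ≤ |F 2| + 9 * (1 / Real.log 2 - 1 / Real.log N) +
      4 * (1 - 1 / ((N : ℝ) - 1)) := by
    intro N hN
    induction N, hN using Nat.le_induction with
    | base => norm_num
    | succ N hN ih =>
      have := step N hN
      have h2 : |F (N + 1)| ≤ |F N| + |F (N + 1) - F N| := by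
        have := abs_add_le (F N) (F (N + 1) - F N); simpa using this
      push_cast at *
      rw [add_sub_cancel_right]
      linarith
  refine ⟨|F 2| + 9 * 2 + 4 + 9 * 2, by positivity, fun N hN => ?_⟩
  have hN2 : (2 : ℝ) ≤ N := by exact_mod_cast hN
  have hu2 : 1 / 2 ≤ Real.log N := hl2.trans (Real.log_le_log (by norm_num) hN2)
  have h1 : 1 / Real.log 2 ≤ 2 := by rw [div_le_iff₀ (by linarith)]; linarith
  have h1' : 0 ≤ 1 / Real.log N := by positivity
  have h2 : 0 ≤ 1 / ((N : ℝ) - 1) := by apply div_nonneg <;> linarith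
  have h3 : |(A N - Real.log N) / Real.log N| ≤ 9 * 2 := by
    rw [abs_div, abs_of_pos (show 0 < Real.log N by linarith), div_le_iff₀ (by linarith)]
    linarith [hE N (by omega)]
  have h4 : R N - Real.log (Real.log N) = F N + (A N - Real.log N) / Real.log N := by
    simp only [hF]; ring
  rw [h4]
  refine (abs_add_le _ _).trans ?_
  linarith [bound N hN]

theorem ite_eq_empty_le_sum_powerset (B : Finset ℕ) (t : ℕ) :
    (if B = ∅ then (1 : ℝ) else 0) ≤
      ∑ U ∈ B.powerset, if U.card ≤ 2 * t then (-1 : ℝ) ^ U.card else 0 := by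
  have h := Finset.sum_powerset_apply_card
    (fun m => if m ≤ 2 * t then (-1 : ℝ) ^ m else 0) (x := B)
  rw [h]
  rcases Nat.eq_zero_or_pos B.card with h0 | h0
  · rw [Finset.card_eq_zero] at h0; subst h0; simp
  · rw [if_neg (by rintro rfl; simp at h0)]
    obtain ⟨n, hn⟩ : ∃ n, B.card = n + 1 := ⟨B.card - 1, by omega⟩
    rw [hn]
    have e : ∑ m ∈ Finset.range (n + 1 + 1), (n + 1).choose m • (if m ≤ 2 * t then (-1 : ℝ) ^ m else 0)
        = ∑ m ∈ Finset.range (2 * t + 1), (-1 : ℝ) ^ m * (n + 1).choose m := by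
      have e1 : ∀ m, (n + 1).choose m • (if m ≤ 2 * t then (-1 : ℝ) ^ m else 0) =
          if m ∈ Finset.range (2 * t + 1) then (-1 : ℝ) ^ m * (n + 1).choose m else 0 := by
        intro m
        by_cases hm : m ≤ 2 * t
        · rw [if_pos hm, if_pos (Finset.mem_range.2 (by omega)), nsmul_eq_mul, mul_comm]
        · rw [if_neg hm, if_neg (by simpa using hm), smul_zero]
      rw [Finset.sum_congr rfl fun m _ => e1 m, Finset.sum_ite_mem]
      refine Finset.sum_subset Finset.inter_subset_right ?_
      intro m hm hm'
      have : n + 1 < m := by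
        by_contra hlt
        exact hm' (Finset.mem_inter.2 ⟨Finset.mem_range.2 (by omega), hm⟩)
      simp [Nat.choose_eq_zero_of_lt this]
    rw [e]
    have := @Int.alternating_sum_range_choose_eq_choose n (2 * t)
    have h2 : ((∑ m ∈ Finset.range (2 * t + 1), ((-1) ^ m * (n + 1).choose m : ℤ) : ℤ) : ℝ) =
      (((-1) ^ (2 * t) * n.choose (2 * t) : ℤ) : ℝ) := by rw [this]
    push_cast at h2
    rw [h2, pow_mul]
    simp

theorem abs_card_filter_modEq_sub_le (M c Q : ℕ) (hQ : 0 < Q) :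
    |(((Finset.Ioc 0 M).filter fun n => n ≡ c [MOD Q]).card : ℝ) - M / Q| ≤ 1 := by
  have h := Nat.Ioc_filter_modEq_card 0 M hQ c
  have hQ' : (0 : ℚ) < Q := by exact_mod_cast hQ
  set a : ℤ := ⌊((M : ℚ) - c) / Q⌋
  set b : ℤ := ⌊(((0 : ℕ) : ℚ) - c) / Q⌋
  have ha1 : (a : ℚ) ≤ ((M : ℚ) - c) / Q := Int.floor_le _
  have ha2 : ((M : ℚ) - c) / Q < a + 1 := Int.lt_floor_add_one _
  have hb1 : (b : ℚ) ≤ (((0 : ℕ) : ℚ) - c) / Q := Int.floor_le _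
  have hb2 : (((0 : ℕ) : ℚ) - c) / Q < b + 1 := Int.lt_floor_add_one _
  have hab : b ≤ a := Int.floor_le_floor (by gcongr; simp)
  rw [max_eq_left (by linarith)] at h
  have e : ((M : ℚ) - c) / Q - (((0 : ℕ) : ℚ) - c) / Q = M / Q := by push_cast; ring
  have key : |((((Finset.Ioc 0 M).filter fun n => n ≡ c [MOD Q]).card : ℤ) : ℚ) - M / Q| ≤ 1 := by
    rw [h, abs_le]; push_cast
    constructor <;> linarith
  have : ((|((((Finset.Ioc 0 M).filter fun n => n ≡ c [MOD Q]).card : ℤ) : ℚ) - M / Q| : ℚ) : ℝ)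
      ≤ ((1 : ℚ) : ℝ) := by exact_mod_cast key
  push_cast at this
  exact this

theorem abs_card_filter_residues_sub_le (M κ : ℕ) (R : ℕ → Finset ℕ) (U : Finset ℕ)
    (hU : ∀ q ∈ U, q.Prime) (hR : ∀ q ∈ U, (R q).card = κ) (hRq : ∀ q ∈ U, ∀ r ∈ R q, r < q) :
    ∀ c Q : ℕ, 0 < Q → (∀ q ∈ U, Nat.Coprime Q q) →
    |(((Finset.Ioc 0 M).filter fun n => n ≡ c [MOD Q] ∧ ∀ q ∈ U, n % q ∈ R q).card : ℝ)
      - (M : ℝ) / Q * ∏ q ∈ U, (κ : ℝ) / q| ≤ (κ : ℝ) ^ U.card := by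
  induction U using Finset.induction_on with
  | empty => intro c Q hQ _; simpa using abs_card_filter_modEq_sub_le M c Q hQ
  | insert q U hq ih =>
    intro c Q hQ hcop
    have ih' := ih (fun p hp => hU p (by simp [hp])) (fun p hp => hR p (by simp [hp]))
      (fun p hp => hRq p (by simp [hp]))
    have hqP := hU q (by simp)
    have hQq : Nat.Coprime Q q := hcop q (by simp)
    have hdecomp : ((Finset.Ioc 0 M).filter fun n => n ≡ c [MOD Q] ∧ ∀ p ∈ insert q U, n % p ∈ R p)
        = (R q).biUnion fun r => (Finset.Ioc 0 M).filter fun n =>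
          n ≡ Nat.chineseRemainder hQq c r [MOD Q * q] ∧ ∀ p ∈ U, n % p ∈ R p := by
      ext n
      simp only [Finset.mem_filter, Finset.mem_biUnion, Finset.mem_insert, forall_eq_or_imp]
      have hcr : ∀ r, n ≡ Nat.chineseRemainder hQq c r [MOD Q * q] ↔
          n ≡ c [MOD Q] ∧ n ≡ r [MOD q] := fun r => by
        rw [← Nat.modEq_and_modEq_iff_modEq_mul hQq]
        have h := (Nat.chineseRemainder hQq c r).2
        exact ⟨fun h' => ⟨h'.1.trans h.1, h'.2.trans h.2⟩,
          fun h' => ⟨h'.1.trans h.1.symm, h'.2.trans h.2.symm⟩⟩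
      constructor
      · rintro ⟨h1, h2, h3, h4⟩
        exact ⟨n % q, h3, h1, (hcr _).2 ⟨h2, (Nat.mod_modEq n q).symm⟩, h4⟩
      · rintro ⟨r, hr, h1, h2, h4⟩
        obtain ⟨h2, h3⟩ := (hcr _).1 h2
        refine ⟨h1, h2, ?_, h4⟩
        have : n % q = r := by
          rw [h3, Nat.mod_eq_of_lt (hRq q (by simp) r hr)]
        rwa [this]
    rw [hdecomp, Finset.card_biUnion]
    · have hsum : (M : ℝ) / Q * ∏ p ∈ insert q U, (κ : ℝ) / p =
          ∑ r ∈ R q, (M : ℝ) / (Q * q : ℕ) * ∏ p ∈ U, (κ : ℝ) / p := by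
        rw [Finset.sum_const, hR q (by simp), Finset.prod_insert hq]
        push_cast; rw [nsmul_eq_mul]
        have : (q : ℝ) ≠ 0 := by exact_mod_cast hqP.ne_zero
        have : (Q : ℝ) ≠ 0 := by exact_mod_cast hQ.ne'
        field_simp
      rw [hsum]
      push_cast
      rw [← Finset.sum_sub_distrib]
      refine (Finset.abs_sum_le_sum_abs _ _).trans ?_
      refine (Finset.sum_le_sum (g := fun _ => (κ : ℝ) ^ U.card) fun r hr => ?_).trans ?_
      · have := ih' (Nat.chineseRemainder hQq c r) (Q * q) (Nat.mul_pos hQ hqP.pos) (fun p hp => by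
          refine Nat.Coprime.mul_left (hcop p (by simp [hp])) ?_
          exact (Nat.coprime_primes hqP (hU p (by simp [hp]))).2 fun e => hq (e ▸ hp))
        push_cast at this
        exact this
      · rw [Finset.sum_const, hR q (by simp), Finset.card_insert_of_notMem hq, nsmul_eq_mul, pow_succ']
    · intro r hr r' hr' hne
      rw [Function.onFun, Finset.disjoint_left]
      intro n hn hn'
      simp only [Finset.mem_filter] at hn hn'
      have h1 := (Nat.modEq_and_modEq_iff_modEq_mul hQq).2 hn.2.1
      have h2 := (Nat.modEq_and_modEq_iff_modEq_mul hQq).2 hn'.2.1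
      have h3 := (h1.2.trans (Nat.chineseRemainder hQq c r).2.2).symm.trans
        (h2.2.trans (Nat.chineseRemainder hQq c r').2.2)
      have h4 := hRq q (by simp) r' hr'
      exact hne (Nat.ModEq.eq_of_lt_of_lt h3 (hRq q (by simp) r hr) h4)

/-- Brun's pure sieve. -/
theorem brun_pure_sieve (M κ t z : ℕ) (hz : 1 ≤ z) (R : ℕ → Finset ℕ) (P : Finset ℕ)
    (hP : ∀ q ∈ P, q.Prime) (hPz : P.card ≤ z) (hκ : ∀ q ∈ P, κ ≤ q)
    (hR : ∀ q ∈ P, (R q).card = κ) (hRq : ∀ q ∈ P, ∀ r ∈ R q, r < q) :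
    (((Finset.Ioc 0 M).filter fun n => ∀ q ∈ P, n % q ∉ R q).card : ℝ) ≤
      M * (Real.exp (-(κ * ∑ q ∈ P, (1 : ℝ) / q)) +
        (1 / 2) ^ (2 * t) * Real.exp (2 * κ * ∑ q ∈ P, (1 : ℝ) / q))
      + (z : ℝ) ^ (2 * t) * Real.exp κ := by
  classical
  set X : Finset ℕ → ℝ := fun U => ∏ q ∈ U, (κ : ℝ) / q with hX
  have hX0 : ∀ U, 0 ≤ X U := fun U => Finset.prod_nonneg fun q _ => by positivity
  have h1 : (((Finset.Ioc 0 M).filter fun n => ∀ q ∈ P, n % q ∉ R q).card : ℝ) ≤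
      ∑ U ∈ P.powerset, (if U.card ≤ 2 * t then (-1 : ℝ) ^ U.card else 0) *
        (((Finset.Ioc 0 M).filter fun n => ∀ q ∈ U, n % q ∈ R q).card : ℝ) := by
    rw [Finset.card_filter]
    push_cast
    have : ∀ U ∈ P.powerset, (if U.card ≤ 2 * t then (-1 : ℝ) ^ U.card else 0) *
        (((Finset.Ioc 0 M).filter fun n => ∀ q ∈ U, n % q ∈ R q).card : ℝ) =
        ∑ n ∈ Finset.Ioc 0 M, if U ⊆ P.filter (fun q => n % q ∈ R q) then
          (if U.card ≤ 2 * t then (-1 : ℝ) ^ U.card else 0) else 0 := by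
      intro U hU
      rw [Finset.card_filter]; push_cast
      rw [Finset.mul_sum]
      refine Finset.sum_congr rfl fun n _ => ?_
      have : (∀ q ∈ U, n % q ∈ R q) ↔ U ⊆ P.filter (fun q => n % q ∈ R q) := by
        rw [Finset.mem_powerset] at hU
        exact ⟨fun h q hq => Finset.mem_filter.2 ⟨hU hq, h q hq⟩,
          fun h q hq => (Finset.mem_filter.1 (h hq)).2⟩
      simp only [this]
      split_ifs <;> simp
    rw [Finset.sum_congr rfl this, Finset.sum_comm]
    refine Finset.sum_le_sum fun n _ => ?_
    have hb := ite_eq_empty_le_sum_powerset (P.filter (fun q => n % q ∈ R q)) t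
    rw [← Finset.sum_filter]
    have e1 : P.powerset.filter (fun U => U ⊆ P.filter (fun q => n % q ∈ R q)) =
        (P.filter (fun q => n % q ∈ R q)).powerset := by
      ext U
      simp only [Finset.mem_filter, Finset.mem_powerset]
      exact ⟨fun h => h.2, fun h => ⟨h.trans (Finset.filter_subset _ _), h⟩⟩
    rw [e1]
    refine le_trans (le_of_eq ?_) hb
    simp only [Finset.filter_eq_empty_iff]
  have h2 : ∀ U ∈ P.powerset, (if U.card ≤ 2 * t then (-1 : ℝ) ^ U.card else 0) *
        (((Finset.Ioc 0 M).filter fun n => ∀ q ∈ U, n % q ∈ R q).card : ℝ) ≤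
      M * ((-1 : ℝ) ^ U.card * X U + (1 / 2) ^ (2 * t) * (2 ^ U.card * X U)) +
        (z : ℝ) ^ (2 * t) * ∏ q ∈ U, ((κ : ℝ) / z) := by
    intro U hU
    rw [Finset.mem_powerset] at hU
    have hz' : (1 : ℝ) ≤ z := by exact_mod_cast hz
    have hz0 : (z : ℝ) ≠ 0 := by positivity
    have hE : 0 ≤ (z : ℝ) ^ (2 * t) * ∏ q ∈ U, ((κ : ℝ) / z) :=
      mul_nonneg (by positivity) (Finset.prod_nonneg fun q _ => by positivity)
    have hpow : |(-1 : ℝ) ^ U.card| = 1 := by rw [abs_pow]; simp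
    have hM : (0 : ℝ) ≤ M := Nat.cast_nonneg M
    split_ifs with h
    · have hc := abs_card_filter_residues_sub_le M κ R U (fun q hq => hP q (hU hq))
        (fun q hq => hR q (hU hq)) (fun q hq => hRq q (hU hq)) 0 1 one_pos (by simp)
      simp only [Nat.modEq_one, true_and, Nat.cast_one, div_one] at hc
      have h3 : (κ : ℝ) ^ U.card ≤ (z : ℝ) ^ (2 * t) * ∏ q ∈ U, ((κ : ℝ) / z) := by
        rw [Finset.prod_const, div_pow]
        have : (z : ℝ) ^ U.card ≤ (z : ℝ) ^ (2 * t) := pow_le_pow_right₀ hz' h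
        rw [mul_div_assoc', le_div_iff₀ (by positivity), mul_comm]
        gcongr
      set N : ℝ := (((Finset.Ioc 0 M).filter fun n => ∀ q ∈ U, n % q ∈ R q).card : ℝ)
      have h4 : (-1 : ℝ) ^ U.card * N - (-1 : ℝ) ^ U.card * (M * X U) ≤ (κ : ℝ) ^ U.card := by
        rw [← mul_sub]
        refine (le_abs_self _).trans ?_
        rw [abs_mul, hpow, one_mul]; exact hc
      have h5 : 0 ≤ (M : ℝ) * ((1 / 2) ^ (2 * t) * (2 ^ U.card * X U)) :=
        mul_nonneg hM (mul_nonneg (by positivity) (mul_nonneg (by positivity) (hX0 U)))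
      nlinarith
    · rw [zero_mul]
      have h3 : 1 ≤ (1 / 2 : ℝ) ^ (2 * t) * 2 ^ U.card := by
        have : (2 : ℝ) ^ (2 * t) ≤ 2 ^ U.card := pow_le_pow_right₀ (by norm_num) (by omega)
        rw [one_div, inv_pow, inv_mul_eq_div, le_div_iff₀ (by positivity)]; linarith
      have h4 : -X U ≤ (-1 : ℝ) ^ U.card * X U := by
        have : -1 ≤ (-1 : ℝ) ^ U.card := by
          have := neg_abs_le ((-1 : ℝ) ^ U.card); rwa [hpow] at this
        nlinarith [hX0 U]
      have h5 : X U ≤ (1 / 2) ^ (2 * t) * (2 ^ U.card * X U) := by nlinarith [hX0 U]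
      have : 0 ≤ (M : ℝ) * ((-1 : ℝ) ^ U.card * X U + (1 / 2) ^ (2 * t) * (2 ^ U.card * X U)) :=
        mul_nonneg hM (by linarith)
      linarith
  refine h1.trans ((Finset.sum_le_sum h2).trans ?_)
  rw [Finset.sum_add_distrib, ← Finset.mul_sum, ← Finset.mul_sum, Finset.sum_add_distrib,
    ← Finset.mul_sum]
  have e1 : ∑ U ∈ P.powerset, (-1 : ℝ) ^ U.card * X U = ∏ q ∈ P, (1 + -((κ : ℝ) / q)) := by
    rw [Finset.prod_one_add]
    exact Finset.sum_congr rfl fun U _ => by rw [Finset.prod_neg]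
  have e2 : ∑ U ∈ P.powerset, (2 : ℝ) ^ U.card * X U = ∏ q ∈ P, (1 + 2 * ((κ : ℝ) / q)) := by
    rw [Finset.prod_one_add]
    exact Finset.sum_congr rfl fun U _ => by rw [Finset.prod_mul_distrib, Finset.prod_const]
  rw [e1, e2, ← Finset.prod_one_add]
  have hM : (0 : ℝ) ≤ M := Nat.cast_nonneg M
  have b1 : ∏ q ∈ P, (1 + -((κ : ℝ) / q)) ≤ Real.exp (-(κ * ∑ q ∈ P, (1 : ℝ) / q)) := by
    rw [Finset.mul_sum, ← Finset.sum_neg_distrib, Real.exp_sum]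
    refine Finset.prod_le_prod (fun q hq => ?_) fun q _ => ?_
    · have : (κ : ℝ) / q ≤ 1 := div_le_one_of_le₀ (by exact_mod_cast hκ q hq) (by positivity)
      linarith
    · rw [mul_one_div, add_comm]; exact Real.add_one_le_exp _
  have b2 : ∏ q ∈ P, (1 + 2 * ((κ : ℝ) / q)) ≤ Real.exp (2 * κ * ∑ q ∈ P, (1 : ℝ) / q) := by
    rw [Finset.mul_sum, Real.exp_sum]
    refine Finset.prod_le_prod (fun q hq => by positivity) fun q _ => ?_
    rw [add_comm, mul_one_div, mul_div_assoc']; exact Real.add_one_le_exp _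
  have b3 : ∏ q ∈ P, (1 + (κ : ℝ) / z) ≤ Real.exp κ := by
    refine (Finset.prod_le_prod (g := fun _ => Real.exp ((κ : ℝ) / z)) (fun q hq => by positivity)
      fun q _ => by rw [add_comm]; exact Real.add_one_le_exp _).trans ?_
    rw [← Real.exp_sum, Finset.sum_const, nsmul_eq_mul]
    refine Real.exp_le_exp.2 ?_
    have hz0 : (0 : ℝ) < z := by exact_mod_cast hz
    rw [mul_div_assoc', div_le_iff₀ hz0, mul_comm]
    have : (P.card : ℝ) ≤ z := by exact_mod_cast hPz
    gcongr
  gcongr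

theorem sum_primeFactors_inv_le {K : ℝ} (hK : ∀ N : ℕ, 2 ≤ N →
      |∑ p ∈ primesUpTo N, (1 : ℝ) / p - Real.log (Real.log N)| ≤ K)
    (D N : ℕ) (hD : 0 < D) (hN : 2 ≤ N) (hDN : Real.log D ≤ N) :
    ∑ q ∈ D.primeFactors, (1 : ℝ) / q ≤ Real.log (Real.log N) + K + 2 := by
  rw [← Finset.sum_filter_add_sum_filter_not _ (fun q => q ≤ N)]
  have h1 : ∑ q ∈ D.primeFactors.filter (fun q => q ≤ N), (1 : ℝ) / q ≤
      ∑ p ∈ primesUpTo N, (1 : ℝ) / p := by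
    refine Finset.sum_le_sum_of_subset_of_nonneg ?_ fun _ _ _ => by positivity
    intro q hq
    rw [Finset.mem_filter] at hq
    exact mem_primesUpTo.2 ⟨Nat.prime_of_mem_primeFactors hq.1, hq.2⟩
  have h2 := (abs_le.1 (hK N hN)).2
  have hcard : (2 : ℕ) ^ D.primeFactors.card ≤ D := by
    refine le_trans ?_ (Nat.le_of_dvd hD (Nat.prod_primeFactors_dvd D))
    exact Finset.pow_card_le_prod _ _ _ fun q hq => (Nat.prime_of_mem_primeFactors hq).two_le
  have hcard' : D.primeFactors.card * Real.log 2 ≤ N := by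
    refine le_trans ?_ hDN
    rw [← Real.log_pow]
    exact Real.log_le_log (by positivity) (by exact_mod_cast hcard)
  have hN0 : (0 : ℝ) < N := by exact_mod_cast (by omega : 0 < N)
  have h3 : ∑ q ∈ D.primeFactors.filter (fun q => ¬ q ≤ N), (1 : ℝ) / q ≤ 2 := by
    refine (Finset.sum_le_card_nsmul _ _ (1 / (N : ℝ)) fun q hq => ?_).trans ?_
    · have := (Finset.mem_filter.1 hq).2
      exact one_div_le_one_div_of_le hN0 (by exact_mod_cast (not_le.1 this).le)
    · rw [nsmul_eq_mul, mul_one_div, div_le_iff₀ hN0]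
      have : ((D.primeFactors.filter (fun q => ¬ q ≤ N)).card : ℝ) ≤ D.primeFactors.card := by
        exact_mod_cast Finset.card_filter_le _ _
      nlinarith [Real.log_two_gt_d9]
  linarith

/-- The residue classes modulo `q` to be avoided by primes `P` with all `a * P - 1` prime. -/
def sieveResidues (T : Finset ℕ) (q : ℕ) : Finset ℕ :=
  insert 0 (T.image fun a : ℕ => ((a : ZMod q)⁻¹).val)

/-- A nonzero number divisible by the primes at which the residues `sieveResidues` collide. -/
def sieveDisc (T : Finset ℕ) : ℕ :=
  (∏ a ∈ T, a) * ∏ b ∈ (T ×ˢ T).filter (fun b => b.2 < b.1), (b.1 - b.2)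

theorem card_sieveResidues {T : Finset ℕ} {q : ℕ} (hq : q.Prime) (hD : ¬ q ∣ sieveDisc T) :
    (sieveResidues T q).card = T.card + 1 := by
  have : Fact q.Prime := ⟨hq⟩
  have hna : ∀ a ∈ T, (a : ZMod q) ≠ 0 := fun a ha h => by
    rw [ZMod.natCast_eq_zero_iff] at h
    exact hD ((h.trans (Finset.dvd_prod_of_mem _ ha)).trans (Dvd.intro _ rfl))
  have hnab : ∀ a ∈ T, ∀ b ∈ T, b < a → (a : ZMod q) ≠ b := fun a ha b hb hab h => by
    have : q ∣ a - b := by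
      rw [← ZMod.natCast_eq_zero_iff, Nat.cast_sub hab.le, h, sub_self]
    refine hD ((this.trans ?_).trans (Dvd.intro_left _ rfl))
    exact Finset.dvd_prod_of_mem (fun b : ℕ × ℕ => b.1 - b.2)
      (show (a, b) ∈ (T ×ˢ T).filter (fun b => b.2 < b.1) by simp [ha, hb, hab])
  rw [sieveResidues, Finset.card_insert_of_notMem, Finset.card_image_of_injOn]
  · intro a ha b hb h
    have h' : (a : ZMod q) = b := by
      have := ZMod.val_injective q h
      exact inv_injective this
    rcases lt_trichotomy a b with hlt | hlt | hlt
    · exact absurd h'.symm (hnab b hb a ha hlt)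
    · exact hlt
    · exact absurd h' (hnab a ha b hb hlt)
  · intro h
    obtain ⟨a, ha, h⟩ := Finset.mem_image.1 h
    rw [ZMod.val_eq_zero, inv_eq_zero] at h
    exact hna a ha h

theorem notMem_sieveResidues {T : Finset ℕ} {q P : ℕ} (hq : q.Prime) (hD : ¬ q ∣ sieveDisc T)
    (hP : P.Prime) (hqP : q < P) (h : ∀ a ∈ T, (a * P - 1).Prime ∧ q < a * P - 1) :
    P % q ∉ sieveResidues T q := by
  have : Fact q.Prime := ⟨hq⟩
  rw [sieveResidues, Finset.mem_insert]
  rintro (h0 | h0)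
  · exact hqP.ne ((Nat.prime_dvd_prime_iff_eq hq hP).1 (Nat.dvd_of_mod_eq_zero h0))
  · obtain ⟨a, ha, h0⟩ := Finset.mem_image.1 h0
    have hna : (a : ZMod q) ≠ 0 := fun h => by
      rw [ZMod.natCast_eq_zero_iff] at h
      exact hD ((h.trans (Finset.dvd_prod_of_mem _ ha)).trans (Dvd.intro _ rfl))
    have h1 : (P : ZMod q) = (a : ZMod q)⁻¹ := by
      rw [← ZMod.val_natCast] at h0
      exact (ZMod.val_injective q h0).symm
    obtain ⟨hp, hlt⟩ := h a ha
    have : q ∣ a * P - 1 := by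
      rw [← ZMod.natCast_eq_zero_iff, Nat.cast_sub (by omega)]
      push_cast
      rw [h1, mul_inv_cancel₀ hna, sub_self]
    exact hlt.ne ((Nat.prime_dvd_prime_iff_eq hq hp).1 this)

theorem sieveDisc_pos {T : Finset ℕ} (hT : ∀ a ∈ T, 1 ≤ a) : 0 < sieveDisc T := by
  refine Nat.mul_pos (Finset.prod_pos hT) (Finset.prod_pos fun b hb => ?_)
  have := (Finset.mem_filter.1 hb).2
  omega

theorem log_sieveDisc_le {T : Finset ℕ} {Y : ℝ} (hT : ∀ a ∈ T, 1 ≤ a) (hT2 : T.card ≤ 2)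
    (hY : 0 ≤ Y) (hTY : ∀ a ∈ T, Real.log a ≤ Y) : Real.log (sieveDisc T) ≤ 6 * Y := by
  rw [sieveDisc]
  push_cast
  have h1 : ∀ a ∈ T, (a : ℝ) ≠ 0 := fun a ha => by
    have := hT a ha; positivity
  have h2 : ∀ b ∈ (T ×ˢ T).filter (fun b => b.2 < b.1), ((b.1 - b.2 : ℕ) : ℝ) ≠ 0 := fun b hb => by
    have := (Finset.mem_filter.1 hb).2
    exact_mod_cast (by omega : b.1 - b.2 ≠ 0)
  rw [Real.log_mul (Finset.prod_ne_zero_iff.2 h1) (Finset.prod_ne_zero_iff.2 h2),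
    Real.log_prod h1, Real.log_prod h2]
  have b1 := Finset.sum_le_card_nsmul T (fun a => Real.log (a : ℝ)) Y hTY
  have b2 := Finset.sum_le_card_nsmul ((T ×ˢ T).filter (fun b => b.2 < b.1))
    (fun b => Real.log ((b.1 - b.2 : ℕ) : ℝ)) Y (fun b hb => by
      have hb' := Finset.mem_filter.1 hb
      have : b.1 - b.2 ≤ b.1 := Nat.sub_le _ _
      refine le_trans (Real.log_le_log ?_ (by exact_mod_cast this))
        (hTY b.1 (Finset.mem_product.1 hb'.1).1)
      have := h2 b hb
      positivity)
  rw [nsmul_eq_mul] at b1 b2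
  have c1 : (T.card : ℝ) ≤ 2 := by exact_mod_cast hT2
  have c2 : (((T ×ˢ T).filter (fun b => b.2 < b.1)).card : ℝ) ≤ 4 := by
    have := (Finset.card_filter_le (T ×ˢ T) (fun b => b.2 < b.1))
    rw [Finset.card_product] at this
    have : ((T ×ˢ T).filter (fun b => b.2 < b.1)).card ≤ 4 := by nlinarith
    exact_mod_cast this
  nlinarith

set_option maxHeartbeats 1000000 in
/-- An upper bound for the number of primes `P ≤ M` with all `a * P - 1`, `a ∈ T`, prime. -/
theorem exists_sieve_bound : ∃ L₀ : ℝ, 1 ≤ L₀ ∧ ∀ L : ℝ, L₀ ≤ L → ∀ T : Finset ℕ, T.card ≤ 2 →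
    (∀ a ∈ T, 1 ≤ a) → (∀ a ∈ T, Real.log a ≤ Real.exp L) → ∀ M : ℕ, 1 ≤ M →
    Real.log M ≤ Real.exp L →
    (((Finset.Ioc 0 M).filter fun P => P.Prime ∧ ∀ a ∈ T, (a * P - 1).Prime).card : ℝ) *
      Real.log M ^ (T.card + 1) ≤ L ^ 30 * M := by
  obtain ⟨K, hK0, hK⟩ := exists_abs_sum_primes_inv_sub_log_log_le
  have hE0 := Real.exp_pos (2 * K + 3)
  have hE1 := Real.exp_pos (6 * K)
  refine ⟨400 * Real.exp (2 * K + 3) + Real.exp (6 * K) + 1104 + 400, by linarith, ?_⟩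
  intro L hL T hT hT1 hTL M hM hML
  have hL400 : 400 ≤ L := by linarith
  have hM0 : (1 : ℝ) ≤ M := by exact_mod_cast hM
  set ℓ := Real.log M with hℓ
  have hℓ0 : 0 ≤ ℓ := Real.log_nonneg hM0
  have hMexp : (M : ℝ) = Real.exp ℓ := by rw [hℓ, Real.exp_log (by linarith)]
  set κ := T.card + 1 with hκ
  have hκ3 : κ ≤ 3 := by omega
  set count : ℝ :=
    (((Finset.Ioc 0 M).filter fun P => P.Prime ∧ ∀ a ∈ T, (a * P - 1).Prime).card : ℝ) with hcount
  have hcountM : count ≤ M := by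
    have := Finset.card_filter_le (Finset.Ioc 0 M) (fun P => P.Prime ∧ ∀ a ∈ T, (a * P - 1).Prime)
    rw [Nat.card_Ioc, Nat.sub_zero] at this
    rw [hcount]
    exact_mod_cast this
  rcases le_or_gt ℓ (L ^ 10) with hsmall | hlarge
  · have h1 : ℓ ^ κ ≤ L ^ 30 :=
      calc ℓ ^ κ ≤ (L ^ 10) ^ κ := pow_le_pow_left₀ hℓ0 hsmall _
        _ ≤ (L ^ 10) ^ 3 := pow_le_pow_right₀ (one_le_pow₀ (by linarith)) hκ3
        _ = L ^ 30 := by ring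
    calc count * ℓ ^ κ ≤ M * L ^ 30 := by gcongr
      _ = _ := by ring
  -- parameters of the sieve
  have hL0 : 0 < L := by linarith
  have hℓ1 : 1 ≤ ℓ := (one_le_pow₀ (by linarith)).trans hlarge.le
  set y := ℓ / (100 * L) with hy
  have hy4 : 4 ≤ y := by
    rw [hy, le_div_iff₀ (by positivity)]
    have : L ^ 2 ≤ L ^ 10 := pow_le_pow_right₀ (by linarith) (by norm_num)
    nlinarith
  set z := ⌊Real.exp y⌋₊ with hz
  set t := ⌈10 * L⌉₊ with ht
  have hzy : (z : ℝ) ≤ Real.exp y := Nat.floor_le (Real.exp_pos _).le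
  have hzy' : Real.exp (y / 2) ≤ z := by
    have h1 : Real.exp y < z + 1 := Nat.lt_floor_add_one _
    have h2 : Real.exp y = Real.exp (y / 2) * Real.exp (y / 2) := by rw [← Real.exp_add]; ring_nf
    have h3 : y / 2 + 1 ≤ Real.exp (y / 2) := Real.add_one_le_exp _
    nlinarith
  have hz2 : 2 ≤ z := by
    have h3 : y / 2 + 1 ≤ Real.exp (y / 2) := Real.add_one_le_exp _
    have : (2 : ℝ) ≤ z := by linarith
    exact_mod_cast this
  have hz0 : (0 : ℝ) < z := by exact_mod_cast (by omega : 0 < z)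
  have hlogz1 : y / 2 ≤ Real.log z := (Real.le_log_iff_exp_le hz0).2 hzy'
  have hlogz2 : Real.log z ≤ y := (Real.log_le_iff_le_exp hz0).2 hzy
  set P := (primesUpTo z).filter fun q => 3 < q ∧ ¬ q ∣ sieveDisc T with hP
  have hPprime : ∀ q ∈ P, q.Prime := fun q hq => (mem_primesUpTo.1 (Finset.mem_filter.1 hq).1).1
  have hPz : ∀ q ∈ P, q ≤ z := fun q hq => (mem_primesUpTo.1 (Finset.mem_filter.1 hq).1).2
  have hPcard : P.card ≤ z := by
    have : P ⊆ Finset.Ioc 0 z := fun q hq => Finset.mem_Ioc.2 ⟨(hPprime q hq).pos, hPz q hq⟩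
    simpa using Finset.card_le_card this
  have hbrun := brun_pure_sieve M κ t z (by omega) (sieveResidues T) P hPprime hPcard
    (fun q hq => by have := (Finset.mem_filter.1 hq).2.1; omega)
    (fun q hq => card_sieveResidues (hPprime q hq) (Finset.mem_filter.1 hq).2.2)
    (fun q hq r hr => by
      have : Fact q.Prime := ⟨hPprime q hq⟩
      rcases Finset.mem_insert.1 hr with rfl | hr
      · exact (hPprime q hq).pos
      · obtain ⟨a, _, rfl⟩ := Finset.mem_image.1 hr
        exact ZMod.val_lt _)
  set s := ∑ q ∈ P, (1 : ℝ) / q with hs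
  have hs0 : 0 ≤ s := Finset.sum_nonneg fun q _ => by positivity
  -- comparing the prime tuples with the sifted set
  have hsub : ((Finset.Ioc 0 M).filter fun P => P.Prime ∧ ∀ a ∈ T, (a * P - 1).Prime) ⊆
      Finset.Ioc 0 (z + 1) ∪
        ((Finset.Ioc 0 M).filter fun n => ∀ q ∈ P, n % q ∉ sieveResidues T q) := by
    intro n hn
    obtain ⟨hnM, hnP, hnT⟩ := Finset.mem_filter.1 hn
    rw [Finset.mem_union]
    rcases le_or_gt n (z + 1) with h | h
    · exact Or.inl (Finset.mem_Ioc.2 ⟨hnP.pos, h⟩)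
    · refine Or.inr (Finset.mem_filter.2 ⟨hnM, fun q hq => ?_⟩)
      have hqz := hPz q hq
      refine notMem_sieveResidues (hPprime q hq) (Finset.mem_filter.1 hq).2.2 hnP (by omega)
        fun a ha => ⟨hnT a ha, ?_⟩
      have : n ≤ a * n := Nat.le_mul_of_pos_left n (hT1 a ha)
      omega
  have hcount2 : count ≤ (z + 1) +
      (((Finset.Ioc 0 M).filter fun n => ∀ q ∈ P, n % q ∉ sieveResidues T q).card : ℝ) := by
    have := (Finset.card_le_card hsub).trans (Finset.card_union_le _ _)
    rw [Nat.card_Ioc, Nat.sub_zero] at this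
    rw [hcount]
    exact_mod_cast this
  -- estimates for `s`
  have hlogy : Real.log y ≤ L := by
    rw [Real.log_le_iff_le_exp (by linarith)]
    refine le_trans ?_ hML
    exact div_le_self hℓ0 (by linarith)
  have hKz := abs_le.1 (hK z hz2)
  have hs_up : s ≤ L + K := by
    have h1 : s ≤ ∑ p ∈ primesUpTo z, (1 : ℝ) / p :=
      Finset.sum_le_sum_of_subset_of_nonneg (Finset.filter_subset _ _) fun _ _ _ => by positivity
    have h2 : Real.log (Real.log z) ≤ Real.log y := Real.log_le_log (by linarith) hlogz2
    linarith [hKz.2]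
  have hs_lo : Real.log (Real.log z) - Real.log (2 * L) - (2 * K + 3) ≤ s := by
    set N := ⌈6 * Real.exp L⌉₊ with hN
    have hexpL : L + 1 ≤ Real.exp L := Real.add_one_le_exp L
    have hN1 : 6 * Real.exp L ≤ N := Nat.le_ceil _
    have hN2 : (N : ℝ) < 6 * Real.exp L + 1 := Nat.ceil_lt_add_one (by positivity)
    have hNge : 2 ≤ N := by
      have : (2 : ℝ) ≤ N := by linarith
      exact_mod_cast this
    have hDN : Real.log (sieveDisc T) ≤ N :=
      (log_sieveDisc_le hT1 hT (Real.exp_pos L).le hTL).trans hN1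
    have hdiv := sum_primeFactors_inv_le hK (sieveDisc T) N (sieveDisc_pos hT1) hNge hDN
    have hNlog : Real.log N ≤ 2 * L := by
      rw [Real.log_le_iff_le_exp (by linarith)]
      have : Real.exp (2 * L) = Real.exp L * Real.exp L := by rw [← Real.exp_add]; ring_nf
      nlinarith
    have hNlog0 : 0 < Real.log N := Real.log_pos (by linarith)
    have hNll : Real.log (Real.log N) ≤ Real.log (2 * L) := Real.log_le_log hNlog0 hNlog
    have hsplit : ∑ p ∈ primesUpTo z, (1 : ℝ) / p ≤
        s + (∑ p ∈ ({2, 3} : Finset ℕ), (1 : ℝ) / p + ∑ q ∈ (sieveDisc T).primeFactors, (1 : ℝ) / q) := by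
      have hcov : primesUpTo z ⊆ P ∪ ({2, 3} ∪ (sieveDisc T).primeFactors) := by
        intro q hq
        have hqp := (mem_primesUpTo.1 hq).1
        by_cases h1 : q ∣ sieveDisc T
        · simp [Nat.mem_primeFactors, hqp, h1, (sieveDisc_pos hT1).ne']
        · by_cases h2 : 3 < q
          · exact Finset.mem_union_left _ (Finset.mem_filter.2 ⟨hq, h2, h1⟩)
          · have := hqp.two_le
            have : q = 2 ∨ q = 3 := by omega
            rcases this with rfl | rfl <;> simp
      have hunion : ∀ A B : Finset ℕ, ∑ q ∈ A ∪ B, (1 : ℝ) / q ≤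
          ∑ q ∈ A, (1 : ℝ) / q + ∑ q ∈ B, (1 : ℝ) / q := fun A B => by
        rw [← Finset.sum_union_inter]
        have : 0 ≤ ∑ q ∈ A ∩ B, (1 : ℝ) / q := Finset.sum_nonneg fun _ _ => by positivity
        linarith
      refine (Finset.sum_le_sum_of_subset_of_nonneg hcov fun _ _ _ => by positivity).trans ?_
      exact (hunion _ _).trans (add_le_add_right (hunion _ _) _)
    have h23 : ∑ p ∈ ({2, 3} : Finset ℕ), (1 : ℝ) / p ≤ 1 := by norm_num
    linarith [hKz.1]
  have hκ3' : (κ : ℝ) ≤ 3 := by exact_mod_cast hκ3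
  -- the main term
  have hmain : Real.exp (-(κ * s)) * ℓ ^ κ ≤ L ^ 9 := by
    have h1 : Real.exp (-s) * ℓ ≤ L ^ 3 := by
      have h2 : Real.exp (-s) ≤ Real.exp (2 * K + 3) * (2 * L) / Real.log z := by
        rw [← Real.exp_log (show 0 < Real.exp (2 * K + 3) * (2 * L) / Real.log z by
          have : 0 < Real.log z := by linarith
          positivity)]
        refine Real.exp_le_exp.2 ?_
        have : Real.log z ≠ 0 := by linarith
        rw [Real.log_div (by positivity) this, Real.log_mul (by positivity) (by positivity),
          Real.log_exp]
        linarith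
      have h3 : Real.exp (2 * K + 3) * (2 * L) / Real.log z ≤
          Real.exp (2 * K + 3) * (2 * L) / (y / 2) := by gcongr
      calc Real.exp (-s) * ℓ ≤ Real.exp (2 * K + 3) * (2 * L) / (y / 2) * ℓ :=
            mul_le_mul_of_nonneg_right (h2.trans h3) hℓ0
        _ = 400 * Real.exp (2 * K + 3) * L ^ 2 := by
          rw [hy]; field_simp; ring
        _ ≤ L * L ^ 2 := by
          refine mul_le_mul_of_nonneg_right ?_ (by positivity)
          linarith
        _ = L ^ 3 := by ring
    calc Real.exp (-(κ * s)) * ℓ ^ κ = (Real.exp (-s) * ℓ) ^ κ := by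
          rw [mul_pow, ← Real.exp_nat_mul]; ring_nf
      _ ≤ (L ^ 3) ^ κ := pow_le_pow_left₀ (by positivity) h1 _
      _ ≤ (L ^ 3) ^ 3 := pow_le_pow_right₀ (one_le_pow₀ (by linarith)) hκ3
      _ = L ^ 9 := by ring
  have ht1 : 10 * L ≤ t := Nat.le_ceil _
  have ht2 : (t : ℝ) < 10 * L + 1 := Nat.ceil_lt_add_one (by positivity)
  have htail : (1 / 2) ^ (2 * t) * Real.exp (2 * κ * s) * ℓ ^ κ ≤ Real.exp (6 * K) := by
    have h1 : (1 / 2 : ℝ) ^ (2 * t) ≤ Real.exp (-(13 * L)) := by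
      have : (1 / 2 : ℝ) = Real.exp (-Real.log 2) := by
        rw [Real.exp_neg, Real.exp_log (by norm_num), one_div]
      rw [this, ← Real.exp_nat_mul]
      refine Real.exp_le_exp.2 ?_
      push_cast
      nlinarith [Real.log_two_gt_d9]
    have h2 : Real.exp (2 * κ * s) ≤ Real.exp (6 * (L + K)) := Real.exp_le_exp.2 <| by
      calc 2 * κ * s ≤ 2 * 3 * (L + K) := by gcongr
        _ = 6 * (L + K) := by ring
    have h3 : ℓ ^ κ ≤ Real.exp (3 * L) := by
      calc ℓ ^ κ ≤ ℓ ^ 3 := pow_le_pow_right₀ hℓ1 hκ3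
        _ ≤ (Real.exp L) ^ 3 := pow_le_pow_left₀ hℓ0 hML _
        _ = Real.exp (3 * L) := by rw [← Real.exp_nat_mul]; push_cast; ring_nf
    calc (1 / 2) ^ (2 * t) * Real.exp (2 * κ * s) * ℓ ^ κ ≤
          Real.exp (-(13 * L)) * Real.exp (6 * (L + K)) * Real.exp (3 * L) := by gcongr
      _ = Real.exp (-(13 * L) + 6 * (L + K) + 3 * L) := by rw [Real.exp_add, Real.exp_add]
      _ ≤ Real.exp (6 * K) := Real.exp_le_exp.2 (by linarith)
  have herr : ((z + 1) + (z : ℝ) ^ (2 * t) * Real.exp κ) * ℓ ^ κ ≤ 1104 * M := by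
    have hexp3 : Real.exp κ ≤ 21 := by
      have h1 : Real.exp κ ≤ Real.exp 1 ^ 3 := by
        rw [← Real.exp_nat_mul]; exact Real.exp_le_exp.2 (by push_cast; linarith)
      have h2 : Real.exp 1 ^ 3 ≤ 2.7182818286 ^ 3 :=
        pow_le_pow_left₀ (Real.exp_pos 1).le Real.exp_one_lt_d9.le 3
      exact h1.trans (h2.trans (by norm_num))
    have hyL : y * (25 * L) = ℓ / 4 := by rw [hy]; field_simp; ring
    have h1 : (z : ℝ) ^ (2 * t) ≤ Real.exp (ℓ / 4) := by
      calc (z : ℝ) ^ (2 * t) ≤ (Real.exp y) ^ (2 * t) := pow_le_pow_left₀ hz0.le hzy _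
        _ = Real.exp ((2 * t : ℕ) * y) := by rw [← Real.exp_nat_mul]
        _ ≤ Real.exp (ℓ / 4) := by
          refine Real.exp_le_exp.2 ?_
          rw [← hyL]; push_cast; nlinarith
    have h2 : (z : ℝ) + 1 ≤ 2 * Real.exp (ℓ / 4) := by
      have : Real.exp y ≤ Real.exp (ℓ / 4) := Real.exp_le_exp.2 (by rw [← hyL]; nlinarith)
      have : 1 ≤ Real.exp y := Real.one_le_exp (by linarith)
      linarith
    have h3 : ℓ ^ κ ≤ 48 * Real.exp (ℓ / 2) := by
      refine (pow_le_pow_right₀ hℓ1 hκ3).trans ?_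
      have := Real.pow_div_factorial_le_exp (ℓ / 2) (by linarith) 3
      norm_num [Nat.factorial] at this
      linarith
    have h4 : (z + 1) + (z : ℝ) ^ (2 * t) * Real.exp κ ≤ 23 * Real.exp (ℓ / 4) := by
      have : (z : ℝ) ^ (2 * t) * Real.exp κ ≤ Real.exp (ℓ / 4) * 21 := by gcongr
      linarith
    calc ((z + 1) + (z : ℝ) ^ (2 * t) * Real.exp κ) * ℓ ^ κ ≤
          (23 * Real.exp (ℓ / 4)) * (48 * Real.exp (ℓ / 2)) := by gcongr
      _ = 1104 * Real.exp (ℓ / 4 + ℓ / 2) := by rw [Real.exp_add]; ring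
      _ ≤ 1104 * Real.exp ℓ := by
        have : Real.exp (ℓ / 4 + ℓ / 2) ≤ Real.exp ℓ := Real.exp_le_exp.2 (by linarith)
        linarith
      _ = 1104 * M := by rw [hMexp]
  have hℓκ : 0 ≤ ℓ ^ κ := by positivity
  calc count * ℓ ^ κ ≤ ((z + 1) + (M * (Real.exp (-(κ * s)) + (1 / 2) ^ (2 * t) * Real.exp (2 * κ * s))
        + (z : ℝ) ^ (2 * t) * Real.exp κ)) * ℓ ^ κ :=
        mul_le_mul_of_nonneg_right (hcount2.trans (add_le_add_right hbrun _)) hℓκ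
    _ = M * (Real.exp (-(κ * s)) * ℓ ^ κ) + M * ((1 / 2) ^ (2 * t) * Real.exp (2 * κ * s) * ℓ ^ κ) +
        ((z + 1) + (z : ℝ) ^ (2 * t) * Real.exp κ) * ℓ ^ κ := by ring
    _ ≤ M * L ^ 9 + M * Real.exp (6 * K) + 1104 * M := by gcongr
    _ = (L ^ 9 + (Real.exp (6 * K) + 1104)) * M := by ring
    _ ≤ L ^ 30 * M := by
      refine mul_le_mul_of_nonneg_right ?_ (by linarith)
      have h1 : L ^ 10 ≤ L ^ 30 := pow_le_pow_right₀ (by linarith) (by norm_num)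
      have h2 : L ≤ L ^ 9 := le_self_pow₀ (by linarith) (by norm_num)
      have h3 : L ^ 10 = L * L ^ 9 := by ring
      nlinarith

/-- Primes `P ≤ N` with `log P ≥ Z` and all `a * P - 1`, `a ∈ T`, prime. -/
noncomputable def sievedPrimes (N : ℕ) (T : Finset ℕ) (Z : ℝ) : Finset ℕ :=
  (Finset.Ioc 0 N).filter fun P => P.Prime ∧ (∀ a ∈ T, (a * P - 1).Prime) ∧ Z ≤ Real.log P

/-- The reciprocal sum bounds provided by the sieve. -/
def SieveBound (N : ℕ) (κ : ℝ) : Prop :=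
  ∀ T : Finset ℕ, T.Nonempty → T.card ≤ 2 → (∀ a ∈ T, 1 ≤ a ∧ a ≤ N) → ∀ Z : ℝ, 1 ≤ Z →
    ∑ P ∈ sievedPrimes N T Z, (1 : ℝ) / P ≤ κ / Z ^ T.card ∧
    ∀ B Y : ℝ, 1 ≤ B → ∑ P ∈ (sievedPrimes N T Z).filter (fun P : ℕ => Y / B < P ∧ P ≤ Y), (1 : ℝ) / P ≤
      B * κ / Z ^ (T.card + 1)

theorem sum_inv_sq_le (Z : ℝ) (hZ : 1 ≤ Z) (J : ℕ) :
    ∑ n ∈ (Finset.range J).filter (fun n : ℕ => Z ≤ n), (1 : ℝ) / (n : ℝ) ^ 2 ≤ 2 / Z := by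
  have h1 : ∀ J : ℕ, ∑ n ∈ (Finset.range J).filter (fun n : ℕ => Z ≤ n), (1 : ℝ) / (n : ℝ) ^ 2 ≤
      if Z ≤ J then 2 / Z - 2 / J else 0 := by
    intro J
    induction J with
    | zero => rw [if_neg (by push_cast; linarith)]; simp
    | succ J ih =>
      rw [Finset.range_add_one, Finset.filter_insert]
      split_ifs at ih ⊢ with a b c
      · rw [Finset.sum_insert (by simp)]
        have hJ : (1 : ℝ) ≤ J := by linarith
        have : (1 : ℝ) / (J : ℝ) ^ 2 ≤ 2 / J - 2 / (J + 1 : ℕ) := by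
          push_cast
          rw [div_sub_div _ _ (by positivity) (by positivity), div_le_div_iff₀ (by positivity) (by positivity)]
          nlinarith
        linarith
      · exfalso; push_cast at b; linarith
      · have : (2 : ℝ) / (J + 1 : ℕ) ≤ 2 / Z := by
          apply div_le_div_of_nonneg_left <;> linarith
        linarith
      · exact ih
  refine (h1 J).trans ?_
  split_ifs with h
  · have : (0 : ℝ) ≤ 2 / J := by positivity
    linarith
  · positivity

theorem exists_sieveBound : ∃ L₀ : ℝ, 1 ≤ L₀ ∧ ∀ L : ℝ, L₀ ≤ L → ∀ N : ℕ,
    Real.log N ≤ Real.exp L → SieveBound N (L ^ 40) := by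
  obtain ⟨L₀, hL₀, hS⟩ := exists_sieve_bound
  refine ⟨L₀ + 3, by linarith, fun L hL N hN T hTne hT hTN Z hZ => ?_⟩
  have hL3 : 4 ≤ L := by linarith
  have hexp : Real.exp L + 1 ≤ Real.exp (L + 1) := by
    rw [Real.exp_add]
    have h1 : 2 ≤ Real.exp 1 := by linarith [Real.exp_one_gt_d9]
    have h2 : 1 ≤ Real.exp L := Real.one_le_exp (by linarith)
    nlinarith
  have hT1 : ∀ a ∈ T, 1 ≤ a := fun a ha => (hTN a ha).1
  have hTL : ∀ a ∈ T, Real.log a ≤ Real.exp (L + 1) := fun a ha => by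
    have h1 := hTN a ha
    have : Real.log a ≤ Real.log N := Real.log_le_log (by exact_mod_cast h1.1) (by exact_mod_cast h1.2)
    linarith
  set κ := (L + 1) ^ 30 with hκ
  have hκ0 : 0 ≤ κ := by positivity
  have hκL : 32 * κ ≤ L ^ 40 := by
    have h1 : κ ≤ (5 / 4 * L) ^ 30 := pow_le_pow_left₀ (by linarith) (by linarith) _
    have h2 : (4 : ℝ) ^ 10 ≤ L ^ 10 := pow_le_pow_left₀ (by norm_num) hL3 _
    calc 32 * κ ≤ 32 * (5 / 4 * L) ^ 30 := by linarith
      _ = (32 * (5 / 4) ^ 30) * L ^ 30 := by ring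
      _ ≤ 4 ^ 10 * L ^ 30 := mul_le_mul_of_nonneg_right (by norm_num) (by positivity)
      _ ≤ L ^ 10 * L ^ 30 := by gcongr
      _ = L ^ 40 := by ring
  have hcount : ∀ M : ℕ, 1 ≤ M → Real.log M ≤ Real.exp (L + 1) →
      (((Finset.Ioc 0 M).filter fun P => P.Prime ∧ ∀ a ∈ T, (a * P - 1).Prime).card : ℝ) *
      Real.log M ^ (T.card + 1) ≤ κ * M := fun M hM hML =>
    hS (L + 1) (by linarith) T hT hT1 hTL M hM hML
  have hm : 1 ≤ T.card := Finset.card_pos.2 hTne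
  set m := T.card with hm_def
  constructor
  · have hmaps : ∀ P ∈ sievedPrimes N T Z, Nat.log 2 P + 1 ∈ Finset.range (N + 2) := by
      intro P hP
      have := (Finset.mem_Ioc.1 (Finset.mem_filter.1 hP).1).2
      have h2 := Nat.log_le_self 2 P
      exact Finset.mem_range.2 (by omega)
    rw [← Finset.sum_fiberwise_of_maps_to hmaps]
    have hfib : ∀ n ∈ Finset.range (N + 2), ∑ P ∈ (sievedPrimes N T Z).filter
        (fun P => Nat.log 2 P + 1 = n), (1 : ℝ) / P ≤
        if Z ≤ n then 16 * κ / Z ^ (m - 1) * (1 / (n : ℝ) ^ 2) else 0 := by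
      intro n _
      rcases (Finset.filter (fun P => Nat.log 2 P + 1 = n) (sievedPrimes N T Z)).eq_empty_or_nonempty
        with he | ⟨P, hP⟩
      · rw [he, Finset.sum_empty]; split_ifs <;> positivity
      obtain ⟨hP, hPn⟩ := Finset.mem_filter.1 hP
      obtain ⟨hPN, hPp, hPT, hPZ⟩ := Finset.mem_filter.1 hP
      have hlt : ∀ P : ℕ, Nat.log 2 P + 1 = n → P < 2 ^ n := fun P h => by
        rw [← h]; exact Nat.lt_pow_succ_log_self (by norm_num) P
      have hn0 : 0 < n := by omega
      have hlogn : Real.log ((2 ^ n : ℕ) : ℝ) = n * Real.log 2 := by push_cast; rw [Real.log_pow]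
      have hl2 : 1 / 2 ≤ Real.log 2 := by linarith [Real.log_two_gt_d9]
      have hl2' : Real.log 2 ≤ 1 := by linarith [Real.log_two_lt_d9]
      have hZn : Z ≤ n := by
        have h1 : Real.log P ≤ Real.log ((2 ^ n : ℕ) : ℝ) :=
          Real.log_le_log (by exact_mod_cast hPp.pos) (by exact_mod_cast (hlt P hPn).le)
        rw [hlogn] at h1
        have : (0 : ℝ) < n := by exact_mod_cast hn0
        nlinarith
      rw [if_pos hZn]
      have hn1 : (1 : ℝ) ≤ n := by exact_mod_cast hn0
      have hle : ∀ P : ℕ, 0 < P → Nat.log 2 P + 1 = n → 2 ^ n ≤ 2 * P := fun P h0 h => by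
        rw [← h, pow_succ, mul_comm]
        exact Nat.mul_le_mul_left 2 (Nat.pow_log_le_self 2 h0.ne')
      have hc := hcount (2 ^ n) Nat.one_le_two_pow (by
        have h1 : ((2 ^ n : ℕ) : ℝ) ≤ 2 * N := by
          have := hle P hPp.pos hPn
          have := (Finset.mem_Ioc.1 hPN).2
          exact_mod_cast (by omega : 2 ^ n ≤ 2 * N)
        have hN0 : (0 : ℝ) < N := by
          have := (Finset.mem_Ioc.1 hPN); exact_mod_cast (by omega : 0 < N)
        have := Real.log_le_log (by positivity) h1
        rw [Real.log_mul (by norm_num) hN0.ne'] at this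
        linarith)
      rw [hlogn] at hc
      set c : ℝ := (((Finset.Ioc 0 (2 ^ n)).filter fun P => P.Prime ∧ ∀ a ∈ T, (a * P - 1).Prime).card : ℝ)
        with hcdef
      have h1 : ∑ P ∈ (sievedPrimes N T Z).filter (fun P => Nat.log 2 P + 1 = n), (1 : ℝ) / P ≤
          c * (2 / 2 ^ n) := by
        refine (Finset.sum_le_card_nsmul _ _ (2 / 2 ^ n : ℝ) fun P hP => ?_).trans ?_
        · obtain ⟨hP, hPn⟩ := Finset.mem_filter.1 hP
          have hP0 := (Finset.mem_Ioc.1 (Finset.mem_filter.1 hP).1).1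
          have := hle P hP0 hPn
          rw [div_le_div_iff₀ (by exact_mod_cast hP0) (by positivity), one_mul]
          exact_mod_cast this
        · rw [nsmul_eq_mul]
          refine mul_le_mul_of_nonneg_right ?_ (by positivity)
          rw [hcdef]
          refine Nat.cast_le.2 (Finset.card_le_card fun P hP => ?_)
          obtain ⟨hP, hPn⟩ := Finset.mem_filter.1 hP
          obtain ⟨hPN, hPp, hPT, hPZ⟩ := Finset.mem_filter.1 hP
          exact Finset.mem_filter.2 ⟨Finset.mem_Ioc.2 ⟨hPp.pos, (hlt P hPn).le⟩, hPp, hPT⟩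
      have hm3 : m + 1 ≤ 3 := by omega
      have h2 : c * (n : ℝ) ^ (m + 1) ≤ 8 * κ * 2 ^ n := by
        have hc0 : 0 ≤ c := Nat.cast_nonneg _
        have h3 : (n : ℝ) ^ (m + 1) ≤ 8 * (n * Real.log 2) ^ (m + 1) := by
          calc (n : ℝ) ^ (m + 1) ≤ (2 * (n * Real.log 2)) ^ (m + 1) :=
                pow_le_pow_left₀ (by positivity) (by nlinarith) _
            _ = 2 ^ (m + 1) * (n * Real.log 2) ^ (m + 1) := by rw [mul_pow]
            _ ≤ 2 ^ 3 * (n * Real.log 2) ^ (m + 1) := by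
              gcongr; norm_num
            _ = _ := by norm_num
        calc c * (n : ℝ) ^ (m + 1) ≤ c * (8 * (n * Real.log 2) ^ (m + 1)) := by gcongr
          _ = 8 * (c * (n * Real.log 2) ^ (m + 1)) := by ring
          _ ≤ 8 * (κ * (2 ^ n : ℕ)) := by gcongr
          _ = _ := by push_cast; ring
      have h4 : Z ^ (m - 1) * (n : ℝ) ^ 2 ≤ (n : ℝ) ^ (m + 1) := by
        calc Z ^ (m - 1) * (n : ℝ) ^ 2 ≤ (n : ℝ) ^ (m - 1) * (n : ℝ) ^ 2 := by gcongr
          _ = (n : ℝ) ^ (m + 1) := by rw [← pow_add]; congr 1; omega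
      refine h1.trans ?_
      rw [div_mul_div_comm, mul_div_assoc', div_le_div_iff₀ (by positivity) (by positivity)]
      have hc0 : 0 ≤ c := Nat.cast_nonneg _
      calc c * 2 * (Z ^ (m - 1) * (n : ℝ) ^ 2) ≤ c * 2 * (n : ℝ) ^ (m + 1) := by gcongr
        _ = 2 * (c * (n : ℝ) ^ (m + 1)) := by ring
        _ ≤ 2 * (8 * κ * 2 ^ n) := by gcongr
        _ = _ := by ring
    refine (Finset.sum_le_sum hfib).trans ?_
    rw [← Finset.sum_filter, ← Finset.mul_sum]
    calc _ ≤ 16 * κ / Z ^ (m - 1) * (2 / Z) := by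
          gcongr; exact sum_inv_sq_le Z hZ _
      _ = 32 * κ / Z ^ m := by
          rw [div_mul_div_comm, ← pow_succ, show m - 1 + 1 = m by omega]; ring
      _ ≤ L ^ 40 / Z ^ m := by gcongr
  · intro B Y hB
    rcases (Finset.filter (fun P : ℕ => Y / B < P ∧ P ≤ Y) (sievedPrimes N T Z)).eq_empty_or_nonempty
      with he | ⟨P, hP⟩
    · rw [he, Finset.sum_empty]; positivity
    obtain ⟨hP, hPn⟩ := Finset.mem_filter.1 hP
    obtain ⟨hPN, hPp, hPT, hPZ⟩ := Finset.mem_filter.1 hP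
    set M := min N ⌊Y⌋₊ with hM
    have hY0 : 0 < Y := lt_of_lt_of_le (by exact_mod_cast hPp.pos) hPn.2
    have hMY : (M : ℝ) ≤ Y := le_trans (by exact_mod_cast min_le_right _ _) (Nat.floor_le hY0.le)
    have hPM : ∀ P ∈ Finset.filter (fun P : ℕ => Y / B < P ∧ P ≤ Y) (sievedPrimes N T Z), P ≤ M := by
      intro P hP
      obtain ⟨hP, hPn⟩ := Finset.mem_filter.1 hP
      exact le_min (Finset.mem_Ioc.1 (Finset.mem_filter.1 hP).1).2 (Nat.le_floor hPn.2)
    have hPM1 : P ≤ M := hPM P (by simp only [Finset.mem_filter]; exact ⟨hP, hPn⟩)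
    have hM1 : 1 ≤ M := hPp.one_le.trans hPM1
    have hM0 : (0 : ℝ) < M := by exact_mod_cast hM1
    have hMN : Real.log M ≤ Real.log N := Real.log_le_log hM0 (by exact_mod_cast min_le_left _ _)
    have hc := hcount M hM1 (by linarith)
    have hZM : Z ≤ Real.log M :=
      hPZ.trans (Real.log_le_log (by exact_mod_cast hPp.pos) (by exact_mod_cast hPM1))
    set c : ℝ := (((Finset.Ioc 0 M).filter fun P => P.Prime ∧ ∀ a ∈ T, (a * P - 1).Prime).card : ℝ)
        with hcdef
    have hc0 : 0 ≤ c := Nat.cast_nonneg _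
    have h1 : ∑ P ∈ (sievedPrimes N T Z).filter (fun P : ℕ => Y / B < P ∧ P ≤ Y), (1 : ℝ) / P ≤
          c * (B / M) := by
      refine (Finset.sum_le_card_nsmul _ _ (B / M : ℝ) fun P hP => ?_).trans ?_
      · obtain ⟨hP, hPn⟩ := Finset.mem_filter.1 hP
        have hP0 := (Finset.mem_Ioc.1 (Finset.mem_filter.1 hP).1).1
        rw [div_le_div_iff₀ (by exact_mod_cast hP0) hM0, one_mul]
        have := (div_lt_iff₀ (by linarith)).1 hPn.1
        linarith
      · rw [nsmul_eq_mul]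
        refine mul_le_mul_of_nonneg_right ?_ (by positivity)
        rw [hcdef]
        refine Nat.cast_le.2 (Finset.card_le_card fun P hP => ?_)
        have hPM := hPM P hP
        obtain ⟨hP, hPn⟩ := Finset.mem_filter.1 hP
        obtain ⟨hPN, hPp, hPT, hPZ⟩ := Finset.mem_filter.1 hP
        exact Finset.mem_filter.2 ⟨Finset.mem_Ioc.2 ⟨hPp.pos, hPM⟩, hPp, hPT⟩
    have h2 : c * Z ^ (m + 1) ≤ L ^ 40 * M := by
      calc c * Z ^ (m + 1) ≤ c * Real.log M ^ (m + 1) := by gcongr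
        _ ≤ κ * M := hc
        _ ≤ L ^ 40 * M := by gcongr; linarith
    refine h1.trans ?_
    rw [mul_div_assoc', div_le_div_iff₀ hM0 (by positivity)]
    nlinarith

/-- The largest prime factor (`0` for `0` and `1`). -/
def gpf (n : ℕ) : ℕ := n.primeFactors.sup id

theorem le_gpf {n q : ℕ} (hn : n ≠ 0) (hq : q.Prime) (h : q ∣ n) : q ≤ gpf n :=
  Finset.le_sup (f := id) (Nat.mem_primeFactors.2 ⟨hq, h, hn⟩)

theorem gpf_mem {n : ℕ} (h : 0 < gpf n) : (gpf n).Prime ∧ gpf n ∣ n := by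
  have hne : n.primeFactors.Nonempty := by
    rw [Finset.nonempty_iff_ne_empty]
    intro h0
    simp [gpf, h0] at h
  obtain ⟨q, hq, he⟩ := Finset.exists_mem_eq_sup _ hne id
  have : gpf n = q := he
  rw [this]
  exact ⟨Nat.prime_of_mem_primeFactors hq, Nat.dvd_of_mem_primeFactors hq⟩

theorem gpf_prod_le {C : Type*} {s : Finset C} {a : C → ℕ} (ha : ∀ c ∈ s, a c ≠ 0) {P : ℕ}
    (h : ∀ c ∈ s, gpf (a c) ≤ P) : gpf (∏ c ∈ s, a c) ≤ P := by
  refine Finset.sup_le fun q hq => ?_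
  have hqp := Nat.prime_of_mem_primeFactors hq
  obtain ⟨c, hc, hd⟩ := (hqp.prime.dvd_finsetProd_iff _).1 (Nat.dvd_of_mem_primeFactors hq)
  exact (le_gpf (ha c hc) hqp hd).trans (h c hc)

theorem Finset.sum_le_sum_of_surj {α β : Type*} {s : Finset α} {t : Finset β}
    (φ : β → α) (F : α → ℝ) (hF : ∀ a, 0 ≤ F a) (h : ∀ a ∈ s, ∃ b ∈ t, φ b = a) :
    ∑ a ∈ s, F a ≤ ∑ b ∈ t, F (φ b) := by
  classical
  rcases s.eq_empty_or_nonempty with rfl | ⟨a₀, ha₀⟩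
  · simpa using Finset.sum_nonneg fun b _ => hF (φ b)
  have : Nonempty β := ⟨(h a₀ ha₀).choose⟩
  choose! f hf hφ using h
  have hinj : Set.InjOn f s := fun a ha b hb e => by rw [← hφ a ha, ← hφ b hb, e]
  calc ∑ a ∈ s, F a = ∑ a ∈ s, F (φ (f a)) := Finset.sum_congr rfl fun a ha => by rw [hφ a ha]
    _ = ∑ b ∈ s.image f, F (φ b) := (Finset.sum_image (f := fun b => F (φ b)) hinj).symm
    _ ≤ ∑ b ∈ t, F (φ b) := Finset.sum_le_sum_of_subset_of_nonneg
        (Finset.image_subset_iff.2 hf) fun _ _ _ => hF _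

section Config

variable {C ι : Type} [Fintype C] [DecidableEq C] [DecidableEq ι]

/-- Configurations `a` of positive integers on the cells `C` for which the products over the lines
in `Λ` are distinct shifted primes `p + 1 ≤ N` with a large prime factor. -/
noncomputable def cfg (ln : ι → Finset C) (N : ℕ) (Z : ι → ℝ) (Λ : Finset ι) : Finset (C → ℕ) :=
  (Fintype.piFinset fun _ => Finset.Icc 1 N).filter fun a =>
    (∀ l ∈ Λ, (∏ c ∈ ln l, a c - 1).Prime ∧ ∏ c ∈ ln l, a c ≤ N ∧
      Z l ≤ Real.log (gpf (∏ c ∈ ln l, a c))) ∧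
    ∀ l ∈ Λ, ∀ l' ∈ Λ, l ≠ l' → ∏ c ∈ ln l, a c ≠ ∏ c ∈ ln l', a c

theorem mem_cfg {ln : ι → Finset C} {N : ℕ} {Z : ι → ℝ} {Λ : Finset ι} {a : C → ℕ} :
    a ∈ cfg ln N Z Λ ↔ (∀ c, a c ∈ Finset.Icc 1 N) ∧
      (∀ l ∈ Λ, (∏ c ∈ ln l, a c - 1).Prime ∧ ∏ c ∈ ln l, a c ≤ N ∧
        Z l ≤ Real.log (gpf (∏ c ∈ ln l, a c))) ∧
      ∀ l ∈ Λ, ∀ l' ∈ Λ, l ≠ l' → ∏ c ∈ ln l, a c ≠ ∏ c ∈ ln l', a c := by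
  rw [cfg, Finset.mem_filter, Fintype.mem_piFinset]

/-- The lines of `Λ` through the cell `c`. -/
def linesThrough (ln : ι → Finset C) (Λ : Finset ι) (c : C) : Finset ι := Λ.filter fun l => c ∈ ln l

/-- The products over the lines of `Λ` through the cell `c`. -/
def lineProds (ln : ι → Finset C) (Λ : Finset ι) (c : C) (a : C → ℕ) : Finset ℕ :=
  (linesThrough ln Λ c).image fun l => ∏ d ∈ ln l, a d

theorem prod_update_mul (s : Finset C) (a : C → ℕ) (c : C) (P : ℕ) :
    ∏ d ∈ s, Function.update a c (P * a c) d = (if c ∈ s then P else 1) * ∏ d ∈ s, a d := by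
  split_ifs with h
  · rw [← Finset.mul_prod_erase _ _ h, ← Finset.mul_prod_erase s a h, Function.update_self, mul_assoc]
    congr 2
    exact Finset.prod_congr rfl fun d hd => Function.update_of_ne (Finset.ne_of_mem_erase hd) _ _
  · rw [one_mul]
    exact Finset.prod_congr rfl fun d hd => Function.update_of_ne (by rintro rfl; exact h hd) _ _

/-- Every configuration arises from a smaller one by multiplying one cell by its largest prime. -/
theorem exists_extract (ln : ι → Finset C) (N : ℕ) (Z : ι → ℝ) (Λ : Finset ι) (hΛ : Λ.Nonempty)
    (hZ : ∀ l ∈ Λ, 1 ≤ Z l) (a : C → ℕ) (ha : a ∈ cfg ln N Z Λ) :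
    ∃ c a' P, (linesThrough ln Λ c).Nonempty ∧ a' ∈ cfg ln N Z (Λ \ linesThrough ln Λ c) ∧
      (∀ n ∈ lineProds ln Λ c a', 1 ≤ n ∧ n ≤ N) ∧
      (lineProds ln Λ c a').card = (linesThrough ln Λ c).card ∧
      P ∈ sievedPrimes N (lineProds ln Λ c a') (Λ.sup' hΛ Z) ∧
      Function.update a' c (P * a' c) = a := by
  classical
  obtain ⟨hbox, hline, hdist⟩ := Finset.mem_filter.1 ha
  rw [Fintype.mem_piFinset] at hbox
  have hpos : ∀ c, 0 < a c := fun c => (Finset.mem_Icc.1 (hbox c)).1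
  have hU : (Λ.biUnion ln).Nonempty := by
    obtain ⟨l, hl⟩ := hΛ
    rcases (ln l).eq_empty_or_nonempty with h | ⟨c, hc⟩
    · have := (hline l hl).1
      rw [h, Finset.prod_empty] at this
      exact absurd this (by norm_num)
    · exact ⟨c, Finset.mem_biUnion.2 ⟨l, hl, hc⟩⟩
  obtain ⟨c, hc, hmax⟩ := Finset.exists_max_image (Λ.biUnion ln) (fun c => gpf (a c)) hU
  obtain ⟨l₀, hl₀, hcl₀⟩ := Finset.mem_biUnion.1 hc
  set P := gpf (a c) with hP
  have hgpf : ∀ l ∈ Λ, gpf (∏ c ∈ ln l, a c) ≤ P := fun l hl =>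
    gpf_prod_le (fun d _ => (hpos d).ne') fun d hd => hmax d (Finset.mem_biUnion.2 ⟨l, hl, hd⟩)
  have hZP : ∀ l ∈ Λ, Z l ≤ Real.log P := fun l hl => by
    have h1 := (hline l hl).2.2
    have h2 := hZ l hl
    have h0 : 0 < gpf (∏ c ∈ ln l, a c) := by
      rw [Nat.pos_iff_ne_zero]; intro h0
      rw [h0] at h1; simp at h1; linarith
    exact h1.trans (Real.log_le_log (by exact_mod_cast h0) (by exact_mod_cast hgpf l hl))
  have hP0 : 0 < P := by
    rw [Nat.pos_iff_ne_zero]; intro h0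
    have h1 := hZP l₀ hl₀
    have h2 := hZ l₀ hl₀
    rw [h0] at h1; simp at h1; linarith
  obtain ⟨hPp, r, hr⟩ := gpf_mem hP0
  rw [← hP] at hPp hr
  have hr0 : 0 < r := Nat.pos_of_ne_zero fun h => by
    have := hpos c; rw [hr, h] at this; simp at this
  set a' := Function.update a c r with ha'
  have ha'c : a' c = r := Function.update_self _ _ _
  have hback : Function.update a' c (P * a' c) = a := by
    rw [ha'c, ha', Function.update_idem, ← hr, Function.update_eq_self]
  have hprod : ∀ l, ∏ d ∈ ln l, a d = (if c ∈ ln l then P else 1) * ∏ d ∈ ln l, a' d := fun l => by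
    rw [← prod_update_mul, hback]
  have ha'pos : ∀ d, 0 < a' d := fun d => by
    by_cases h : d = c
    · rw [h, ha'c]; exact hr0
    · rw [ha', Function.update_of_ne h]; exact hpos d
  have hin : ∀ l ∈ linesThrough ln Λ c, l ∈ Λ ∧ ∏ d ∈ ln l, a d = P * ∏ d ∈ ln l, a' d := fun l hl => by
    obtain ⟨h1, h2⟩ := Finset.mem_filter.1 hl
    exact ⟨h1, by rw [hprod, if_pos h2]⟩
  have hout : ∀ l ∈ Λ \ linesThrough ln Λ c, l ∈ Λ ∧ ∏ d ∈ ln l, a' d = ∏ d ∈ ln l, a d := fun l hl => by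
    obtain ⟨h1, h2⟩ := Finset.mem_sdiff.1 hl
    have : c ∉ ln l := fun h => h2 (Finset.mem_filter.2 ⟨h1, h⟩)
    exact ⟨h1, by rw [hprod, if_neg this, one_mul]⟩
  refine ⟨c, a', P, ⟨l₀, Finset.mem_filter.2 ⟨hl₀, hcl₀⟩⟩, ?_, ?_, ?_, ?_, hback⟩
  · refine Finset.mem_filter.2 ⟨?_, ?_, ?_⟩
    · rw [Fintype.mem_piFinset]
      intro d
      refine Finset.mem_Icc.2 ⟨ha'pos d, ?_⟩
      have hd := (Finset.mem_Icc.1 (hbox d)).2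
      by_cases h : d = c
      · rw [h, ha'c]
        rw [h, hr] at hd
        exact (Nat.le_mul_of_pos_left r hP0).trans hd
      · rw [ha', Function.update_of_ne h]; exact hd
    · intro l hl
      obtain ⟨h1, h2⟩ := hout l hl
      rw [h2]; exact hline l h1
    · intro l hl l' hl' hne
      rw [(hout l hl).2, (hout l' hl').2]
      exact hdist l (hout l hl).1 l' (hout l' hl').1 hne
  · intro n hn
    obtain ⟨l, hl, rfl⟩ := Finset.mem_image.1 hn
    obtain ⟨h1, h2⟩ := hin l hl
    refine ⟨Finset.prod_pos fun d _ => ha'pos d, ?_⟩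
    have := (hline l h1).2.1
    rw [h2] at this
    exact (Nat.le_mul_of_pos_left _ hP0).trans this
  · refine Finset.card_image_of_injOn fun l hl l' hl' he => ?_
    by_contra hne
    obtain ⟨h1, h2⟩ := hin l hl
    obtain ⟨h1', h2'⟩ := hin l' hl'
    refine hdist l h1 l' h1' hne ?_
    rw [h2, h2']; exact congrArg (P * ·) he
  · refine Finset.mem_filter.2 ⟨Finset.mem_Ioc.2 ⟨hP0, ?_⟩, hPp, ?_, ?_⟩
    · have hd := (Finset.mem_Icc.1 (hbox c)).2
      rw [hr] at hd
      exact (Nat.le_mul_of_pos_right P hr0).trans hd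
    · intro n hn
      obtain ⟨l, hl, rfl⟩ := Finset.mem_image.1 hn
      obtain ⟨h1, h2⟩ := hin l hl
      rw [mul_comm, ← h2]
      exact (hline l h1).1
    · exact Finset.sup'_le _ _ hZP

end Config

section Config

variable {C ι : Type} [Fintype C] [DecidableEq C] [DecidableEq ι]

/-- The weight of a configuration. -/
noncomputable def cfgWeight (g : C → ℕ → ℝ) (a : C → ℕ) : ℝ := ∏ c, g c (a c) / (a c)

theorem cfgWeight_nonneg {g : C → ℕ → ℝ} (hg : ∀ c n, 0 ≤ g c n) (a : C → ℕ) :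
    0 ≤ cfgWeight g a :=
  Finset.prod_nonneg fun c _ => div_nonneg (hg c _) (Nat.cast_nonneg _)

theorem cfgWeight_update_le {g : C → ℕ → ℝ} (hg : ∀ c n, 0 ≤ g c n)
    (hg2 : ∀ c p r, p.Prime → 1 ≤ r → g c (p * r) ≤ 2 * g c r) (a : C → ℕ) (c : C) {P : ℕ}
    (hP : P.Prime) (hc : 1 ≤ a c) :
    cfgWeight g (Function.update a c (P * a c)) ≤ cfgWeight g a * (2 * (1 / P)) := by
  have hP0 : (0 : ℝ) < P := by exact_mod_cast hP.pos
  have hc0 : (0 : ℝ) < a c := by exact_mod_cast hc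
  unfold cfgWeight
  rw [← Finset.mul_prod_erase _ _ (Finset.mem_univ c),
    ← Finset.mul_prod_erase _ (fun d => g d (a d) / (a d)) (Finset.mem_univ c),
    Function.update_self]
  have : ∏ d ∈ Finset.univ.erase c, g d (Function.update a c (P * a c) d) /
      (Function.update a c (P * a c) d : ℕ) = ∏ d ∈ Finset.univ.erase c, g d (a d) / (a d) :=
    Finset.prod_congr rfl fun d hd => by rw [Function.update_of_ne (Finset.ne_of_mem_erase hd)]
  rw [this]
  have h0 : 0 ≤ ∏ d ∈ Finset.univ.erase c, g d (a d) / (a d : ℝ) :=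
    Finset.prod_nonneg fun c _ => div_nonneg (hg c _) (Nat.cast_nonneg _)
  have h1 : g c (P * a c) / ((P * a c : ℕ) : ℝ) ≤ g c (a c) / (a c) * (2 * (1 / P)) := by
    have := hg2 c P (a c) hP hc
    push_cast
    rw [div_mul_eq_mul_div, div_le_div_iff₀ (by positivity) hc0]
    have h2 : g c (a c) * (2 * (1 / (P : ℝ))) * (P * a c) = (2 * g c (a c)) * a c := by
      field_simp
    rw [h2]
    exact mul_le_mul_of_nonneg_right this hc0.le
  calc _ ≤ g c (a c) / (a c) * (2 * (1 / P)) * _ := mul_le_mul_of_nonneg_right h1 h0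
    _ = _ := by ring

theorem sum_cfg_filter_le (ln : ι → Finset C) (N : ℕ) (Z : ι → ℝ) {g : C → ℕ → ℝ}
    (hg : ∀ c n, 0 ≤ g c n)
    (hg2 : ∀ c p r, p.Prime → 1 ≤ r → g c (p * r) ≤ 2 * g c r) (Λ : Finset ι) (hΛ : Λ.Nonempty)
    (hZ : ∀ l ∈ Λ, 1 ≤ Z l) (Q : ℕ → Prop) [DecidablePred Q] (D : C → ℝ) (hD : ∀ c, 0 ≤ D c)
    (hsum : ∀ c, (linesThrough ln Λ c).Nonempty → ∀ T : Finset ℕ,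
      T.card = (linesThrough ln Λ c).card → (∀ n ∈ T, 1 ≤ n ∧ n ≤ N) → ∀ m : ℕ, 1 ≤ m →
      ∑ P ∈ (sievedPrimes N T (Λ.sup' hΛ Z)).filter (fun P => Q (P * m)), (1 : ℝ) / P ≤ D c) :
    ∑ a ∈ (cfg ln N Z Λ).filter (fun a => Q (∏ c, a c)), cfgWeight g a ≤
      ∑ c ∈ Finset.univ.filter (fun c => (linesThrough ln Λ c).Nonempty),
        2 * D c * ∑ a ∈ cfg ln N Z (Λ \ linesThrough ln Λ c), cfgWeight g a := by
  let t : Finset (Σ _ : C, Σ _ : C → ℕ, ℕ) :=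
    (Finset.univ.filter (fun c => (linesThrough ln Λ c).Nonempty)).sigma fun c =>
      ((cfg ln N Z (Λ \ linesThrough ln Λ c)).filter fun a =>
        (∀ n ∈ lineProds ln Λ c a, 1 ≤ n ∧ n ≤ N) ∧
        (lineProds ln Λ c a).card = (linesThrough ln Λ c).card).sigma fun a =>
      (sievedPrimes N (lineProds ln Λ c a) (Λ.sup' hΛ Z)).filter fun P => Q (P * ∏ d, a d)
  have hF := cfgWeight_nonneg hg
  refine (Finset.sum_le_sum_of_surj (t := t)
    (fun b => Function.update b.2.1 b.1 (b.2.2 * b.2.1 b.1)) (cfgWeight g) hF ?_).trans ?_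
  · intro a ha
    obtain ⟨ha, hQ⟩ := Finset.mem_filter.1 ha
    obtain ⟨c, a', P, hne, ha', h1, h2, h3, rfl⟩ := exists_extract ln N Z Λ hΛ hZ a ha
    refine ⟨⟨c, a', P⟩, ?_, rfl⟩
    refine Finset.mem_sigma.2 ⟨Finset.mem_filter.2 ⟨Finset.mem_univ _, hne⟩,
      Finset.mem_sigma.2 ⟨Finset.mem_filter.2 ⟨ha', h1, h2⟩, Finset.mem_filter.2 ⟨h3, ?_⟩⟩⟩
    rwa [prod_update_mul, if_pos (Finset.mem_univ _)] at hQ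
  · rw [Finset.sum_sigma]
    refine Finset.sum_le_sum fun c hc => ?_
    rw [Finset.sum_sigma, Finset.mul_sum]
    refine (Finset.sum_le_sum (g := fun a => 2 * D c * cfgWeight g a) fun a ha => ?_).trans
      (Finset.sum_le_sum_of_subset_of_nonneg (Finset.filter_subset _ _) fun a _ _ =>
        mul_nonneg (by linarith [hD c]) (hF a))
    obtain ⟨ha, h1, h2⟩ := Finset.mem_filter.1 ha
    have hbox := Fintype.mem_piFinset.1 (Finset.mem_filter.1 ha).1
    have hpos : ∀ c, 1 ≤ a c := fun c => (Finset.mem_Icc.1 (hbox c)).1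
    calc _ ≤ ∑ P ∈ (sievedPrimes N (lineProds ln Λ c a) (Λ.sup' hΛ Z)).filter
          (fun P => Q (P * ∏ d, a d)), cfgWeight g a * (2 * (1 / P : ℝ)) := by
          refine Finset.sum_le_sum fun P hP => ?_
          exact cfgWeight_update_le hg hg2 a c
            (Finset.mem_filter.1 (Finset.mem_filter.1 hP).1).2.1 (hpos c)
      _ = cfgWeight g a * 2 * ∑ P ∈ (sievedPrimes N (lineProds ln Λ c a) (Λ.sup' hΛ Z)).filter
          (fun P => Q (P * ∏ d, a d)), (1 / P : ℝ) := by
          rw [Finset.mul_sum]; exact Finset.sum_congr rfl fun _ _ => by ring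
      _ ≤ cfgWeight g a * 2 * D c := mul_le_mul_of_nonneg_left
          (hsum c (Finset.mem_filter.1 hc).2 _ h2 h1 _ (Nat.one_le_iff_ne_zero.2 (Finset.prod_ne_zero_iff.2 fun d _ => Nat.one_le_iff_ne_zero.1 (hpos d))))
          (mul_nonneg (hF a) zero_le_two)
      _ = _ := by ring

/-- The common hypotheses for the configuration bounds. -/
structure CfgHyp (ln : ι → Finset C) (N : ℕ) (Z : ι → ℝ) (g : C → ℕ → ℝ) (κ H : ℝ) : Prop where
  nonneg : ∀ c n, 0 ≤ g c n
  mul_le : ∀ c p r, p.Prime → 1 ≤ r → g c (p * r) ≤ 2 * g c r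
  one_le : ∀ l, 1 ≤ Z l
  card_le : ∀ (Λ : Finset ι) c, (linesThrough ln Λ c).card ≤ 2
  sieve : SieveBound N κ
  kappa : 0 ≤ κ
  one_le_H : 1 ≤ H
  le_H : 2 * Fintype.card C * κ ≤ H

variable {ln : ι → Finset C} {N : ℕ} {Z : ι → ℝ} {g : C → ℕ → ℝ} {κ H : ℝ}

theorem CfgHyp.inv_pow_le (h : CfgHyp ln N Z g κ H) (Λ : Finset ι) (hΛ : Λ.Nonempty) (c : C) :
    1 / (Λ.sup' hΛ Z) ^ (linesThrough ln Λ c).card ≤ ∏ l ∈ linesThrough ln Λ c, 1 / Z l := by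
  rw [Finset.prod_div_distrib, Finset.prod_const_one, ← Finset.prod_const]
  refine one_div_le_one_div_of_le (Finset.prod_pos fun l _ => by linarith [h.one_le l]) ?_
  exact Finset.prod_le_prod (fun l _ => by linarith [h.one_le l]) fun l hl =>
    Finset.le_sup' Z (Finset.mem_filter.1 hl).1

theorem CfgHyp.one_le_sup (h : CfgHyp ln N Z g κ H) (Λ : Finset ι) (hΛ : Λ.Nonempty) :
    1 ≤ Λ.sup' hΛ Z := by
  obtain ⟨l, hl⟩ := hΛ
  exact (h.one_le l).trans (Finset.le_sup' Z hl)

theorem CfgHyp.sum_step (h : CfgHyp ln N Z g κ H) (Λ : Finset ι) (R E : ℝ) (hR : 0 ≤ R)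
    (hE : 0 ≤ E) :
    ∑ c ∈ Finset.univ.filter (fun c => (linesThrough ln Λ c).Nonempty),
      2 * (R * κ * ∏ l ∈ linesThrough ln Λ c, 1 / Z l) *
        (E * ∏ l ∈ Λ \ linesThrough ln Λ c, H / Z l) ≤ R * (E * ∏ l ∈ Λ, H / Z l) := by
  have hZ0 : ∀ l, 0 < Z l := fun l => by linarith [h.one_le l]
  have hH0 : 0 < H := by linarith [h.one_le_H]
  have hκ := h.kappa
  set E' := ∏ l ∈ Λ, H / Z l with hE'
  have hE'0 : 0 ≤ E' := Finset.prod_nonneg fun l _ => (div_pos hH0 (hZ0 l)).le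
  have key : ∀ c ∈ Finset.univ.filter (fun c => (linesThrough ln Λ c).Nonempty),
      2 * (R * κ * ∏ l ∈ linesThrough ln Λ c, 1 / Z l) *
        (E * ∏ l ∈ Λ \ linesThrough ln Λ c, H / Z l) ≤ (R * E * E' / H) * (2 * κ) := by
    intro c hc
    have hne := (Finset.mem_filter.1 hc).2
    have hsub : linesThrough ln Λ c ⊆ Λ := Finset.filter_subset _ _
    have h1 : H * ∏ l ∈ linesThrough ln Λ c, 1 / Z l ≤ ∏ l ∈ linesThrough ln Λ c, H / Z l := by
      have : ∏ l ∈ linesThrough ln Λ c, H / Z l =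
          H ^ (linesThrough ln Λ c).card * ∏ l ∈ linesThrough ln Λ c, 1 / Z l := by
        rw [← Finset.prod_const, ← Finset.prod_mul_distrib]
        exact Finset.prod_congr rfl fun _ _ => by ring
      rw [this]
      refine mul_le_mul_of_nonneg_right ?_
        (Finset.prod_nonneg fun l _ => (div_pos one_pos (hZ0 l)).le)
      exact le_self_pow₀ h.one_le_H (Finset.card_pos.2 hne).ne'
    have h2 : E' = (∏ l ∈ Λ \ linesThrough ln Λ c, H / Z l) * ∏ l ∈ linesThrough ln Λ c, H / Z l :=
      (Finset.prod_sdiff hsub).symm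
    have h3 : 0 ≤ ∏ l ∈ Λ \ linesThrough ln Λ c, H / Z l :=
      Finset.prod_nonneg fun l _ => (div_pos hH0 (hZ0 l)).le
    have h4 : (∏ l ∈ linesThrough ln Λ c, 1 / Z l) * ∏ l ∈ Λ \ linesThrough ln Λ c, H / Z l ≤
        E' / H := by
      rw [le_div_iff₀ hH0, h2]
      nlinarith
    calc _ = (2 * R * κ * E) * ((∏ l ∈ linesThrough ln Λ c, 1 / Z l) *
          ∏ l ∈ Λ \ linesThrough ln Λ c, H / Z l) := by ring
      _ ≤ (2 * R * κ * E) * (E' / H) := mul_le_mul_of_nonneg_left h4 (by positivity)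
      _ = _ := by ring
  refine (Finset.sum_le_card_nsmul _ _ _ key).trans ?_
  rw [nsmul_eq_mul]
  have hcard : (((Finset.univ.filter (fun c => (linesThrough ln Λ c).Nonempty)).card : ℕ) : ℝ) ≤
      Fintype.card C := by exact_mod_cast Finset.card_le_univ _
  calc _ ≤ (Fintype.card C : ℝ) * (R * E * E' / H * (2 * κ)) :=
        mul_le_mul_of_nonneg_right hcard (by positivity)
    _ = (R * E * E' / H) * (2 * Fintype.card C * κ) := by ring
    _ ≤ (R * E * E' / H) * H := mul_le_mul_of_nonneg_left h.le_H (by positivity)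
    _ = _ := by field_simp

theorem CfgHyp.euler_nonneg (h : CfgHyp ln N Z g κ H) :
    0 ≤ ∏ c : C, ∑ n ∈ Finset.Icc 1 N, g c n / n :=
  Finset.prod_nonneg fun c _ => Finset.sum_nonneg fun n _ => div_nonneg (h.nonneg c n)
    (Nat.cast_nonneg _)

theorem CfgHyp.sum_le (h : CfgHyp ln N Z g κ H) (Λ : Finset ι) :
    ∑ a ∈ cfg ln N Z Λ, cfgWeight g a ≤
      (∏ c : C, ∑ n ∈ Finset.Icc 1 N, g c n / n) * ∏ l ∈ Λ, H / Z l := by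
  induction Λ using Finset.strongInduction with
  | H Λ ih =>
    rcases Λ.eq_empty_or_nonempty with rfl | hΛ
    · rw [Finset.prod_empty, mul_one, Finset.prod_univ_sum]
      exact Finset.sum_le_sum_of_subset_of_nonneg (Finset.filter_subset _ _) fun a _ _ =>
        cfgWeight_nonneg h.nonneg a
    · have hD : ∀ c, 0 ≤ 1 * κ * ∏ l ∈ linesThrough ln Λ c, 1 / Z l := fun c =>
        mul_nonneg (by linarith [h.kappa]) (Finset.prod_nonneg fun l _ =>
          one_div_nonneg.2 (by linarith [h.one_le l]))
      have h1 := sum_cfg_filter_le ln N Z h.nonneg h.mul_le Λ hΛ (fun l _ => h.one_le l)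
        (fun _ => True) (fun c => 1 * κ * ∏ l ∈ linesThrough ln Λ c, 1 / Z l) hD (by
          intro c hc T hT hTN m _
          rw [Finset.filter_true_of_mem (fun _ _ => trivial)]
          refine (h.sieve T (Finset.card_pos.1 (hT ▸ Finset.card_pos.2 hc))
            (hT ▸ h.card_le Λ c) hTN _ (h.one_le_sup Λ hΛ)).1.trans ?_
          rw [hT, one_mul, div_eq_mul_one_div]
          exact mul_le_mul_of_nonneg_left (h.inv_pow_le Λ hΛ c) h.kappa)
      rw [Finset.filter_true_of_mem (fun _ _ => trivial)] at h1
      refine h1.trans ?_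
      refine le_trans ?_ ((h.sum_step Λ 1 _ zero_le_one h.euler_nonneg).trans_eq (one_mul _))
      refine Finset.sum_le_sum fun c hc => ?_
      refine mul_le_mul_of_nonneg_left (ih _ ?_) (mul_nonneg zero_le_two (hD c))
      exact Finset.sdiff_ssubset (Finset.filter_subset _ _) (Finset.mem_filter.1 hc).2

theorem CfgHyp.sum_top_le (h : CfgHyp ln N Z g κ H) (Λ : Finset ι) (l₀ : ι) (hl₀ : l₀ ∈ Λ)
    (B Y : ℝ) (hB : 1 ≤ B) :
    ∑ a ∈ (cfg ln N Z Λ).filter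
        (fun a => Y / B < ((∏ c, a c : ℕ) : ℝ) ∧ ((∏ c, a c : ℕ) : ℝ) ≤ Y), cfgWeight g a ≤
      B / Z l₀ * ((∏ c : C, ∑ n ∈ Finset.Icc 1 N, g c n / n) * ∏ l ∈ Λ, H / Z l) := by
  have hΛ : Λ.Nonempty := ⟨l₀, hl₀⟩
  have hZ0 : ∀ l, 0 < Z l := fun l => by linarith [h.one_le l]
  have hR : 0 ≤ B / Z l₀ := div_nonneg (by linarith) (hZ0 l₀).le
  have hD : ∀ c, 0 ≤ B / Z l₀ * κ * ∏ l ∈ linesThrough ln Λ c, 1 / Z l := fun c =>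
    mul_nonneg (mul_nonneg hR h.kappa) (Finset.prod_nonneg fun l _ =>
      one_div_nonneg.2 (hZ0 l).le)
  have h1 := sum_cfg_filter_le ln N Z h.nonneg h.mul_le Λ hΛ (fun l _ => h.one_le l)
    (fun n => Y / B < (n : ℝ) ∧ (n : ℝ) ≤ Y)
    (fun c => B / Z l₀ * κ * ∏ l ∈ linesThrough ln Λ c, 1 / Z l) hD (by
      intro c hc T hT hTN m hm
      have hm0 : (0 : ℝ) < m := by exact_mod_cast hm
      have h2 := (h.sieve T (Finset.card_pos.1 (hT ▸ Finset.card_pos.2 hc))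
        (hT ▸ h.card_le Λ c) hTN _ (h.one_le_sup Λ hΛ)).2 B (Y / m) hB
      have h3 : (sievedPrimes N T (Λ.sup' hΛ Z)).filter
          (fun P : ℕ => Y / B < ((P * m : ℕ) : ℝ) ∧ ((P * m : ℕ) : ℝ) ≤ Y) =
          (sievedPrimes N T (Λ.sup' hΛ Z)).filter
          (fun P : ℕ => Y / m / B < (P : ℝ) ∧ (P : ℝ) ≤ Y / m) := by
        refine Finset.filter_congr fun P _ => ?_
        push_cast
        rw [le_div_iff₀ hm0, div_right_comm, div_lt_iff₀ hm0]
      rw [h3]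
      refine h2.trans ?_
      rw [hT, pow_succ]
      have h4 := h.inv_pow_le Λ hΛ c
      have h5 : 1 / Λ.sup' hΛ Z ≤ 1 / Z l₀ :=
        one_div_le_one_div_of_le (hZ0 l₀) (Finset.le_sup' Z hl₀)
      have h6 : 0 < Λ.sup' hΛ Z := by linarith [h.one_le_sup Λ hΛ]
      calc _ = B * κ * (1 / (Λ.sup' hΛ Z) ^ (linesThrough ln Λ c).card * (1 / Λ.sup' hΛ Z)) := by
            field_simp
        _ ≤ B * κ * ((∏ l ∈ linesThrough ln Λ c, 1 / Z l) * (1 / Z l₀)) := by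
            refine mul_le_mul_of_nonneg_left (mul_le_mul h4 h5 (by positivity)
              (Finset.prod_nonneg fun l _ => one_div_nonneg.2 (hZ0 l).le))
              (mul_nonneg (by linarith) h.kappa)
        _ = _ := by ring)
  refine h1.trans (le_trans ?_ (h.sum_step Λ _ _ hR h.euler_nonneg))
  exact Finset.sum_le_sum fun c _ =>
    mul_le_mul_of_nonneg_left (h.sum_le _) (mul_nonneg zero_le_two (hD c))

end Config

/-- The completely multiplicative function with values `w` on primes. -/
noncomputable def cm (w : ℕ → ℝ) (n : ℕ) : ℝ := (n.primeFactorsList.map w).prod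

theorem cm_mul (w : ℕ → ℝ) {m n : ℕ} (hm : m ≠ 0) (hn : n ≠ 0) : cm w (m * n) = cm w m * cm w n := by
  unfold cm
  rw [← List.prod_append, ← List.map_append]
  exact ((Nat.perm_primeFactorsList_mul hm hn).map w).prod_eq

theorem cm_one (w : ℕ → ℝ) : cm w 1 = 1 := by simp [cm]

theorem cm_prime (w : ℕ → ℝ) {p : ℕ} (hp : p.Prime) : cm w p = w p := by
  simp [cm, Nat.primeFactorsList_prime hp]

theorem cm_nonneg {w : ℕ → ℝ} (hw : ∀ q, 0 ≤ w q) (n : ℕ) : 0 ≤ cm w n :=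
  List.prod_nonneg fun x hx => by
    obtain ⟨q, _, rfl⟩ := List.mem_map.1 hx
    exact hw q

theorem cm_mul_le {w : ℕ → ℝ} (hw : ∀ q, 0 ≤ w q) (hw2 : ∀ q, w q ≤ 3 / 2) {p r : ℕ} (hp : p.Prime)
    (hr : 1 ≤ r) : cm w (p * r) ≤ 2 * cm w r := by
  rw [cm_mul w hp.ne_zero (by omega), cm_prime w hp]
  exact mul_le_mul_of_nonneg_right (by linarith [hw2 p]) (cm_nonneg hw r)

/-- The completely multiplicative function `cm w n / n` as a monoid homomorphism. -/
noncomputable def cmDiv (w : ℕ → ℝ) : ℕ →* ℝ where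
  toFun n := cm w n / n
  map_one' := by simp [cm_one]
  map_mul' m n := by
    rcases eq_or_ne m 0 with rfl | hm
    · simp
    rcases eq_or_ne n 0 with rfl | hn
    · simp
    rw [cm_mul w hm hn]
    push_cast
    rw [mul_div_mul_comm]

theorem inv_one_sub_le_exp {t : ℝ} (h1 : t ≤ 3 / 4) :
    (1 - t)⁻¹ ≤ Real.exp (t + 4 * t ^ 2) := by
  have h := Real.add_one_le_exp (t + 4 * t ^ 2)
  refine le_trans ?_ h
  rw [inv_le_iff_one_le_mul₀ (by linarith)]
  nlinarith [mul_nonneg (sq_nonneg t) (sub_nonneg.2 h1)]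

theorem sum_cm_div_le {w : ℕ → ℝ} (hw : ∀ q, 0 ≤ w q) (hw2 : ∀ q, w q ≤ 3 / 2) (N : ℕ) :
    ∑ n ∈ Finset.Icc 1 N, cm w n / n ≤ Real.exp (∑ q ∈ primesUpTo N, w q / q + 18) := by
  have hp34 : ∀ {p : ℕ}, p.Prime → w p / p ≤ 3 / 4 := fun {p} hp => by
    have h2 : (2 : ℝ) ≤ p := by exact_mod_cast hp.two_le
    rw [div_le_iff₀ (by linarith)]
    linarith [hw2 p]
  have hp0 : ∀ p : ℕ, 0 ≤ w p / p := fun p => div_nonneg (hw p) (Nat.cast_nonneg _)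
  obtain ⟨h1, h2⟩ := EulerProduct.summable_and_hasSum_smoothNumbers_prod_primesBelow_geometric
    (f := cmDiv w) (fun {p} hp => by
      change ‖cm w p / p‖ < 1
      rw [cm_prime w hp, Real.norm_of_nonneg (hp0 p)]
      linarith [hp34 hp]) (N + 1)
  have hpr : Nat.primesBelow (N + 1) = primesUpTo N := by
    ext p
    rw [Nat.mem_primesBelow, mem_primesUpTo]
    constructor
    · rintro ⟨a, b⟩; exact ⟨b, by omega⟩
    · rintro ⟨a, b⟩; exact ⟨by omega, a⟩
  have hsm : ∀ n ∈ Finset.Icc 1 N, n ∈ Nat.smoothNumbers (N + 1) := fun n hn => by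
    obtain ⟨ha, hb⟩ := Finset.mem_Icc.1 hn
    refine ⟨by omega, fun p hp => ?_⟩
    have := Nat.le_of_mem_primeFactorsList hp
    omega
  have h3 : ∑ n ∈ Finset.Icc 1 N, cm w n / n ≤
      ∏ p ∈ Nat.primesBelow (N + 1), (1 - cmDiv w p)⁻¹ := by
    have h4 := sum_le_hasSum ((Finset.Icc 1 N).attach.image fun n =>
      (⟨n.1, hsm n.1 n.2⟩ : Nat.smoothNumbers (N + 1)))
      (fun m _ => div_nonneg (cm_nonneg hw m.1) (Nat.cast_nonneg m.1)) h2
    refine le_trans (le_of_eq ?_) h4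
    rw [Finset.sum_image]
    · exact (Finset.sum_attach (Finset.Icc 1 N) (fun n => cm w n / n)).symm
    · intro a _ b _ h
      exact Subtype.ext (congrArg (fun z : Nat.smoothNumbers (N + 1) => (z : ℕ)) h)
  refine h3.trans ?_
  rw [hpr]
  calc _ ≤ ∏ p ∈ primesUpTo N, Real.exp (w p / p + 4 * (w p / p) ^ 2) := by
        refine Finset.prod_le_prod (fun p hp => ?_) fun p hp => ?_
        · have hpp := (mem_primesUpTo.1 hp).1
          change 0 ≤ (1 - cm w p / p)⁻¹
          rw [cm_prime w hpp]
          exact inv_nonneg.2 (by linarith [hp34 hpp])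
        · have hpp := (mem_primesUpTo.1 hp).1
          change (1 - cm w p / p)⁻¹ ≤ _
          rw [cm_prime w hpp]
          exact inv_one_sub_le_exp (hp34 hpp)
    _ = Real.exp (∑ q ∈ primesUpTo N, w q / q + ∑ q ∈ primesUpTo N, 4 * (w q / q) ^ 2) := by
        rw [← Real.exp_sum, Finset.sum_add_distrib]
    _ ≤ _ := by
        refine Real.exp_le_exp.2 (add_le_add_right ?_ _)
        have h5 := sum_inv_sq_le 1 le_rfl (N + 1)
        calc ∑ q ∈ primesUpTo N, 4 * (w q / q) ^ 2 ≤
              ∑ q ∈ primesUpTo N, 9 * (1 / (q : ℝ) ^ 2) := by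
              refine Finset.sum_le_sum fun q _ => ?_
              rw [div_pow, div_eq_mul_one_div, ← mul_assoc]
              refine mul_le_mul_of_nonneg_right ?_ (by positivity)
              nlinarith [hw q, hw2 q]
          _ ≤ 9 * ∑ n ∈ (Finset.range (N + 1)).filter (fun n : ℕ => (1 : ℝ) ≤ n),
                (1 : ℝ) / (n : ℝ) ^ 2 := by
              rw [← Finset.mul_sum]
              refine mul_le_mul_of_nonneg_left (Finset.sum_le_sum_of_subset_of_nonneg
                (fun q hq => ?_) fun _ _ _ => by positivity) (by norm_num)
              obtain ⟨ha, hb⟩ := mem_primesUpTo.1 hq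
              exact Finset.mem_filter.2 ⟨Finset.mem_range.2 (by omega), by exact_mod_cast ha.one_le⟩
          _ ≤ 18 := by linarith

/-- The level of `n`. -/
noncomputable def lev (n : ℕ) : ℝ := Real.log (Real.log n)

theorem lev_le_iff {q : ℕ} (hq : 2 ≤ q) (b : ℝ) : lev q ≤ b ↔ q ≤ ⌊Real.exp (Real.exp b)⌋₊ := by
  have h2 : (2 : ℝ) ≤ q := by exact_mod_cast hq
  unfold lev
  rw [Real.log_le_iff_le_exp (Real.log_pos (by linarith)), Real.log_le_iff_le_exp (by linarith),
    Nat.le_floor_iff (Real.exp_pos _).le]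

theorem two_le_floor_exp_exp {b : ℝ} (hb : 0 ≤ b) : 2 ≤ ⌊Real.exp (Real.exp b)⌋₊ := by
  rw [Nat.le_floor_iff (Real.exp_pos _).le]
  have h1 : 1 ≤ Real.exp b := Real.one_le_exp hb
  have h2 := Real.add_one_le_exp (Real.exp b)
  push_cast; linarith

theorem lev_floor_le {b : ℝ} (hb : 0 ≤ b) : lev ⌊Real.exp (Real.exp b)⌋₊ ≤ b :=
  (lev_le_iff (two_le_floor_exp_exp hb) b).2 le_rfl

theorem sub_two_le_lev_floor {b : ℝ} (hb : 0 ≤ b) : b - 2 ≤ lev ⌊Real.exp (Real.exp b)⌋₊ := by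
  have h2 := two_le_floor_exp_exp hb
  have h2' : (2 : ℝ) ≤ ⌊Real.exp (Real.exp b)⌋₊ := by exact_mod_cast h2
  set y := ⌊Real.exp (Real.exp b)⌋₊ with hy
  have h3 : Real.exp (Real.exp b) < y + 1 := Nat.lt_floor_add_one _
  have hlog : Real.exp b ≤ 2 * Real.log y := by
    rw [← Real.log_exp (Real.exp b), ← Real.log_rpow (by linarith)]
    refine Real.log_le_log (Real.exp_pos _) ?_
    norm_num
    nlinarith
  have hl0 : 0 < Real.log y := Real.log_pos (by linarith)
  have h4 : b ≤ Real.log (2 * Real.log y) := by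
    rw [Real.le_log_iff_exp_le (by linarith)]; exact hlog
  rw [Real.log_mul two_ne_zero hl0.ne'] at h4
  have := Real.log_two_lt_d9
  unfold lev; linarith

theorem filter_lev_le (N : ℕ) (b : ℝ) :
    (primesUpTo N).filter (fun q => lev q ≤ b) ⊆ primesUpTo ⌊Real.exp (Real.exp b)⌋₊ := by
  intro q hq
  obtain ⟨h1, h2⟩ := Finset.mem_filter.1 hq
  have hp := (mem_primesUpTo.1 h1).1
  exact mem_primesUpTo.2 ⟨hp, (lev_le_iff hp.two_le b).1 h2⟩

/-- Mertens' theorem on the scale of levels. -/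
theorem exists_sum_lev :
    ∃ M : ℝ, 0 ≤ M ∧
      (∀ (N : ℕ) (b : ℝ), 0 ≤ b →
        ∑ q ∈ (primesUpTo N).filter (fun q => lev q ≤ b), (1 : ℝ) / q ≤ b + M) ∧
      (∀ (N : ℕ) (a b : ℝ), 0 ≤ a → a ≤ b →
        ∑ q ∈ (primesUpTo N).filter (fun q => a < lev q ∧ lev q ≤ b), (1 : ℝ) / q ≤ b - a + M) ∧
      (∀ (N : ℕ) (a b : ℝ), 0 ≤ a → a ≤ b → ⌊Real.exp (Real.exp b)⌋₊ ≤ N →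
        b - a - M ≤ ∑ q ∈ (primesUpTo N).filter (fun q => a < lev q ∧ lev q ≤ b), (1 : ℝ) / q) := by
  obtain ⟨M, hM0, hM⟩ := exists_abs_sum_primes_inv_sub_log_log_le
  have hT : ∀ b : ℝ, 0 ≤ b → ∑ p ∈ primesUpTo ⌊Real.exp (Real.exp b)⌋₊, (1 : ℝ) / p ≤ b + M := by
    intro b hb
    have h1 := (abs_le.1 (hM _ (two_le_floor_exp_exp hb))).2
    have h2 := lev_floor_le hb
    unfold lev at h2; linarith
  have hT' : ∀ b : ℝ, 0 ≤ b → b - 2 - M ≤ ∑ p ∈ primesUpTo ⌊Real.exp (Real.exp b)⌋₊, (1 : ℝ) / p := by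
    intro b hb
    have h1 := (abs_le.1 (hM _ (two_le_floor_exp_exp hb))).1
    have h2 := sub_two_le_lev_floor hb
    unfold lev at h2; linarith
  have hsplit : ∀ a b : ℝ, a ≤ b →
      ∑ q ∈ (primesUpTo ⌊Real.exp (Real.exp b)⌋₊).filter (fun q => a < lev q ∧ lev q ≤ b), (1 : ℝ) / q +
        ∑ p ∈ primesUpTo ⌊Real.exp (Real.exp a)⌋₊, (1 : ℝ) / p =
      ∑ p ∈ primesUpTo ⌊Real.exp (Real.exp b)⌋₊, (1 : ℝ) / p := by
    intro a b hab
    rw [← Finset.sum_filter_add_sum_filter_not (primesUpTo ⌊Real.exp (Real.exp b)⌋₊)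
      (fun q => a < lev q ∧ lev q ≤ b)]
    congr 1
    refine Finset.sum_congr ?_ fun _ _ => rfl
    ext q
    rw [Finset.mem_filter, mem_primesUpTo, mem_primesUpTo]
    constructor
    · rintro ⟨hp, h⟩
      have h1 := (lev_le_iff hp.two_le a).2 h
      exact ⟨⟨hp, (lev_le_iff hp.two_le b).1 (h1.trans hab)⟩, fun h2 => absurd h1 (not_le.2 h2.1)⟩
    · rintro ⟨⟨hp, h⟩, h1⟩
      refine ⟨hp, (lev_le_iff hp.two_le a).1 ?_⟩
      by_contra hlt
      exact h1 ⟨not_le.1 hlt, (lev_le_iff hp.two_le b).2 h⟩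
  refine ⟨2 * M + 2, by linarith, fun N b hb => ?_, fun N a b ha hab => ?_,
    fun N a b ha hab hN => ?_⟩
  · have := Finset.sum_le_sum_of_subset_of_nonneg (filter_lev_le N b)
      (f := fun q : ℕ => (1 : ℝ) / q) fun _ _ _ => by positivity
    linarith [hT b hb]
  · have h1 : (primesUpTo N).filter (fun q => a < lev q ∧ lev q ≤ b) ⊆
        (primesUpTo ⌊Real.exp (Real.exp b)⌋₊).filter (fun q => a < lev q ∧ lev q ≤ b) := by
      intro q hq
      obtain ⟨h1, h2⟩ := Finset.mem_filter.1 hq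
      exact Finset.mem_filter.2 ⟨filter_lev_le N b (Finset.mem_filter.2 ⟨h1, h2.2⟩), h2⟩
    have := Finset.sum_le_sum_of_subset_of_nonneg h1
      (f := fun q : ℕ => (1 : ℝ) / q) fun _ _ _ => by positivity
    linarith [hT b (ha.trans hab), hT' a ha, hsplit a b hab]
  · have h1 : (primesUpTo ⌊Real.exp (Real.exp b)⌋₊).filter (fun q => a < lev q ∧ lev q ≤ b) ⊆
        (primesUpTo N).filter (fun q => a < lev q ∧ lev q ≤ b) := by
      intro q hq
      obtain ⟨h1, h2⟩ := Finset.mem_filter.1 hq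
      obtain ⟨h3, h4⟩ := mem_primesUpTo.1 h1
      exact Finset.mem_filter.2 ⟨mem_primesUpTo.2 ⟨h3, h4.trans hN⟩, h2⟩
    have := Finset.sum_le_sum_of_subset_of_nonneg h1
      (f := fun q : ℕ => (1 : ℝ) / q) fun _ _ _ => by positivity
    linarith [hT' b (ha.trans hab), hT a ha, hsplit a b hab]

/-- The index of `q`: the largest `l ≤ k` with `lev q ≤ ρ ^ l * L`. -/
noncomputable def idx (ρ L : ℝ) (k q : ℕ) : ℕ := Nat.findGreatest (fun l => lev q ≤ ρ ^ l * L) k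

/-- The length of the `l`-th interval of levels. -/
noncomputable def lam (ρ L : ℝ) (k l : ℕ) : ℝ := if l < k then (1 - ρ) * ρ ^ l * L else ρ ^ k * L

/-- The number of prime factors of index `l`, with multiplicity. -/
noncomputable def Om (ρ L : ℝ) (k l n : ℕ) : ℕ :=
  (n.primeFactorsList.filter fun q => idx ρ L k q = l).length

section Idx

variable {ρ L : ℝ} {k : ℕ}

theorem idx_le (q : ℕ) : idx ρ L k q ≤ k := Nat.findGreatest_le k

theorem le_idx {i q : ℕ} (hi : i ≤ k) (h : lev q ≤ ρ ^ i * L) : i ≤ idx ρ L k q :=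
  Nat.le_findGreatest (P := fun l => lev q ≤ ρ ^ l * L) hi h

theorem lev_le_of_idx {q : ℕ} (h : lev q ≤ L) : lev q ≤ ρ ^ idx ρ L k q * L :=
  Nat.findGreatest_spec (P := fun l => lev q ≤ ρ ^ l * L) (Nat.zero_le k) (by simpa using h)

theorem lt_lev_of_idx {q l : ℕ} (hl : l < k) (h : idx ρ L k q = l) : ρ ^ (l + 1) * L < lev q := by
  by_contra hc
  have := le_idx (k := k) (by omega : l + 1 ≤ k) (not_lt.1 hc)
  omega

theorem lam_nonneg (hρ : 0 < ρ) (hρ1 : ρ < 1) (hL : 0 ≤ L) (l : ℕ) : 0 ≤ lam ρ L k l := by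
  unfold lam
  split_ifs
  · exact mul_nonneg (mul_nonneg (by linarith) (pow_pos hρ _).le) hL
  · exact mul_nonneg (pow_pos hρ _).le hL

theorem le_lam (hρ : 0 < ρ) (hρ1 : ρ < 1) (hL : 0 ≤ L) {l : ℕ} :
    (1 - ρ) * (ρ ^ k * L) ≤ lam ρ L k l := by
  unfold lam
  have h0 : 0 ≤ ρ ^ k * L := mul_nonneg (pow_pos hρ _).le hL
  split_ifs with h
  · rw [mul_assoc]
    refine mul_le_mul_of_nonneg_left (mul_le_mul_of_nonneg_right ?_ hL) (by linarith)
    exact pow_le_pow_of_le_one hρ.le hρ1.le h.le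
  · nlinarith

theorem sum_lam (i : ℕ) (hi : i ≤ k) : ∑ l ∈ Finset.Icc i k, lam ρ L k l = ρ ^ i * L := by
  induction hi using Nat.decreasingInduction with
  | self => simp [lam]
  | of_succ i hi ih =>
    rw [← Finset.add_sum_Ioc_eq_sum_Icc hi.le, show Finset.Ioc i k = Finset.Icc (i + 1) k by ext; simp, ih]
    simp only [lam, hi, if_true, pow_succ]; ring

theorem sum_idx_le {M : ℝ} (hρ : 0 < ρ) (hρ1 : ρ < 1) (hL : 0 ≤ L) {N : ℕ} (hN : lev N ≤ L)
    (h1 : ∀ (N : ℕ) (b : ℝ), 0 ≤ b →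
        ∑ q ∈ (primesUpTo N).filter (fun q => lev q ≤ b), (1 : ℝ) / q ≤ b + M)
    (h2 : ∀ (N : ℕ) (a b : ℝ), 0 ≤ a → a ≤ b →
        ∑ q ∈ (primesUpTo N).filter (fun q => a < lev q ∧ lev q ≤ b), (1 : ℝ) / q ≤ b - a + M)
    {l : ℕ} (hl : l ≤ k) :
    ∑ q ∈ (primesUpTo N).filter (fun q => idx ρ L k q = l), (1 : ℝ) / q ≤ lam ρ L k l + M := by
  have hle : ∀ q ∈ primesUpTo N, lev q ≤ L := fun q hq => by
    obtain ⟨hp, hqN⟩ := mem_primesUpTo.1 hq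
    have : (2 : ℝ) ≤ q := by exact_mod_cast hp.two_le
    refine le_trans (Real.log_le_log (Real.log_pos (by linarith)) ?_) hN
    exact Real.log_le_log (by linarith) (by exact_mod_cast hqN)
  unfold lam
  split_ifs with h
  · have h3 := h2 N (ρ ^ (l + 1) * L) (ρ ^ l * L) (mul_nonneg (pow_pos hρ _).le hL)
      (mul_le_mul_of_nonneg_right (pow_le_pow_of_le_one hρ.le hρ1.le (Nat.le_succ l)) hL)
    refine (Finset.sum_le_sum_of_subset_of_nonneg (fun q hq => ?_)
      fun _ _ _ => by positivity).trans (h3.trans (le_of_eq (by rw [pow_succ]; ring)))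
    obtain ⟨hq, hi⟩ := Finset.mem_filter.1 hq
    exact Finset.mem_filter.2 ⟨hq, lt_lev_of_idx h hi, hi ▸ lev_le_of_idx (hle q hq)⟩
  · obtain rfl : l = k := by omega
    have h3 := h1 N (ρ ^ l * L) (mul_nonneg (pow_pos hρ _).le hL)
    refine (Finset.sum_le_sum_of_subset_of_nonneg (fun q hq => ?_)
      fun _ _ _ => by positivity).trans h3
    obtain ⟨hq, hi⟩ := Finset.mem_filter.1 hq
    refine Finset.mem_filter.2 ⟨hq, ?_⟩
    have := lev_le_of_idx (ρ := ρ) (k := l) (hle q hq)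
    rwa [hi] at this

end Idx

theorem unit_cfgHyp {N : ℕ} {κ Z : ℝ} (hs : SieveBound N κ) (hκ : 0 ≤ κ) (hZ : 1 ≤ Z) {w : ℕ → ℝ}
    (hw : ∀ q, 0 ≤ w q) (hw2 : ∀ q, w q ≤ 3 / 2) :
    CfgHyp (C := Unit) (ι := Unit) (fun _ => {()}) N (fun _ => Z) (fun _ => cm w) κ (2 * κ + 1) where
  nonneg _ n := cm_nonneg hw n
  mul_le _ _ _ hp hr := cm_mul_le hw hw2 hp hr
  one_le _ := hZ
  card_le Λ c := (Finset.card_le_univ _).trans (by simp)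
  sieve := hs
  kappa := hκ
  one_le_H := by linarith
  le_H := by simp

/-- Weighted reciprocal sums over shifted primes with a large prime factor. -/
theorem sum_shifted_le {N : ℕ} {κ Z : ℝ} (hs : SieveBound N κ) (hκ : 0 ≤ κ) (hZ : 1 ≤ Z)
    {w : ℕ → ℝ} (hw : ∀ q, 0 ≤ w q) (hw2 : ∀ q, w q ≤ 3 / 2) :
    ∑ n ∈ (Finset.Icc 1 N).filter (fun n => (n - 1).Prime ∧ Z ≤ Real.log (gpf n)), cm w n / n ≤
      Real.exp (∑ q ∈ primesUpTo N, w q / q + 18) * ((2 * κ + 1) / Z) := by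
  have h := (unit_cfgHyp hs hκ hZ hw hw2).sum_le {()}
  rw [Finset.prod_singleton, Fintype.prod_unique] at h
  refine le_trans (le_trans ?_ h) (mul_le_mul_of_nonneg_right (sum_cm_div_le hw hw2 N)
    (div_nonneg (by linarith) (by linarith)))
  refine (Finset.sum_le_sum_of_surj (fun a : Unit → ℕ => a ()) _ (fun n => div_nonneg
    (cm_nonneg hw n) (Nat.cast_nonneg n)) (fun n hn => ⟨fun _ => n, ?_, rfl⟩)).trans
    (le_of_eq (Finset.sum_congr rfl fun a _ => ?_))
  · obtain ⟨h1, h2, h3⟩ := Finset.mem_filter.1 hn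
    refine mem_cfg.2 ⟨fun _ => h1, fun l _ => ?_,
      fun l _ l' _ hne => absurd rfl hne⟩
    rw [Finset.prod_singleton]
    exact ⟨h2, (Finset.mem_Icc.1 h1).2, h3⟩
  · simp [cfgWeight]

theorem sum_shifted_top_le {N : ℕ} {κ Z : ℝ} (hs : SieveBound N κ) (hκ : 0 ≤ κ) (hZ : 1 ≤ Z)
    {w : ℕ → ℝ} (hw : ∀ q, 0 ≤ w q) (hw2 : ∀ q, w q ≤ 3 / 2) {B Y : ℝ} (hB : 1 ≤ B) :
    ∑ n ∈ (Finset.Icc 1 N).filter (fun n : ℕ => ((n - 1).Prime ∧ Z ≤ Real.log (gpf n)) ∧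
        Y / B < n ∧ n ≤ Y), cm w n / n ≤
      B / Z * (Real.exp (∑ q ∈ primesUpTo N, w q / q + 18) * ((2 * κ + 1) / Z)) := by
  have h := (unit_cfgHyp hs hκ hZ hw hw2).sum_top_le {()} () (Finset.mem_singleton_self _) B Y hB
  rw [Finset.prod_singleton, Fintype.prod_unique] at h
  refine le_trans (le_trans ?_ h) (mul_le_mul_of_nonneg_left (mul_le_mul_of_nonneg_right
    (sum_cm_div_le hw hw2 N) (div_nonneg (by linarith) (by linarith)))
    (div_nonneg (by linarith) (by linarith)))
  refine (Finset.sum_le_sum_of_surj (fun a : Unit → ℕ => a ()) _ (fun n => div_nonneg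
    (cm_nonneg hw n) (Nat.cast_nonneg n)) (fun n hn => ⟨fun _ => n, ?_, rfl⟩)).trans
    (le_of_eq (Finset.sum_congr rfl fun a _ => ?_))
  · obtain ⟨h1, ⟨h2, h3⟩, h4⟩ := Finset.mem_filter.1 hn
    refine Finset.mem_filter.2 ⟨mem_cfg.2 ⟨fun _ => h1,
      fun l _ => ?_, fun l _ l' _ hne => absurd rfl hne⟩, ?_⟩
    · rw [Finset.prod_singleton]
      exact ⟨h2, (Finset.mem_Icc.1 h1).2, h3⟩
    · simpa using h4
  · simp [cfgWeight]

theorem cm_ite_idx (ρ L : ℝ) (k l : ℕ) (a : ℝ) (n : ℕ) :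
    cm (fun q => if idx ρ L k q = l then a else 1) n = a ^ Om ρ L k l n := by
  unfold cm Om
  induction n.primeFactorsList with
  | nil => simp
  | cons q t ih =>
    rw [List.map_cons, List.prod_cons, ih, List.filter_cons]
    by_cases h : idx ρ L k q = l
    · simp [h, pow_succ']
    · simp [h]

theorem sum_smooth_le {M L s : ℝ} (hs0 : 0 ≤ s) (hsL : s ≤ L) (hL : 1 ≤ L)
    (h1 : ∀ (N : ℕ) (b : ℝ), 0 ≤ b →
        ∑ q ∈ (primesUpTo N).filter (fun q => lev q ≤ b), (1 : ℝ) / q ≤ b + M) :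
    ∑ n ∈ (Finset.Icc 1 ⌊Real.exp (Real.exp s)⌋₊).filter
      (fun n => s - 1 < lev n ∧ L ^ 2 * Real.log (gpf n) < Real.log n), (1 : ℝ) / n ≤
      Real.exp (2 * (L + M) + 18 - L ^ 2 / 12) := by
  set N := ⌊Real.exp (Real.exp s)⌋₊ with hN
  set σ : ℝ := L ^ 2 / (4 * Real.exp s) with hσ
  have hes := Real.exp_pos s
  have hσ0 : 0 ≤ σ := by positivity
  set w : ℕ → ℝ := fun q => if L ^ 2 * Real.log q < Real.exp s then Real.exp (σ * Real.log q) else 0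
    with hwdef
  have hw : ∀ q, 0 ≤ w q := fun q => by
    simp only [hwdef]; split_ifs
    · positivity
    · exact le_rfl
  have hw2 : ∀ q, w q ≤ 3 / 2 := fun q => by
    simp only [hwdef]; split_ifs with h
    · have h2 : σ * Real.log q ≤ 1 / 4 := by
        rw [hσ, div_mul_eq_mul_div, div_le_iff₀ (by positivity)]
        linarith
      have h3 : Real.exp (1 / 4 : ℝ) ≤ 3 / 2 := by
        have h4 : Real.exp (1 / 4 : ℝ) ^ 4 < (3 / 2) ^ 4 := by
          rw [← Real.exp_nat_mul]
          norm_num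
          linarith [Real.exp_one_lt_d9]
        exact (lt_of_pow_lt_pow_left₀ 4 (by norm_num) h4).le
      exact (Real.exp_le_exp.2 h2).trans h3
    · norm_num
  have key : ∀ n ∈ (Finset.Icc 1 N).filter
      (fun n => s - 1 < lev n ∧ L ^ 2 * Real.log (gpf n) < Real.log n),
      (1 : ℝ) / n ≤ Real.exp (-(L ^ 2 / 12)) * (cm w n / n) := by
    intro n hn
    obtain ⟨h3, h4, h5⟩ := Finset.mem_filter.1 hn
    obtain ⟨h6, h7⟩ := Finset.mem_Icc.1 h3
    have hn0 : (0 : ℝ) < n := by exact_mod_cast h6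
    have hlog0 : 0 < Real.log n := by
      refine lt_of_le_of_lt ?_ h5
      exact mul_nonneg (by positivity) (Real.log_natCast_nonneg _)
    have hlogs : Real.log n ≤ Real.exp s := by
      rw [Real.log_le_iff_le_exp hn0]
      exact (Nat.le_floor_iff (Real.exp_pos _).le).1 h7
    have hlogs' : Real.exp (s - 1) < Real.log n := by
      rw [← Real.lt_log_iff_exp_lt hlog0]; exact h4
    have hcm : ∀ t : List ℕ, (∀ q ∈ t, q.Prime ∧ q ≤ gpf n) →
        (t.map w).prod = Real.exp (σ * Real.log t.prod) := by
      intro t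
      induction t with
      | nil => simp
      | cons q t ih =>
        intro ht
        have hq := ht q (by simp)
        rw [List.map_cons, List.prod_cons, List.prod_cons, ih fun q hq => ht q (by simp [hq])]
        have hwq : w q = Real.exp (σ * Real.log q) := by
          simp only [hwdef]
          rw [if_pos]
          refine lt_of_le_of_lt ?_ (h5.trans_le hlogs)
          refine mul_le_mul_of_nonneg_left (Real.log_le_log ?_ ?_) (by positivity)
          · exact_mod_cast hq.1.pos
          · exact_mod_cast hq.2
        have ht0 : ((t.prod : ℕ) : ℝ) ≠ 0 := by
          refine Nat.cast_ne_zero.2 (List.prod_ne_zero fun h0 => ?_)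
          exact absurd (ht 0 (by simp [h0])).1 Nat.not_prime_zero
        rw [hwq, ← Real.exp_add, Nat.cast_mul, Real.log_mul (by exact_mod_cast hq.1.ne_zero) ht0,
          mul_add]
    have h8 : cm w n = Real.exp (σ * Real.log n) := by
      unfold cm
      rw [hcm _ fun q hq => ⟨Nat.prime_of_mem_primeFactorsList hq, le_gpf (by omega)
        (Nat.prime_of_mem_primeFactorsList hq) (Nat.dvd_of_mem_primeFactorsList hq)⟩,
        Nat.prod_primeFactorsList (by omega)]
    have h9 : L ^ 2 / 12 ≤ σ * Real.log n := by
      have h10 : Real.exp s = Real.exp 1 * Real.exp (s - 1) := by rw [← Real.exp_add]; ring_nf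
      have h11 : Real.exp s ≤ 3 * Real.log n := by
        rw [h10]; nlinarith [Real.exp_one_lt_d9, Real.exp_pos (s - 1)]
      rw [hσ, div_mul_eq_mul_div, div_le_div_iff₀ (by norm_num) (by positivity)]
      nlinarith [sq_nonneg L]
    rw [h8, ← mul_div_assoc, ← Real.exp_add]
    refine div_le_div_of_nonneg_right (Real.one_le_exp (by linarith)) hn0.le
  refine (Finset.sum_le_sum key).trans ?_
  rw [← Finset.mul_sum, show 2 * (L + M) + 18 - L ^ 2 / 12 = -(L ^ 2 / 12) + (2 * (L + M) + 18) by ring,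
    Real.exp_add]
  refine mul_le_mul_of_nonneg_left ?_ (Real.exp_pos _).le
  refine (Finset.sum_le_sum_of_subset_of_nonneg (Finset.filter_subset _ _) fun n _ _ =>
    div_nonneg (cm_nonneg hw n) (Nat.cast_nonneg n)).trans ((sum_cm_div_le hw hw2 N).trans ?_)
  refine Real.exp_le_exp.2 (add_le_add_left ?_ _)
  have h3 := h1 N s hs0
  rw [Finset.filter_true_of_mem fun q hq => (lev_le_iff (mem_primesUpTo.1 hq).1.two_le s).2
    (mem_primesUpTo.1 hq).2] at h3
  calc ∑ q ∈ primesUpTo N, w q / q ≤ ∑ q ∈ primesUpTo N, 2 * ((1 : ℝ) / q) := by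
        refine Finset.sum_le_sum fun q _ => ?_
        rw [← mul_div_assoc, mul_one]
        exact div_le_div_of_nonneg_right (by linarith [hw2 q]) (Nat.cast_nonneg q)
    _ ≤ _ := by rw [← Finset.mul_sum]; linarith

theorem sum_abnormal_aux {M ρ L s δ : ℝ} {k l : ℕ} (hρ : 0 < ρ) (hρ1 : ρ < 1) (hs0 : 0 ≤ s)
    (hsL : s ≤ L) (hδ : 0 < δ) (hδ2 : δ ≤ 1 / 2) (hM : 0 ≤ M)
    (h1 : ∀ (N : ℕ) (b : ℝ), 0 ≤ b →
        ∑ q ∈ (primesUpTo N).filter (fun q => lev q ≤ b), (1 : ℝ) / q ≤ b + M)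
    (h2 : ∀ (N : ℕ) (a b : ℝ), 0 ≤ a → a ≤ b →
        ∑ q ∈ (primesUpTo N).filter (fun q => a < lev q ∧ lev q ≤ b), (1 : ℝ) / q ≤ b - a + M)
    (hl : l ≤ k) :
    Real.exp (∑ q ∈ primesUpTo ⌊Real.exp (Real.exp s)⌋₊,
      (if idx ρ L k q = l then 1 + δ else 1) / (q : ℝ) + 18) ≤
      Real.exp (s + δ * lam ρ L k l + (18 + 2 * M)) := by
  set N := ⌊Real.exp (Real.exp s)⌋₊ with hN
  refine Real.exp_le_exp.2 ?_
  have h3 := h1 N s hs0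
  rw [Finset.filter_true_of_mem fun q hq => (lev_le_iff (mem_primesUpTo.1 hq).1.two_le s).2
    (mem_primesUpTo.1 hq).2] at h3
  have h4 := sum_idx_le hρ hρ1 (hs0.trans hsL) ((lev_floor_le hs0).trans hsL) h1 h2 hl
  rw [← hN] at h4
  have h5 : ∑ q ∈ primesUpTo N, (if idx ρ L k q = l then 1 + δ else 1) / (q : ℝ) =
      ∑ q ∈ primesUpTo N, (1 : ℝ) / q +
        δ * ∑ q ∈ (primesUpTo N).filter (fun q => idx ρ L k q = l), (1 : ℝ) / q := by
    rw [Finset.sum_filter, Finset.mul_sum, ← Finset.sum_add_distrib]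
    refine Finset.sum_congr rfl fun q _ => ?_
    split_ifs <;> ring
  rw [h5]
  nlinarith

theorem one_le_cm_mul_exp {ρ L δ : ℝ} {k l n : ℕ} (hδ : 0 < δ)
    (h : (1 + δ) * lam ρ L k l < Om ρ L k l n) :
    1 ≤ Real.exp (-((1 + δ) * lam ρ L k l * Real.log (1 + δ))) *
      cm (fun q => if idx ρ L k q = l then 1 + δ else 1) n := by
  rw [cm_ite_idx, ← Real.exp_log (show (0 : ℝ) < 1 + δ by linarith), ← Real.exp_nat_mul,
    ← Real.exp_add, Real.exp_log (by linarith)]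
  refine Real.one_le_exp ?_
  have := Real.log_pos (show 1 < 1 + δ by linarith)
  nlinarith

section Abnormal

variable {M ρ L s δ κ : ℝ} {k l : ℕ} (hρ : 0 < ρ) (hρ1 : ρ < 1) (hs0 : 0 ≤ s)
    (hsL : s ≤ L) (hδ : 0 < δ) (hδ2 : δ ≤ 1 / 2) (hM : 0 ≤ M)
    (h1 : ∀ (N : ℕ) (b : ℝ), 0 ≤ b →
        ∑ q ∈ (primesUpTo N).filter (fun q => lev q ≤ b), (1 : ℝ) / q ≤ b + M)
    (h2 : ∀ (N : ℕ) (a b : ℝ), 0 ≤ a → a ≤ b →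
        ∑ q ∈ (primesUpTo N).filter (fun q => a < lev q ∧ lev q ≤ b), (1 : ℝ) / q ≤ b - a + M)
    (hl : l ≤ k) (hsv : SieveBound ⌊Real.exp (Real.exp s)⌋₊ κ) (hκ : 0 ≤ κ)
    (hZ : L ^ 2 ≤ Real.exp (s - 1)) (hL : 1 ≤ L)

include hρ hρ1 hs0 hsL hδ hδ2 hM h1 h2 hl hsv hκ hZ hL

theorem sum_abnormal_le :
    ∑ n ∈ (Finset.Icc 1 ⌊Real.exp (Real.exp s)⌋₊).filter
      (fun n => ((n - 1).Prime ∧ Real.exp (s - 1) / L ^ 2 ≤ Real.log (gpf n)) ∧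
        (1 + δ) * lam ρ L k l < Om ρ L k l n), (1 : ℝ) / n ≤
      Real.exp (19 + 2 * M - ((1 + δ) * Real.log (1 + δ) - δ) * lam ρ L k l) *
        ((2 * κ + 1) * L ^ 2) := by
  set w : ℕ → ℝ := fun q => if idx ρ L k q = l then 1 + δ else 1 with hwdef
  have hw : ∀ q, 0 ≤ w q := fun q => by simp only [hwdef]; split_ifs <;> linarith
  have hw2 : ∀ q, w q ≤ 3 / 2 := fun q => by simp only [hwdef]; split_ifs <;> linarith
  have hZ1 : 1 ≤ Real.exp (s - 1) / L ^ 2 := by rwa [one_le_div (by positivity)]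
  have h3 := sum_shifted_le hsv hκ hZ1 hw hw2
  have h4 := sum_abnormal_aux hρ hρ1 hs0 hsL hδ hδ2 hM h1 h2 hl
  have hL0 : (0 : ℝ) < L ^ 2 := by positivity
  calc _ ≤ ∑ n ∈ (Finset.Icc 1 ⌊Real.exp (Real.exp s)⌋₊).filter
          (fun n => (n - 1).Prime ∧ Real.exp (s - 1) / L ^ 2 ≤ Real.log (gpf n)),
            Real.exp (-((1 + δ) * lam ρ L k l * Real.log (1 + δ))) * (cm w n / n) := by
        refine (Finset.sum_le_sum fun n hn => ?_).trans (Finset.sum_le_sum_of_subset_of_nonneg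
          (fun n hn => ?_) fun n _ _ => mul_nonneg (Real.exp_pos _).le (div_nonneg
            (cm_nonneg hw n) (Nat.cast_nonneg n)))
        · rw [← mul_div_assoc]
          exact div_le_div_of_nonneg_right (one_le_cm_mul_exp hδ (Finset.mem_filter.1 hn).2.2)
            (Nat.cast_nonneg n)
        · exact Finset.mem_filter.2 ⟨(Finset.mem_filter.1 hn).1, (Finset.mem_filter.1 hn).2.1⟩
    _ ≤ Real.exp (-((1 + δ) * lam ρ L k l * Real.log (1 + δ))) *
        (Real.exp (s + δ * lam ρ L k l + (18 + 2 * M)) * ((2 * κ + 1) / (Real.exp (s - 1) / L ^ 2))) := by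
        rw [← Finset.mul_sum]
        refine mul_le_mul_of_nonneg_left (h3.trans ?_) (Real.exp_pos _).le
        exact mul_le_mul_of_nonneg_right h4 (by positivity)
    _ = Real.exp (-((1 + δ) * lam ρ L k l * Real.log (1 + δ))) *
        Real.exp (s + δ * lam ρ L k l + (18 + 2 * M)) * Real.exp (-(s - 1)) *
          ((2 * κ + 1) * L ^ 2) := by
        rw [Real.exp_neg (s - 1)]
        field_simp
    _ = _ := by
        rw [← Real.exp_add, ← Real.exp_add]
        congr 2; ring

theorem sum_abnormal_top_le {B Y : ℝ} (hB : 1 ≤ B) :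
    ∑ n ∈ (Finset.Icc 1 ⌊Real.exp (Real.exp s)⌋₊).filter
      (fun n : ℕ => (((n - 1).Prime ∧ Real.exp (s - 1) / L ^ 2 ≤ Real.log (gpf n)) ∧
        Y / B < n ∧ n ≤ Y) ∧ (1 + δ) * lam ρ L k l < Om ρ L k l n), (1 : ℝ) / n ≤
      Real.exp (20 + 2 * M - ((1 + δ) * Real.log (1 + δ) - δ) * lam ρ L k l - s) *
        (B * (2 * κ + 1) * L ^ 4) := by
  set w : ℕ → ℝ := fun q => if idx ρ L k q = l then 1 + δ else 1 with hwdef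
  have hw : ∀ q, 0 ≤ w q := fun q => by simp only [hwdef]; split_ifs <;> linarith
  have hw2 : ∀ q, w q ≤ 3 / 2 := fun q => by simp only [hwdef]; split_ifs <;> linarith
  have hZ1 : 1 ≤ Real.exp (s - 1) / L ^ 2 := by rwa [one_le_div (by positivity)]
  have h3 := sum_shifted_top_le (Y := Y) hsv hκ hZ1 hw hw2 hB
  have h4 := sum_abnormal_aux hρ hρ1 hs0 hsL hδ hδ2 hM h1 h2 hl
  have hL0 : (0 : ℝ) < L ^ 2 := by positivity
  calc _ ≤ ∑ n ∈ (Finset.Icc 1 ⌊Real.exp (Real.exp s)⌋₊).filter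
          (fun n : ℕ => ((n - 1).Prime ∧ Real.exp (s - 1) / L ^ 2 ≤ Real.log (gpf n)) ∧
            Y / B < n ∧ n ≤ Y),
            Real.exp (-((1 + δ) * lam ρ L k l * Real.log (1 + δ))) * (cm w n / n) := by
        refine (Finset.sum_le_sum fun n hn => ?_).trans (Finset.sum_le_sum_of_subset_of_nonneg
          (fun n hn => ?_) fun n _ _ => mul_nonneg (Real.exp_pos _).le (div_nonneg
            (cm_nonneg hw n) (Nat.cast_nonneg n)))
        · rw [← mul_div_assoc]
          exact div_le_div_of_nonneg_right (one_le_cm_mul_exp hδ (Finset.mem_filter.1 hn).2.2)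
            (Nat.cast_nonneg n)
        · exact Finset.mem_filter.2 ⟨(Finset.mem_filter.1 hn).1, (Finset.mem_filter.1 hn).2.1⟩
    _ ≤ Real.exp (-((1 + δ) * lam ρ L k l * Real.log (1 + δ))) * (B / (Real.exp (s - 1) / L ^ 2) *
        (Real.exp (s + δ * lam ρ L k l + (18 + 2 * M)) * ((2 * κ + 1) / (Real.exp (s - 1) / L ^ 2)))) := by
        rw [← Finset.mul_sum]
        refine mul_le_mul_of_nonneg_left (h3.trans ?_) (Real.exp_pos _).le
        exact mul_le_mul_of_nonneg_left (mul_le_mul_of_nonneg_right h4 (by positivity))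
          (by positivity)
    _ = Real.exp (-((1 + δ) * lam ρ L k l * Real.log (1 + δ))) *
        Real.exp (s + δ * lam ρ L k l + (18 + 2 * M)) * Real.exp (-(s - 1)) * Real.exp (-(s - 1)) *
          (B * (2 * κ + 1) * L ^ 4) := by
        rw [Real.exp_neg (s - 1)]
        field_simp
    _ = _ := by
        rw [← Real.exp_add, ← Real.exp_add, ← Real.exp_add]
        congr 2; ring

end Abnormal

theorem Finset.sum_le_sum_cover {α β : Type*} {A : Finset α} {I : Finset β} (T : β → Finset α)
    (F : α → ℝ) (hF : ∀ a, 0 ≤ F a) (h : ∀ a ∈ A, ∃ i ∈ I, a ∈ T i) :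
    ∑ a ∈ A, F a ≤ ∑ i ∈ I, ∑ a ∈ T i, F a := by
  rw [← Finset.sum_sigma (σ := fun _ => α) I T (fun b => F b.2)]
  refine Finset.sum_le_sum_of_surj (fun b : (Σ _ : β, α) => b.2) F hF fun a ha => ?_
  obtain ⟨i, hi, hT⟩ := h a ha
  exact ⟨⟨i, a⟩, Finset.mem_sigma.2 ⟨hi, hT⟩, rfl⟩

theorem Finset.sum_le_sum_add_sum {α : Type*} {A A₁ A₂ : Finset α} (F : α → ℝ) (hF : ∀ a, 0 ≤ F a)
    (h : ∀ a ∈ A, a ∈ A₁ ∨ a ∈ A₂) : ∑ a ∈ A, F a ≤ ∑ a ∈ A₁, F a + ∑ a ∈ A₂, F a := by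
  have := Finset.sum_le_sum_cover (A := A) (I := {true, false}) (fun b : Bool => if b then A₁ else A₂)
    F hF fun a ha => by have := h a ha; simp; tauto
  refine this.trans (le_of_eq ?_)
  simp

theorem lev_mono {m n : ℕ} (hm : 2 ≤ m) (h : m ≤ n) : lev m ≤ lev n := by
  have h2 : (2 : ℝ) ≤ m := by exact_mod_cast hm
  exact Real.log_le_log (Real.log_pos (by linarith)) (Real.log_le_log (by linarith) (by exact_mod_cast h))

theorem lev_succ_le {p : ℕ} (hp : 2 ≤ p) : lev (p + 1) ≤ lev p + 1 := by
  have h2 : (2 : ℝ) ≤ p := by exact_mod_cast hp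
  have hl : 0 < Real.log p := Real.log_pos (by linarith)
  have h3 : Real.log (p + 1 : ℕ) ≤ Real.exp 1 * Real.log p := by
    have h4 : Real.log (p + 1 : ℕ) ≤ Real.log ((p : ℝ) ^ 2) :=
      Real.log_le_log (by positivity) (by push_cast; nlinarith)
    rw [Real.log_pow] at h4
    push_cast at h4 ⊢
    nlinarith [Real.exp_one_gt_d9]
  have h5 : 0 < Real.log (p + 1 : ℕ) := Real.log_pos (by push_cast; linarith)
  have h6 := Real.log_le_log h5 h3
  rw [Real.log_mul (Real.exp_pos _).ne' hl.ne', Real.log_exp] at h6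
  unfold lev
  linarith

/-- Regularity of the prime factorisation of `n`. -/
def Regular (ρ δ L : ℝ) (k n : ℕ) : Prop :=
  Real.log n ≤ L ^ 2 * Real.log (gpf n) ∧ ∀ l ≤ k, (Om ρ L k l n : ℝ) ≤ (1 + δ) * lam ρ L k l

open Classical in
theorem sum_irregular_le {M ρ L δ κ a b : ℝ} {k : ℕ} (hρ : 0 < ρ) (hρ1 : ρ < 1) (ha : 0 ≤ a)
    (hbL : b ≤ L) (hδ : 0 < δ) (hδ2 : δ ≤ 1 / 2) (hM : 0 ≤ M)
    (h1 : ∀ (N : ℕ) (b : ℝ), 0 ≤ b →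
        ∑ q ∈ (primesUpTo N).filter (fun q => lev q ≤ b), (1 : ℝ) / q ≤ b + M)
    (h2 : ∀ (N : ℕ) (a b : ℝ), 0 ≤ a → a ≤ b →
        ∑ q ∈ (primesUpTo N).filter (fun q => a < lev q ∧ lev q ≤ b), (1 : ℝ) / q ≤ b - a + M)
    (hsv : ∀ s : ℝ, s ≤ L → SieveBound ⌊Real.exp (Real.exp s)⌋₊ κ) (hκ : 0 ≤ κ)
    (hZ : L ^ 2 ≤ Real.exp (a - 1)) (hL : 1 ≤ L) (N : ℕ) :
    ∑ n ∈ (Finset.Icc 4 N).filter (fun n => (n - 1).Prime ∧ (a < lev n ∧ lev n ≤ b) ∧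
      ¬ Regular ρ δ L k n), (1 : ℝ) / n ≤
      (L + 1) * (Real.exp (2 * (L + M) + 18 - L ^ 2 / 12) +
        (k + 1) * (Real.exp (19 + 2 * M - ((1 + δ) * Real.log (1 + δ) - δ) * ((1 - ρ) * (ρ ^ k * L))) *
        ((2 * κ + 1) * L ^ 2))) := by
  have hpos : ∀ n : ℕ, (0 : ℝ) ≤ 1 / n := fun n => by positivity
  have hc0 : 0 ≤ (1 + δ) * Real.log (1 + δ) - δ := by
    have := Real.one_sub_inv_le_log_of_pos (show 0 < 1 + δ by linarith)
    have h3 : (1 + δ) * (1 - (1 + δ)⁻¹) = δ := by field_simp; ring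
    nlinarith
  set D := Real.exp (2 * (L + M) + 18 - L ^ 2 / 12) +
        (k + 1) * (Real.exp (19 + 2 * M - ((1 + δ) * Real.log (1 + δ) - δ) * ((1 - ρ) * (ρ ^ k * L))) *
        ((2 * κ + 1) * L ^ 2)) with hD
  have hD0 : 0 ≤ D := by positivity
  let T : ℕ → Finset ℕ := fun m =>
    (Finset.Icc 4 N).filter (fun n => (n - 1).Prime ∧ (a < lev n ∧ b - m - 1 < lev n ∧ lev n ≤ b - m) ∧
      ¬ Regular ρ δ L k n)
  have hcover : ∀ n ∈ (Finset.Icc 4 N).filter (fun n => (n - 1).Prime ∧ (a < lev n ∧ lev n ≤ b) ∧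
      ¬ Regular ρ δ L k n), ∃ m ∈ Finset.range (⌊L⌋₊ + 1), n ∈ T m := by
    intro n hn
    obtain ⟨hn1, hn2, ⟨hn3, hn4⟩, hn5⟩ := Finset.mem_filter.1 hn
    have h0 : 0 ≤ b - lev n := by linarith
    refine ⟨⌊b - lev n⌋₊, Finset.mem_range.2 (Nat.lt_succ_of_le (Nat.floor_mono (by linarith))),
      Finset.mem_filter.2 ⟨hn1, hn2, ⟨hn3, ?_, ?_⟩, hn5⟩⟩
    · linarith [Nat.lt_floor_add_one (b - lev n)]
    · linarith [Nat.floor_le h0]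
  refine (Finset.sum_le_sum_cover T (fun n : ℕ => (1 : ℝ) / n) hpos hcover).trans ?_
  have hT : ∀ m ∈ Finset.range (⌊L⌋₊ + 1), ∑ n ∈ T m, (1 : ℝ) / n ≤ D := by
    intro m _
    rcases (T m).eq_empty_or_nonempty with h | ⟨n₀, hn₀⟩
    · rw [h, Finset.sum_empty]; exact hD0
    set s := b - m with hs
    have has : a ≤ s := by
      obtain ⟨_, _, ⟨h3, _, h4⟩, _⟩ := Finset.mem_filter.1 hn₀
      linarith
    have hsL : s ≤ L := by
      have : (0 : ℝ) ≤ m := Nat.cast_nonneg m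
      linarith
    have hZs : L ^ 2 ≤ Real.exp (s - 1) := hZ.trans (Real.exp_le_exp.2 (by linarith))
    have hL0 : (0 : ℝ) < L ^ 2 := by positivity
    have hsmooth := sum_smooth_le (ha.trans has) hsL hL h1
    have habn := fun l (hl : l ≤ k) => sum_abnormal_le hρ hρ1 (ha.trans has) hsL hδ hδ2 hM h1 h2 hl
      (hsv s hsL) hκ hZs hL
    refine (Finset.sum_le_sum_add_sum (A₁ := _) (A₂ := (Finset.Icc 1 ⌊Real.exp (Real.exp s)⌋₊).filter
      (fun n => ((n - 1).Prime ∧ Real.exp (s - 1) / L ^ 2 ≤ Real.log (gpf n)) ∧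
        ∃ l ≤ k, (1 + δ) * lam ρ L k l < Om ρ L k l n)) (fun n : ℕ => (1 : ℝ) / n) hpos ?_).trans
      (add_le_add hsmooth (le_trans (Finset.sum_le_sum_cover (I := Finset.range (k + 1)) (fun l =>
        (Finset.Icc 1 ⌊Real.exp (Real.exp s)⌋₊).filter
      (fun n => ((n - 1).Prime ∧ Real.exp (s - 1) / L ^ 2 ≤ Real.log (gpf n)) ∧
        (1 + δ) * lam ρ L k l < Om ρ L k l n)) (fun n : ℕ => (1 : ℝ) / n) hpos ?_)
        ((Finset.sum_le_card_nsmul _ _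
        (Real.exp (19 + 2 * M - ((1 + δ) * Real.log (1 + δ) - δ) * ((1 - ρ) * (ρ ^ k * L))) *
        ((2 * κ + 1) * L ^ 2)) fun l hl => ?_).trans (le_of_eq ?_))))
    · intro n hn
      obtain ⟨hn1, hn2, ⟨_, hn3, hn4⟩, hn5⟩ := Finset.mem_filter.1 hn
      have hn1 := (Finset.mem_Icc.1 hn1).1
      have hmem : n ∈ Finset.Icc 1 ⌊Real.exp (Real.exp s)⌋₊ :=
        Finset.mem_Icc.2 ⟨by omega, (lev_le_iff (by omega) s).1 hn4⟩
      by_cases h3 : L ^ 2 * Real.log (gpf n) < Real.log n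
      · exact Or.inl (Finset.mem_filter.2 ⟨hmem, hn3, h3⟩)
      · refine Or.inr (Finset.mem_filter.2 ⟨hmem, ⟨hn2, ?_⟩, ?_⟩)
        · rw [div_le_iff₀' hL0]
          refine le_trans ?_ (not_lt.1 h3)
          rw [← Real.le_log_iff_exp_le (Real.log_pos (by exact_mod_cast (by omega : 1 < n)))]
          exact hn3.le
        · by_contra hcon
          refine hn5 ⟨not_lt.1 h3, fun l hl => ?_⟩
          by_contra h4
          exact hcon ⟨l, hl, not_le.1 h4⟩
    · intro n hn
      obtain ⟨hn1, hn2, l, hl, hn3⟩ := Finset.mem_filter.1 hn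
      exact ⟨l, Finset.mem_range.2 (by omega), Finset.mem_filter.2 ⟨hn1, hn2, hn3⟩⟩
    · refine (habn l (by have := Finset.mem_range.1 hl; omega)).trans
        (mul_le_mul_of_nonneg_right (Real.exp_le_exp.2 ?_) (by positivity))
      exact sub_le_sub_left (mul_le_mul_of_nonneg_left (le_lam hρ hρ1 (by linarith)) hc0) _
    · rw [Finset.card_range, nsmul_eq_mul]; push_cast; ring
  refine (Finset.sum_le_card_nsmul _ _ _ hT).trans ?_
  rw [Finset.card_range, nsmul_eq_mul]
  refine mul_le_mul_of_nonneg_right ?_ hD0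
  push_cast
  linarith [Nat.floor_le (show 0 ≤ L by linarith)]

open Classical in
theorem card_irregular_le {M ρ L δ κ B X : ℝ} {k : ℕ} (hρ : 0 < ρ) (hρ1 : ρ < 1)
    (hδ : 0 < δ) (hδ2 : δ ≤ 1 / 2) (hM : 0 ≤ M)
    (h1 : ∀ (N : ℕ) (b : ℝ), 0 ≤ b →
        ∑ q ∈ (primesUpTo N).filter (fun q => lev q ≤ b), (1 : ℝ) / q ≤ b + M)
    (h2 : ∀ (N : ℕ) (a b : ℝ), 0 ≤ a → a ≤ b →
        ∑ q ∈ (primesUpTo N).filter (fun q => a < lev q ∧ lev q ≤ b), (1 : ℝ) / q ≤ b - a + M)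
    (hsv : ∀ s : ℝ, s ≤ L → SieveBound ⌊Real.exp (Real.exp s)⌋₊ κ) (hκ : 0 ≤ κ)
    (hZ : L ^ 2 ≤ Real.exp (L - 1)) (hL : 1 ≤ L) (N : ℕ) (hB : 1 ≤ B) (hX : 0 ≤ X) :
    (((Finset.Icc 4 N).filter (fun n : ℕ => (n - 1).Prime ∧ (L - 1 < lev n ∧ lev n ≤ L) ∧
      (X / B < n ∧ n ≤ X) ∧ ¬ Regular ρ δ L k n)).card : ℝ) ≤
      X * (Real.exp (2 * (L + M) + 18 - L ^ 2 / 12) +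
        (k + 1) * (Real.exp (20 + 2 * M - ((1 + δ) * Real.log (1 + δ) - δ) *
          ((1 - ρ) * (ρ ^ k * L)) - L) * (B * (2 * κ + 1) * L ^ 4))) := by
  have hpos : ∀ n : ℕ, (0 : ℝ) ≤ 1 / n := fun n => by positivity
  have hL0 : (0 : ℝ) < L ^ 2 := by positivity
  have hc0 : 0 ≤ (1 + δ) * Real.log (1 + δ) - δ := by
    have := Real.one_sub_inv_le_log_of_pos (show 0 < 1 + δ by linarith)
    have h3 : (1 + δ) * (1 - (1 + δ)⁻¹) = δ := by field_simp; ring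
    nlinarith
  set A := (Finset.Icc 4 N).filter (fun n : ℕ => (n - 1).Prime ∧ (L - 1 < lev n ∧ lev n ≤ L) ∧
      (X / B < n ∧ n ≤ X) ∧ ¬ Regular ρ δ L k n) with hA
  have hcard : (A.card : ℝ) ≤ X * ∑ n ∈ A, (1 : ℝ) / n := by
    rw [Finset.mul_sum, Finset.card_eq_sum_ones, Nat.cast_sum]
    refine Finset.sum_le_sum fun n hn => ?_
    obtain ⟨hn1, hn2, _, hn4, _⟩ := Finset.mem_filter.1 hn
    have : (0 : ℝ) < n := by exact_mod_cast (by have := (Finset.mem_Icc.1 hn1).1; omega : 0 < n)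
    rw [mul_one_div, le_div_iff₀ this]
    push_cast; linarith [hn4.2]
  refine hcard.trans (mul_le_mul_of_nonneg_left ?_ hX)
  have hsmooth := sum_smooth_le (show 0 ≤ L by linarith) le_rfl hL h1
  have habn := fun l (hl : l ≤ k) => sum_abnormal_top_le (Y := X) hρ hρ1 (show 0 ≤ L by linarith)
    le_rfl hδ hδ2 hM h1 h2 hl (hsv L le_rfl) hκ hZ hL hB
  refine (Finset.sum_le_sum_add_sum (A₁ := _) (A₂ := (Finset.Icc 1 ⌊Real.exp (Real.exp L)⌋₊).filter
    (fun n : ℕ => (((n - 1).Prime ∧ Real.exp (L - 1) / L ^ 2 ≤ Real.log (gpf n)) ∧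
      X / B < n ∧ n ≤ X) ∧
      ∃ l ≤ k, (1 + δ) * lam ρ L k l < Om ρ L k l n)) (fun n : ℕ => (1 : ℝ) / n) hpos ?_).trans
    (add_le_add hsmooth (le_trans (Finset.sum_le_sum_cover (I := Finset.range (k + 1)) (fun l =>
      (Finset.Icc 1 ⌊Real.exp (Real.exp L)⌋₊).filter
    (fun n : ℕ => (((n - 1).Prime ∧ Real.exp (L - 1) / L ^ 2 ≤ Real.log (gpf n)) ∧
      X / B < n ∧ n ≤ X) ∧
      (1 + δ) * lam ρ L k l < Om ρ L k l n)) (fun n : ℕ => (1 : ℝ) / n) hpos ?_)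
      ((Finset.sum_le_card_nsmul _ _
      (Real.exp (20 + 2 * M - ((1 + δ) * Real.log (1 + δ) - δ) *
          ((1 - ρ) * (ρ ^ k * L)) - L) * (B * (2 * κ + 1) * L ^ 4)) fun l hl => ?_).trans (le_of_eq ?_))))
  · intro n hn
    obtain ⟨hn1, hn2, ⟨hn3, hn4⟩, hX, hn5⟩ := Finset.mem_filter.1 hn
    have hn1 := (Finset.mem_Icc.1 hn1).1
    have hmem : n ∈ Finset.Icc 1 ⌊Real.exp (Real.exp L)⌋₊ :=
      Finset.mem_Icc.2 ⟨by omega, (lev_le_iff (by omega) L).1 hn4⟩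
    by_cases h3 : L ^ 2 * Real.log (gpf n) < Real.log n
    · exact Or.inl (Finset.mem_filter.2 ⟨hmem, hn3, h3⟩)
    · refine Or.inr (Finset.mem_filter.2 ⟨hmem, ⟨⟨hn2, ?_⟩, hX⟩, ?_⟩)
      · rw [div_le_iff₀' hL0]
        refine le_trans ?_ (not_lt.1 h3)
        rw [← Real.le_log_iff_exp_le (Real.log_pos (by exact_mod_cast (by omega : 1 < n)))]
        exact hn3.le
      · by_contra hcon
        refine hn5 ⟨not_lt.1 h3, fun l hl => ?_⟩
        by_contra h4
        exact hcon ⟨l, hl, not_le.1 h4⟩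
  · intro n hn
    obtain ⟨hn1, hn2, l, hl, hn3⟩ := Finset.mem_filter.1 hn
    exact ⟨l, Finset.mem_range.2 (by omega), Finset.mem_filter.2 ⟨hn1, hn2, hn3⟩⟩
  · refine (habn l (by have := Finset.mem_range.1 hl; omega)).trans
      (mul_le_mul_of_nonneg_right (Real.exp_le_exp.2 ?_) (by positivity))
    refine sub_le_sub_right ?_ _
    exact sub_le_sub_left (mul_le_mul_of_nonneg_left (le_lam hρ hρ1 (by linarith)) hc0) _
  · rw [Finset.card_range, nsmul_eq_mul]; push_cast; ring

/-- Lower bound for the reciprocal sum of all shifted primes in a band of levels. -/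
theorem le_sum_shifted {M a b : ℝ} {N : ℕ} (ha : 1 ≤ a) (hab : a ≤ b - 1)
    (h3 : ∀ (N : ℕ) (a b : ℝ), 0 ≤ a → a ≤ b → ⌊Real.exp (Real.exp b)⌋₊ ≤ N →
        b - a - M ≤ ∑ q ∈ (primesUpTo N).filter (fun q => a < lev q ∧ lev q ≤ b), (1 : ℝ) / q)
    (hN : ⌊Real.exp (Real.exp b)⌋₊ ≤ N) :
    (b - 1 - a - M) / 2 ≤ ∑ n ∈ (Finset.Icc 4 N).filter
      (fun n => (n - 1).Prime ∧ (a < lev n ∧ lev n ≤ b)), (1 : ℝ) / n := by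
  have hexp : Real.exp (Real.exp (b - 1)) ≤ Real.exp (Real.exp b) :=
    Real.exp_le_exp.2 (Real.exp_le_exp.2 (by linarith))
  have h := h3 N a (b - 1) (by linarith) hab ((Nat.floor_mono hexp).trans hN)
  rw [div_le_iff₀ two_pos]
  refine h.trans ?_
  rw [Finset.sum_mul]
  set A := (primesUpTo N).filter (fun q => a < lev q ∧ lev q ≤ b - 1) with hA
  have hinj : Set.InjOn (fun p : ℕ => p + 1) A := fun p _ q _ h => by simpa using h
  have hsub : A.image (fun p => p + 1) ⊆ (Finset.Icc 4 N).filter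
      (fun n => (n - 1).Prime ∧ (a < lev n ∧ lev n ≤ b)) := by
    intro n hn
    obtain ⟨p, hp, rfl⟩ := Finset.mem_image.1 hn
    obtain ⟨hp1, hp2, hp3⟩ := Finset.mem_filter.1 hp
    obtain ⟨hpp, _⟩ := mem_primesUpTo.1 hp1
    have h5 := lev_succ_le hpp.two_le
    have hp3' : p ≠ 2 := by
      rintro rfl
      have h6 : lev 2 ≤ 0 := by
        unfold lev
        refine Real.log_nonpos (Real.log_nonneg (by norm_num)) ?_
        have := Real.log_two_lt_d9
        push_cast; linarith
      linarith
    refine Finset.mem_filter.2 ⟨Finset.mem_Icc.2 ⟨by have := hpp.two_le; omega, ?_⟩,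
      by simpa using hpp, hp2.trans_le (lev_mono hpp.two_le (Nat.le_succ p)), by linarith⟩
    exact ((lev_le_iff (by have := hpp.two_le; omega) b).1 (by linarith)).trans hN
  refine le_trans ?_ (Finset.sum_le_sum_of_subset_of_nonneg hsub fun _ _ _ => by positivity)
  rw [Finset.sum_image (f := fun n : ℕ => (1 : ℝ) / n * 2) hinj]
  refine Finset.sum_le_sum fun p hp => ?_
  have hpp := (mem_primesUpTo.1 (Finset.mem_filter.1 hp).1).1
  have : (1 : ℝ) ≤ p := by exact_mod_cast hpp.one_le
  rw [one_div_mul_eq_div, div_le_div_iff₀ (by linarith) (by positivity)]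
  push_cast; linarith

theorem Nat.exists_dvd_prod_eq_of_dvd_prod {β : Type*} (t : Finset β) (Q : β → ℕ) (d : ℕ)
    (h : d ∣ ∏ j ∈ t, Q j) : ∃ e : β → ℕ, (∀ j ∈ t, e j ∣ Q j) ∧ ∏ j ∈ t, e j = d := by
  classical
  induction t using Finset.induction_on generalizing d with
  | empty => exact ⟨fun _ => 1, by simp, by simpa [eq_comm] using h⟩
  | insert j t hj ih =>
    rw [Finset.prod_insert hj] at h
    obtain ⟨d₁, d₂, h₁, h₂, rfl⟩ := exists_dvd_and_dvd_of_dvd_mul h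
    obtain ⟨e, he, rfl⟩ := ih d₂ h₂
    refine ⟨Function.update e j d₁, fun i hi => ?_, ?_⟩
    · rcases eq_or_ne i j with rfl | hij
      · simpa using h₁
      · rw [Function.update_of_ne hij]
        exact he i (Finset.mem_of_mem_insert_of_ne hi hij)
    · rw [Finset.prod_insert hj, Function.update_self, Finset.prod_update_of_notMem hj]

/-- Two factorisations of a number have a common refinement. -/
theorem Nat.exists_refinement {α β : Type*} (s : Finset α) (t : Finset β) (P : α → ℕ)
    (Q : β → ℕ) (hQ : ∀ j ∈ t, Q j ≠ 0) (h : ∏ i ∈ s, P i = ∏ j ∈ t, Q j) :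
    ∃ a : α → β → ℕ, (∀ i ∈ s, ∏ j ∈ t, a i j = P i) ∧ ∀ j ∈ t, ∏ i ∈ s, a i j = Q j := by
  classical
  induction s using Finset.induction_on generalizing Q with
  | empty =>
    refine ⟨fun _ _ => 1, by simp, fun j hj => ?_⟩
    rw [Finset.prod_empty] at h ⊢
    exact (Nat.dvd_one.1 (h ▸ Finset.dvd_prod_of_mem Q hj)).symm
  | insert i s hi ih =>
    rw [Finset.prod_insert hi] at h
    obtain ⟨e, he, hd⟩ := Nat.exists_dvd_prod_eq_of_dvd_prod t Q (P i) (h ▸ Dvd.intro _ rfl)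
    choose! r hr using he
    have hQ' : ∀ j ∈ t, e j * r j ≠ 0 := fun j hj => by rw [← hr j hj]; exact hQ j hj
    have hP : P i ≠ 0 := by
      rw [← hd]
      exact Finset.prod_ne_zero_iff.2 fun j hj => left_ne_zero_of_mul (hQ' j hj)
    obtain ⟨a, h1, h2⟩ := ih r (fun j hj => right_ne_zero_of_mul (hQ' j hj)) (by
      rw [Finset.prod_congr rfl hr, Finset.prod_mul_distrib, hd] at h
      exact Nat.eq_of_mul_eq_mul_left (Nat.pos_of_ne_zero hP) h)
    refine ⟨Function.update a i e, fun i' hi' => ?_, fun j hj => ?_⟩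
    · rcases eq_or_ne i' i with rfl | hne
      · simpa using hd
      · rw [Function.update_of_ne hne]
        exact h1 i' (Finset.mem_of_mem_insert_of_ne hi' hne)
    · rw [Finset.prod_insert hi, Function.update_self, hr j hj, ← h2 j hj]
      congr 1
      refine Finset.prod_congr rfl fun i' hi' => ?_
      rw [Function.update_of_ne (fun h : i' = i => hi (h ▸ hi'))]

theorem cm_prod {β : Type*} (w : ℕ → ℝ) (t : Finset β) (a : β → ℕ) (h : ∀ j ∈ t, a j ≠ 0) :
    cm w (∏ j ∈ t, a j) = ∏ j ∈ t, cm w (a j) := by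
  classical
  induction t using Finset.induction_on with
  | empty => simp [cm_one]
  | insert j t hj ih =>
    rw [Finset.prod_insert hj, Finset.prod_insert hj, cm_mul w (h j (by simp))
      (Finset.prod_ne_zero_iff.2 fun i hi => h i (Finset.mem_insert_of_mem hi)),
      ih fun i hi => h i (Finset.mem_insert_of_mem hi)]

/-- The properties of the families of shifted primes entering the construction. -/
structure RowHyp (ρ δ L : ℝ) (k N : ℕ) (z : Fin (k + 1) → ℝ) (G : Fin (k + 1) → Finset ℕ) :
    Prop where
  four_le : ∀ i, ∀ n ∈ G i, 4 ≤ n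
  prime : ∀ i, ∀ n ∈ G i, (n - 1).Prime
  le : ∀ i, ∀ n ∈ G i, n ≤ N
  gpf_le : ∀ i, ∀ n ∈ G i, Real.exp (z i) / L ^ 2 ≤ Real.log (gpf n)
  lev_le : ∀ i, ∀ n ∈ G i, lev n ≤ ρ ^ (i : ℕ) * L
  om_le : ∀ i, ∀ n ∈ G i, ∀ l ≤ k, (Om ρ L k l n : ℝ) ≤ (1 + δ) * lam ρ L k l
  disj : ∀ i j, i ≠ j → ∀ n ∈ G i, n ∉ G j

/-- The vectors with entries from `G` on `J` and `1` elsewhere. -/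
def rowFam {k : ℕ} (G : Fin (k + 1) → Finset ℕ) (J : Finset (Fin (k + 1))) :
    Finset (Fin (k + 1) → ℕ) :=
  Fintype.piFinset fun i => if i ∈ J then G i else {1}

/-- Pairs of vectors with the same product that differ everywhere on `J`. -/
def collPairs {k : ℕ} (G : Fin (k + 1) → Finset ℕ) (J : Finset (Fin (k + 1))) :
    Finset ((Fin (k + 1) → ℕ) × (Fin (k + 1) → ℕ)) :=
  (rowFam G J ×ˢ rowFam G J).filter fun p => (∀ i ∈ J, p.1 i ≠ p.2 i) ∧ ∏ i, p.1 i = ∏ i, p.2 i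

/-- The number of elements of `J` up to `l`. -/
def cnt {k : ℕ} (J : Finset (Fin (k + 1))) (l : ℕ) : ℕ := (J.filter fun j : Fin (k + 1) => (j : ℕ) ≤ l).card

/-- The weight of the prime `q` in the cell `c`. -/
noncomputable def wt (ρ L : ℝ) {k : ℕ} (J : Finset (Fin (k + 1))) (c : Fin (k + 1) × Fin (k + 1))
    (q : ℕ) : ℝ :=
  if c ∈ (J.filter fun j : Fin (k + 1) => (j : ℕ) ≤ idx ρ L k q) ×ˢ
    (J.filter fun j : Fin (k + 1) => (j : ℕ) ≤ idx ρ L k q) then (cnt J (idx ρ L k q) : ℝ)⁻¹ else 0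

/-- Rows and columns of the square array. -/
def gridLine {k : ℕ} : Fin (k + 1) ⊕ Fin (k + 1) → Finset (Fin (k + 1) × Fin (k + 1))
  | Sum.inl i => {i} ×ˢ Finset.univ
  | Sum.inr j => Finset.univ ×ˢ {j}

section Coll

variable {ρ δ L : ℝ} {k N : ℕ} {z : Fin (k + 1) → ℝ} {G : Fin (k + 1) → Finset ℕ}
  {J : Finset (Fin (k + 1))}

theorem wt_nonneg (c : Fin (k + 1) × Fin (k + 1)) (q : ℕ) : 0 ≤ wt ρ L J c q := by
  unfold wt; split_ifs <;> positivity

theorem wt_le (c : Fin (k + 1) × Fin (k + 1)) (q : ℕ) : wt ρ L J c q ≤ 1 := by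
  unfold wt; split_ifs
  · exact Nat.cast_inv_le_one _
  · exact zero_le_one

theorem sum_wt (q : ℕ) : ∑ c, wt ρ L J c q = cnt J (idx ρ L k q) := by
  unfold wt
  rw [← Finset.sum_filter, Finset.filter_univ_mem, Finset.sum_const, Finset.card_product, nsmul_eq_mul]
  rcases eq_or_ne (cnt J (idx ρ L k q)) 0 with h | h
  · rw [h]; simp
  · unfold cnt at h ⊢
    push_cast
    field_simp

theorem sum_wt_div_le {M : ℝ} (hρ : 0 < ρ) (hρ1 : ρ < 1) (hL : 0 ≤ L) {N : ℕ} (hN : lev N ≤ L)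
    (h1 : ∀ (N : ℕ) (b : ℝ), 0 ≤ b →
        ∑ q ∈ (primesUpTo N).filter (fun q => lev q ≤ b), (1 : ℝ) / q ≤ b + M)
    (h2 : ∀ (N : ℕ) (a b : ℝ), 0 ≤ a → a ≤ b →
        ∑ q ∈ (primesUpTo N).filter (fun q => a < lev q ∧ lev q ≤ b), (1 : ℝ) / q ≤ b - a + M) :
    ∑ c, ∑ q ∈ primesUpTo N, wt ρ L J c q / q ≤
      ∑ l ∈ Finset.range (k + 1), cnt J l * (lam ρ L k l + M) := by
  rw [Finset.sum_comm]
  simp_rw [← Finset.sum_div, sum_wt]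
  rw [← Finset.sum_fiberwise_of_maps_to (g := fun q => idx ρ L k q) (t := Finset.range (k + 1))
    fun q _ => Finset.mem_range.2 (Nat.lt_succ_of_le (idx_le q))]
  refine Finset.sum_le_sum fun l hl => ?_
  refine le_trans (le_of_eq ?_) (mul_le_mul_of_nonneg_left (sum_idx_le hρ hρ1 hL hN h1 h2
    (Nat.lt_succ_iff.1 (Finset.mem_range.1 hl))) (Nat.cast_nonneg _))
  rw [Finset.mul_sum]
  refine Finset.sum_congr rfl fun q hq => ?_
  rw [(Finset.mem_filter.1 hq).2, mul_one_div]

theorem grid_cfgHyp {κ H : ℝ} (hs : SieveBound N κ) (hκ : 0 ≤ κ) (hZ : ∀ i, 1 ≤ Real.exp (z i) / L ^ 2)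
    (hH : 1 ≤ H) (hκH : 2 * (k + 1) ^ 2 * κ ≤ H) :
    CfgHyp (gridLine (k := k)) N (Sum.elim (fun i => Real.exp (z i) / L ^ 2) fun i => Real.exp (z i) / L ^ 2)
      (fun c => cm (wt ρ L J c)) κ H where
  nonneg c n := cm_nonneg (wt_nonneg c) n
  mul_le c _ _ hp hr := cm_mul_le (wt_nonneg c) (fun q => (wt_le c q).trans (by norm_num)) hp hr
  one_le l := by rcases l with l | l <;> exact hZ l
  card_le Λ c := by
    refine (Finset.card_le_card (t := {Sum.inl c.1, Sum.inr c.2}) fun l hl => ?_).trans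
      Finset.card_le_two
    have h := (Finset.mem_filter.1 hl).2
    rcases l with l | l
    · simp only [gridLine, Finset.mem_product, Finset.mem_singleton] at h
      simp [h.1]
    · simp only [gridLine, Finset.mem_product, Finset.mem_singleton] at h
      simp [h.2]
  sieve := hs
  kappa := hκ
  one_le_H := hH
  le_H := by
    refine le_trans (le_of_eq ?_) hκH
    rw [Fintype.card_prod, Fintype.card_fin]; push_cast; ring

theorem cm_inv_cnt {i : Fin (k + 1)} (hi : i ∈ J) {n : ℕ} (h : ∀ q ∈ n.primeFactorsList, (i : ℕ) ≤ idx ρ L k q) :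
    cm (fun q => (cnt J (idx ρ L k q) : ℝ)⁻¹) n =
      Real.exp (-∑ l ∈ Finset.Icc (i : ℕ) k, Om ρ L k l n * Real.log (cnt J l)) := by
  unfold cm Om
  generalize n.primeFactorsList = t at h ⊢
  induction t with
  | nil => simp
  | cons q t ih =>
    have hq := h q (by simp)
    have hc : (0 : ℝ) < cnt J (idx ρ L k q) := by
      have : 0 < cnt J (idx ρ L k q) := Finset.card_pos.2 ⟨i, Finset.mem_filter.2 ⟨hi, hq⟩⟩
      exact_mod_cast this
    rw [List.map_cons, List.prod_cons, ih fun q hq => h q (by simp [hq])]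
    have h3 : ∑ l ∈ Finset.Icc (i : ℕ) k, (((q :: t).filter fun q => idx ρ L k q = l).length : ℝ) *
        Real.log (cnt J l) = Real.log (cnt J (idx ρ L k q)) +
        ∑ l ∈ Finset.Icc (i : ℕ) k, ((t.filter fun q => idx ρ L k q = l).length : ℝ) *
          Real.log (cnt J l) := by
      have h4 : Real.log (cnt J (idx ρ L k q)) = ∑ l ∈ Finset.Icc (i : ℕ) k,
          if idx ρ L k q = l then Real.log (cnt J l) else 0 := by
        rw [Finset.sum_ite_eq, if_pos (Finset.mem_Icc.2 ⟨hq, idx_le q⟩)]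
      rw [h4, ← Finset.sum_add_distrib]
      refine Finset.sum_congr rfl fun l _ => ?_
      rw [List.filter_cons]
      by_cases h5 : idx ρ L k q = l
      · simp [h5]; ring
      · simp [h5]
    rw [h3, neg_add, Real.exp_add, Real.exp_neg (Real.log _), Real.exp_log hc]

end Coll

section Coll

variable {ρ δ L : ℝ} {k N : ℕ} {z : Fin (k + 1) → ℝ} {G : Fin (k + 1) → Finset ℕ}
  {J : Finset (Fin (k + 1))}

theorem sum_mem_sum_Icc (X : ℕ → ℝ) :
    ∑ i ∈ J, ∑ l ∈ Finset.Icc (i : ℕ) k, X l = ∑ l ∈ Finset.range (k + 1), cnt J l * X l := by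
  have h : ∀ i ∈ J, ∑ l ∈ Finset.Icc (i : ℕ) k, X l =
      ∑ l ∈ Finset.range (k + 1), if (i : ℕ) ≤ l then X l else 0 := by
    intro i _
    rw [← Finset.sum_filter]
    refine Finset.sum_congr ?_ fun _ _ => rfl
    ext l
    simp only [Finset.mem_Icc, Finset.mem_filter, Finset.mem_range]
    omega
  rw [Finset.sum_congr rfl h, Finset.sum_comm]
  refine Finset.sum_congr rfl fun l _ => ?_
  rw [← Finset.sum_filter, Finset.sum_const, nsmul_eq_mul, cnt]

theorem cm_congr {w w' : ℕ → ℝ} {n : ℕ} (h : ∀ q ∈ n.primeFactorsList, w q = w' q) :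
    cm w n = cm w' n := by
  unfold cm
  rw [List.map_congr_left h]

theorem RowHyp.le_idx (h : RowHyp ρ δ L k N z G) {i : Fin (k + 1)} {n q : ℕ} (hn : n ∈ G i)
    (hq : q.Prime) (hd : q ∣ n) : (i : ℕ) ≤ idx ρ L k q := by
  have h4 := h.four_le i n hn
  exact _root_.le_idx (Nat.lt_succ_iff.1 i.2)
    ((lev_mono hq.two_le (Nat.le_of_dvd (by omega) hd)).trans (h.lev_le i n hn))

theorem mem_collPairs {p : (Fin (k + 1) → ℕ) × (Fin (k + 1) → ℕ)} :
    p ∈ collPairs G J ↔ ((∀ i, p.1 i ∈ if i ∈ J then G i else {1}) ∧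
      ∀ i, p.2 i ∈ if i ∈ J then G i else {1}) ∧
      (∀ i ∈ J, p.1 i ≠ p.2 i) ∧ ∏ i, p.1 i = ∏ i, p.2 i := by
  rw [collPairs, Finset.mem_filter, Finset.mem_product, rowFam, Fintype.mem_piFinset,
    Fintype.mem_piFinset]

theorem RowHyp.one_le_rankin (h : RowHyp ρ δ L k N z G)
    {P Q : Fin (k + 1) → ℕ} (hPQ : (P, Q) ∈ collPairs G J) {a : Fin (k + 1) → Fin (k + 1) → ℕ}
    (hP : ∀ i, ∏ j, a i j = P i) (hQ : ∀ j, ∏ i, a i j = Q j) :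
    1 ≤ Real.exp (∑ l ∈ Finset.range (k + 1), cnt J l * ((1 + δ) * lam ρ L k l * Real.log (cnt J l))) *
      ∏ c : Fin (k + 1) × Fin (k + 1), cm (wt ρ L J c) (a c.1 c.2) := by
  obtain ⟨⟨hP1, hQ1⟩, -, -⟩ := mem_collPairs.1 hPQ
  have hrow : ∀ i, Real.exp (-(if i ∈ J then ∑ l ∈ Finset.Icc (i : ℕ) k,
      ((1 + δ) * lam ρ L k l * Real.log (cnt J l)) else 0)) ≤
      ∏ j, cm (wt ρ L J (i, j)) (a i j) := by
    intro i
    by_cases hi : i ∈ J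
    · have hPi : P i ∈ G i := by simpa [hi] using hP1 i
      have hP0 : P i ≠ 0 := by have := h.four_le i _ hPi; omega
      have ha0 : ∀ j, a i j ≠ 0 := fun j =>
        Finset.prod_ne_zero_iff.1 (by rw [hP i]; exact hP0) j (Finset.mem_univ j)
      have h3 : ∀ j, cm (wt ρ L J (i, j)) (a i j) =
          cm (fun q => (cnt J (idx ρ L k q) : ℝ)⁻¹) (a i j) := by
        intro j
        by_cases hj : j ∈ J
        · refine cm_congr fun q hq => ?_
          have hqp := Nat.prime_of_mem_primeFactorsList hq
          have hqd := Nat.dvd_of_mem_primeFactorsList hq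
          have h4 := h.le_idx hPi hqp (hqd.trans (hP i ▸ Finset.dvd_prod_of_mem _ (Finset.mem_univ j)))
          have hQj : Q j ∈ G j := by simpa [hj] using hQ1 j
          have h5 := h.le_idx hQj hqp (hqd.trans (hQ j ▸
            Finset.dvd_prod_of_mem (fun i => a i j) (Finset.mem_univ i)))
          unfold wt
          rw [if_pos]
          simp only [Finset.mem_product, Finset.mem_filter]
          exact ⟨⟨hi, h4⟩, hj, h5⟩
        · have hQj : Q j = 1 := by simpa [hj] using hQ1 j
          have : a i j = 1 := Nat.dvd_one.1 (hQj ▸ hQ j ▸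
            Finset.dvd_prod_of_mem (fun i => a i j) (Finset.mem_univ i))
          rw [this, cm_one, cm_one]
      rw [if_pos hi, Finset.prod_congr rfl fun j _ => h3 j, ← cm_prod _ _ _ fun j _ => ha0 j, hP i,
        cm_inv_cnt hi fun q hq => h.le_idx hPi (Nat.prime_of_mem_primeFactorsList hq)
          (Nat.dvd_of_mem_primeFactorsList hq)]
      refine Real.exp_le_exp.2 (neg_le_neg (Finset.sum_le_sum fun l hl => ?_))
      exact mul_le_mul_of_nonneg_right (h.om_le i _ hPi l (Finset.mem_Icc.1 hl).2)
        (Real.log_natCast_nonneg _)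
    · have hPi : P i = 1 := by simpa [hi] using hP1 i
      have ha : ∀ j, a i j = 1 := fun j => Nat.dvd_one.1 (hPi ▸ hP i ▸
        Finset.dvd_prod_of_mem _ (Finset.mem_univ j))
      simp [hi, ha, cm_one]
  have h6 := Finset.prod_le_prod (s := Finset.univ) (fun i _ => (Real.exp_pos _).le)
    fun i _ => hrow i
  rw [← Real.exp_sum, Finset.sum_neg_distrib, Finset.sum_ite_mem, Finset.univ_inter,
    sum_mem_sum_Icc] at h6
  rw [Fintype.prod_prod_type]
  rw [Real.exp_neg] at h6
  have := mul_le_mul_of_nonneg_left h6 (Real.exp_pos (∑ l ∈ Finset.range (k + 1),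
    cnt J l * ((1 + δ) * lam ρ L k l * Real.log (cnt J l)))).le
  rwa [mul_inv_cancel₀ (Real.exp_pos _).ne'] at this

/-- The exponent in the bound for the number of collisions. -/
noncomputable def collExp (ρ δ L M H : ℝ) {k : ℕ} (z : Fin (k + 1) → ℝ) (J : Finset (Fin (k + 1))) : ℝ :=
  ∑ l ∈ Finset.range (k + 1), cnt J l * ((1 + δ) * lam ρ L k l * Real.log (cnt J l)) +
    (∑ l ∈ Finset.range (k + 1), cnt J l * (lam ρ L k l + M) + 18 * (k + 1) ^ 2 +
      2 * ∑ j ∈ J, (Real.log (H * L ^ 2) - z j))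

theorem prod_euler_le {M H : ℝ} (hρ : 0 < ρ) (hρ1 : ρ < 1) (hL : 1 ≤ L) (hN : lev N ≤ L)
    (h1 : ∀ (N : ℕ) (b : ℝ), 0 ≤ b →
        ∑ q ∈ (primesUpTo N).filter (fun q => lev q ≤ b), (1 : ℝ) / q ≤ b + M)
    (h2 : ∀ (N : ℕ) (a b : ℝ), 0 ≤ a → a ≤ b →
        ∑ q ∈ (primesUpTo N).filter (fun q => a < lev q ∧ lev q ≤ b), (1 : ℝ) / q ≤ b - a + M)
    (hH : 1 ≤ H) :
    Real.exp (∑ l ∈ Finset.range (k + 1), cnt J l * ((1 + δ) * lam ρ L k l * Real.log (cnt J l))) *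
    ((∏ c : Fin (k + 1) × Fin (k + 1), ∑ n ∈ Finset.Icc 1 N, cm (wt ρ L J c) n / n) *
      ∏ l ∈ J.disjSum J, H / Sum.elim (fun i => Real.exp (z i) / L ^ 2)
        (fun i => Real.exp (z i) / L ^ 2) l) ≤ Real.exp (collExp ρ δ L M H z J) := by
  rw [collExp, Real.exp_add]
  refine mul_le_mul_of_nonneg_left ?_ (Real.exp_pos _).le
  rw [Real.exp_add]
  refine mul_le_mul ?_ (le_of_eq ?_) (Finset.prod_nonneg fun l _ => ?_) (Real.exp_pos _).le
  · refine (Finset.prod_le_prod (fun c _ => Finset.sum_nonneg fun n _ =>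
      div_nonneg (cm_nonneg (wt_nonneg c) n) (Nat.cast_nonneg n)) fun c _ =>
      sum_cm_div_le (wt_nonneg c) (fun q => (wt_le c q).trans (by norm_num)) N).trans ?_
    rw [← Real.exp_sum, Finset.sum_add_distrib, Finset.sum_const, Finset.card_univ,
      Fintype.card_prod, Fintype.card_fin, nsmul_eq_mul]
    refine Real.exp_le_exp.2 (add_le_add (sum_wt_div_le hρ hρ1 (by linarith) hN h1 h2)
      (le_of_eq ?_))
    push_cast; ring
  · rw [Finset.prod_disjSum]
    simp only [Sum.elim_inl, Sum.elim_inr]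
    rw [← Finset.prod_mul_distrib, Finset.mul_sum, Real.exp_sum]
    refine Finset.prod_congr rfl fun j _ => ?_
    rw [two_mul, Real.exp_add, Real.exp_sub, Real.exp_log (by positivity)]
    field_simp
  · rcases l with l | l <;> simp only [Sum.elim_inl, Sum.elim_inr] <;> positivity

theorem prod_gridLine_inl (a : Fin (k + 1) × Fin (k + 1) → ℕ) (i : Fin (k + 1)) :
    ∏ c ∈ gridLine (Sum.inl i), a c = ∏ j, a (i, j) := by
  rw [gridLine, Finset.prod_product, Finset.prod_singleton]

theorem prod_gridLine_inr (a : Fin (k + 1) × Fin (k + 1) → ℕ) (j : Fin (k + 1)) :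
    ∏ c ∈ gridLine (Sum.inr j), a c = ∏ i, a (i, j) := by
  rw [gridLine, Finset.prod_product_right, Finset.prod_singleton]

theorem RowHyp.exists_cfg (h : RowHyp ρ δ L k N z G) (hN : 1 ≤ N)
    {p : (Fin (k + 1) → ℕ) × (Fin (k + 1) → ℕ)} (hp : p ∈ collPairs G J) :
    ∃ a ∈ cfg (gridLine (k := k)) N (Sum.elim (fun i => Real.exp (z i) / L ^ 2)
      fun i => Real.exp (z i) / L ^ 2) (J.disjSum J),
      ((fun i => ∏ j, a (i, j), fun j => ∏ i, a (i, j)) : (Fin (k + 1) → ℕ) × (Fin (k + 1) → ℕ)) = p := by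
  obtain ⟨⟨hP1, hQ1⟩, hne, heq⟩ := mem_collPairs.1 hp
  have hG : ∀ {p : Fin (k + 1) → ℕ}, (∀ i, p i ∈ if i ∈ J then G i else {1}) → ∀ i,
      1 ≤ p i ∧ p i ≤ N ∧ (i ∈ J → p i ∈ G i) := by
    intro p hp i
    have h3 := hp i
    by_cases hi : i ∈ J
    · rw [if_pos hi] at h3
      exact ⟨by have := h.four_le i _ h3; omega, h.le i _ h3, fun _ => h3⟩
    · rw [if_neg hi, Finset.mem_singleton] at h3
      exact ⟨h3.ge, h3 ▸ hN, fun h => absurd h hi⟩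
  have hP := hG hP1
  have hQ := hG hQ1
  obtain ⟨a, ha1, ha2⟩ := Nat.exists_refinement Finset.univ Finset.univ p.1 p.2
    (fun j _ => by have := (hQ j).1; omega) heq
  have ha1 := fun i => ha1 i (Finset.mem_univ i)
  have ha2 := fun i => ha2 i (Finset.mem_univ i)
  refine ⟨fun c => a c.1 c.2, mem_cfg.2 ⟨fun c => ?_, fun l hl => ?_, fun l hl l' hl' hll => ?_⟩,
    Prod.ext (funext ha1) (funext ha2)⟩
  · have h3 : a c.1 c.2 ∣ p.1 c.1 := ha1 c.1 ▸ Finset.dvd_prod_of_mem _ (Finset.mem_univ c.2)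
    have h4 := (hP c.1).1
    have h5 := (hP c.1).2.1
    exact Finset.mem_Icc.2 ⟨Nat.pos_of_dvd_of_pos h3 (by omega),
      (Nat.le_of_dvd (by omega) h3).trans h5⟩
  · rcases l with i | j
    · rw [prod_gridLine_inl, ha1]
      have hi := (hP i).2.2 (Finset.inl_mem_disjSum.1 hl)
      exact ⟨h.prime i _ hi, h.le i _ hi, h.gpf_le i _ hi⟩
    · rw [prod_gridLine_inr, ha2]
      have hi := (hQ j).2.2 (Finset.inr_mem_disjSum.1 hl)
      exact ⟨h.prime j _ hi, h.le j _ hi, h.gpf_le j _ hi⟩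
  · have key : ∀ {i j : Fin (k + 1)} {m n : ℕ}, i ≠ j → m ∈ G i → n ∈ G j → m ≠ n :=
      fun hij hm hn hmn => h.disj _ _ hij _ hm (hmn ▸ hn)
    rcases l with i | i <;> rcases l' with j | j
    · rw [prod_gridLine_inl, prod_gridLine_inl, ha1, ha1]
      exact key (fun h => hll (congrArg Sum.inl h)) ((hP i).2.2 (Finset.inl_mem_disjSum.1 hl))
        ((hP j).2.2 (Finset.inl_mem_disjSum.1 hl'))
    · rw [prod_gridLine_inl, prod_gridLine_inr, ha1, ha2]
      rcases eq_or_ne i j with rfl | hij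
      · exact hne i (Finset.inl_mem_disjSum.1 hl)
      · exact key hij ((hP i).2.2 (Finset.inl_mem_disjSum.1 hl))
          ((hQ j).2.2 (Finset.inr_mem_disjSum.1 hl'))
    · rw [prod_gridLine_inr, prod_gridLine_inl, ha1, ha2]
      rcases eq_or_ne j i with rfl | hij
      · exact (hne j (Finset.inl_mem_disjSum.1 hl')).symm
      · exact (key hij ((hP j).2.2 (Finset.inl_mem_disjSum.1 hl'))
          ((hQ i).2.2 (Finset.inr_mem_disjSum.1 hl))).symm
    · rw [prod_gridLine_inr, prod_gridLine_inr, ha2, ha2]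
      have hj := (hQ j).2.2 (Finset.inr_mem_disjSum.1 hl')
      exact key (fun h => hll (congrArg Sum.inr h)) ((hQ i).2.2 (Finset.inr_mem_disjSum.1 hl)) hj

/-- The quantity summed over colliding pairs is at most the Rankin-weighted configuration sum. -/
theorem RowHyp.sum_collPairs_le (h : RowHyp ρ δ L k N z G) (hN : 1 ≤ N) {p : ℕ → Prop}
    [DecidablePred p] :
    ∑ x ∈ (collPairs G J).filter (fun x => p (∏ i, x.1 i)), 1 / ((∏ i, x.1 i : ℕ) : ℝ) ≤
      Real.exp (∑ l ∈ Finset.range (k + 1), cnt J l * ((1 + δ) * lam ρ L k l * Real.log (cnt J l))) *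
      ∑ a ∈ (cfg (gridLine (k := k)) N (Sum.elim (fun i => Real.exp (z i) / L ^ 2)
        fun i => Real.exp (z i) / L ^ 2) (J.disjSum J)).filter (fun a => p (∏ c, a c)),
        cfgWeight (fun c => cm (wt ρ L J c)) a := by
  classical
  rw [Finset.mul_sum]
  have hw : ∀ (a : Fin (k + 1) × Fin (k + 1) → ℕ), 0 ≤ cfgWeight (fun c => cm (wt ρ L J c)) a :=
    fun a => cfgWeight_nonneg (fun c n => cm_nonneg (wt_nonneg c) n) a
  set φ : (Fin (k + 1) × Fin (k + 1) → ℕ) → (Fin (k + 1) → ℕ) × (Fin (k + 1) → ℕ) :=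
    fun a => (fun i => ∏ j, a (i, j), fun j => ∏ i, a (i, j)) with hφ
  set t := (cfg (gridLine (k := k)) N (Sum.elim (fun i => Real.exp (z i) / L ^ 2)
    fun i => Real.exp (z i) / L ^ 2) (J.disjSum J)).filter (fun a => p (∏ c, a c)) with ht
  have hprod : ∀ a, ∏ i, (φ a).1 i = ∏ c, a c := fun a => by
    rw [Fintype.prod_prod_type]
  refine (Finset.sum_le_sum_of_surj (t := t.filter fun a => φ a ∈ collPairs G J) φ
    (fun x => 1 / ((∏ i, x.1 i : ℕ) : ℝ)) (fun x => by positivity) fun x hx => ?_).trans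
    ((Finset.sum_le_sum fun a ha => ?_).trans (Finset.sum_le_sum_of_subset_of_nonneg
      (Finset.filter_subset _ _) fun a _ _ => mul_nonneg (Real.exp_pos _).le (hw a)))
  · obtain ⟨hx1, hx2⟩ := Finset.mem_filter.1 hx
    obtain ⟨a, ha, hax⟩ := h.exists_cfg hN hx1
    refine ⟨a, Finset.mem_filter.2 ⟨Finset.mem_filter.2 ⟨ha, ?_⟩, ?_⟩, hax⟩
    · rw [← hprod, hφ]; simp only; rw [← hax] at hx2; exact hx2
    · rw [hφ]; simp only; rw [hax]; exact hx1
  · have h3 := h.one_le_rankin (a := fun i j => a (i, j)) (Finset.mem_filter.1 ha).2 (fun _ => rfl) fun _ => rfl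
    rw [hprod, cfgWeight, Finset.prod_div_distrib, ← mul_div_assoc, Nat.cast_prod]
    exact div_le_div_of_nonneg_right h3 (Finset.prod_nonneg fun _ _ => Nat.cast_nonneg _)

section Bounds

variable {M H κ : ℝ} (h : RowHyp ρ δ L k N z G) (hN1 : 1 ≤ N)
  (hρ : 0 < ρ) (hρ1 : ρ < 1) (hL : 1 ≤ L) (hN : lev N ≤ L)
    (h1 : ∀ (N : ℕ) (b : ℝ), 0 ≤ b →
        ∑ q ∈ (primesUpTo N).filter (fun q => lev q ≤ b), (1 : ℝ) / q ≤ b + M)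
    (h2 : ∀ (N : ℕ) (a b : ℝ), 0 ≤ a → a ≤ b →
        ∑ q ∈ (primesUpTo N).filter (fun q => a < lev q ∧ lev q ≤ b), (1 : ℝ) / q ≤ b - a + M)
    (hs : SieveBound N κ) (hκ : 0 ≤ κ) (hZ : ∀ i, 1 ≤ Real.exp (z i) / L ^ 2)
    (hH : 1 ≤ H) (hκH : 2 * (k + 1) ^ 2 * κ ≤ H)
include h hN1 hρ hρ1 hL hN h1 h2 hs hκ hZ hH hκH

theorem RowHyp.sum_collPairs_le_exp :
    ∑ x ∈ collPairs G J, 1 / ((∏ i, x.1 i : ℕ) : ℝ) ≤ Real.exp (collExp ρ δ L M H z J) := by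
  have h3 := h.sum_collPairs_le (J := J) hN1 (p := fun _ => True)
  simp only [Finset.filter_true] at h3
  exact h3.trans ((mul_le_mul_of_nonneg_left ((grid_cfgHyp hs hκ hZ hH hκH).sum_le _)
    (Real.exp_pos _).le).trans (prod_euler_le hρ hρ1 hL hN h1 h2 hH))

theorem RowHyp.sum_collPairs_top_le_exp {B Y : ℝ} (hB : 1 ≤ B) {i : Fin (k + 1)} (hi : i ∈ J) :
    ∑ x ∈ (collPairs G J).filter (fun x => Y / B < ((∏ i, x.1 i : ℕ) : ℝ) ∧
      ((∏ i, x.1 i : ℕ) : ℝ) ≤ Y), 1 / ((∏ i, x.1 i : ℕ) : ℝ) ≤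
      B / (Real.exp (z i) / L ^ 2) * Real.exp (collExp ρ δ L M H z J) := by
  have h3 := h.sum_collPairs_le (J := J) hN1 (p := fun n : ℕ => Y / B < (n : ℝ) ∧ (n : ℝ) ≤ Y)
  refine h3.trans ((mul_le_mul_of_nonneg_left ((grid_cfgHyp hs hκ hZ hH hκH).sum_top_le _
    (Sum.inl i) (Finset.inl_mem_disjSum.2 hi) B Y hB) (Real.exp_pos _).le).trans ?_)
  rw [mul_left_comm]
  exact mul_le_mul_of_nonneg_left (prod_euler_le hρ hρ1 hL hN h1 h2 hH)
    (div_nonneg (by linarith) (zero_le_one.trans (hZ i)))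

end Bounds

end Coll

/-- The increments of `n log n - n`. -/
noncomputable def incr (n : ℕ) : ℝ := (n + 1 : ℕ) * Real.log (n + 1 : ℕ) - n * Real.log n - 1

theorem incr_nonneg {n : ℕ} (hn : 1 ≤ n) : 0 ≤ incr n := by
  have h1 : (1 : ℝ) ≤ n := by exact_mod_cast hn
  have h2 := Real.one_sub_inv_le_log_of_pos (show (0 : ℝ) < (n + 1) / n by positivity)
  rw [Real.log_div (by positivity) (by positivity), inv_div] at h2
  have h3 : (n + 1 : ℝ) * (1 - n / (n + 1)) = 1 := by field_simp; ring
  have h4 := mul_le_mul_of_nonneg_left h2 (show (0 : ℝ) ≤ n + 1 by linarith)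
  have h5 := Real.log_nonneg h1
  unfold incr
  push_cast
  nlinarith

/-- The function governing the exponent in the collision bound. -/
noncomputable def psiFun (δ : ℝ) (n : ℕ) : ℝ := (1 + δ) * (n * Real.log n) - (1 - 2 * δ) * n

theorem psiFun_succ (δ : ℝ) (n : ℕ) :
    psiFun δ (n + 1) = psiFun δ n + ((1 + δ) * incr n + 3 * δ) := by
  unfold psiFun incr; push_cast; ring

theorem psiFun_mono {δ : ℝ} (hδ : 0 ≤ δ) {m n : ℕ} (hm : 1 ≤ m) (h : m ≤ n) :
    psiFun δ m ≤ psiFun δ n := by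
  induction n, h using Nat.le_induction with
  | base => exact le_rfl
  | succ n hn ih =>
    rw [psiFun_succ]
    have := mul_nonneg (show 0 ≤ 1 + δ by linarith) (incr_nonneg (hm.trans hn))
    linarith

theorem psiFun_add_one (δ : ℝ) (m : ℕ) :
    psiFun δ (m + 1) = -(1 - 2 * δ) + ∑ r ∈ Finset.Icc 1 m, ((1 + δ) * incr r + 3 * δ) := by
  induction m with
  | zero => simp [psiFun]
  | succ m ih => rw [psiFun_succ, ih, Finset.sum_Icc_succ_top (by omega)]; ring

section

variable {ρ δ L : ℝ} {k : ℕ} {J : Finset (Fin (k + 1))}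

theorem sum_lam_psiFun {i : ℕ} (hi : i ≤ k) :
    ∑ l ∈ Finset.Icc i k, lam ρ L k l * psiFun δ (l - i + 1) =
      (-(1 - 2 * δ) + ∑ r ∈ Finset.Icc 1 (k - i), ((1 + δ) * incr r + 3 * δ) * ρ ^ r) * (ρ ^ i * L) := by
  have h1 : ∑ l ∈ Finset.Icc i k, ∑ r ∈ Finset.Icc 1 (l - i),
      lam ρ L k l * ((1 + δ) * incr r + 3 * δ) = ∑ r ∈ Finset.Icc 1 (k - i),
      ∑ l ∈ Finset.Icc (i + r) k, lam ρ L k l * ((1 + δ) * incr r + 3 * δ) := by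
    refine Finset.sum_comm' fun l r => ?_
    rw [Finset.mem_Icc, Finset.mem_Icc, Finset.mem_Icc, Finset.mem_Icc]
    omega
  have h2 : ∀ l, lam ρ L k l * psiFun δ (l - i + 1) = lam ρ L k l * (-(1 - 2 * δ)) +
      ∑ r ∈ Finset.Icc 1 (l - i), lam ρ L k l * ((1 + δ) * incr r + 3 * δ) := fun l => by
    rw [psiFun_add_one, mul_add, Finset.mul_sum]
  rw [Finset.sum_congr rfl fun l _ => h2 l, Finset.sum_add_distrib, h1, ← Finset.sum_mul,
    sum_lam i hi, add_mul, Finset.sum_mul, mul_comm (ρ ^ i * L)]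
  congr 1
  refine Finset.sum_congr rfl fun r hr => ?_
  rw [← Finset.sum_mul, sum_lam (i + r) (by have := Finset.mem_Icc.1 hr; omega), pow_add]
  ring

theorem cnt_pos {j : Fin (k + 1)} (hj : j ∈ J) {l : ℕ} (hl : (j : ℕ) ≤ l) : 1 ≤ cnt J l :=
  Finset.card_pos.2 ⟨j, Finset.mem_filter.2 ⟨hj, hl⟩⟩

theorem cnt_le {j : Fin (k + 1)} (hj : ∀ i ∈ J, j ≤ i) {l : ℕ} (hl : (j : ℕ) ≤ l) :
    cnt J l ≤ l - j + 1 := by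
  have h := Finset.card_le_card_of_injOn (s := J.filter fun j : Fin (k + 1) => (j : ℕ) ≤ l)
    (t := Finset.Icc (j : ℕ) l) (fun i => (i : ℕ)) (fun i hi => by
      have := Finset.mem_filter.1 hi
      exact Finset.mem_coe.2 (Finset.mem_Icc.2 ⟨hj i this.1, this.2⟩)) fun a _ b _ h => Fin.ext h
  rw [Nat.card_Icc] at h
  unfold cnt
  omega

theorem cnt_eq_zero {j : Fin (k + 1)} (hj : ∀ i ∈ J, j ≤ i) {l : ℕ} (hl : l < j) : cnt J l = 0 := by
  unfold cnt
  rw [Finset.card_eq_zero, Finset.filter_eq_empty_iff]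
  intro i hi
  have : (j : ℕ) ≤ i := hj i hi
  omega

theorem cnt_le_succ (l : ℕ) : cnt J l ≤ k + 1 :=
  (Finset.card_le_univ _).trans (by simp)

theorem sum_lam_psiFun_cnt_le (hρ : 0 < ρ) (hρ1 : ρ < 1) (hL : 0 ≤ L) (hδ : 0 ≤ δ)
    (hb : ∀ m, ∑ r ∈ Finset.Icc 1 m, ((1 + δ) * incr r + 3 * δ) * ρ ^ r ≤ 1 - 4 * δ)
    {j : Fin (k + 1)} (hjJ : j ∈ J) (hj : ∀ i ∈ J, j ≤ i) :
    ∑ l ∈ Finset.range (k + 1), lam ρ L k l * psiFun δ (cnt J l) ≤ -(2 * δ) * (ρ ^ (j : ℕ) * L) := by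
  have hjk : (j : ℕ) ≤ k := Nat.lt_succ_iff.1 j.2
  have hsub : Finset.Icc (j : ℕ) k ⊆ Finset.range (k + 1) := fun l hl =>
    Finset.mem_range.2 (Nat.lt_succ_of_le (Finset.mem_Icc.1 hl).2)
  rw [← Finset.sum_subset hsub fun l hl hl' => by
    have h1 : l < j := by
      have := Finset.mem_range.1 hl
      rw [Finset.mem_Icc] at hl'
      omega
    rw [cnt_eq_zero hj h1]; simp [psiFun]]
  refine (Finset.sum_le_sum fun l hl => mul_le_mul_of_nonneg_left (psiFun_mono hδ
    (cnt_pos hjJ (Finset.mem_Icc.1 hl).1) (cnt_le hj (Finset.mem_Icc.1 hl).1))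
    (lam_nonneg hρ hρ1 hL l)).trans ?_
  rw [sum_lam_psiFun hjk]
  refine mul_le_mul_of_nonneg_right ?_ (mul_nonneg (pow_pos hρ _).le hL)
  linarith [hb (k - j)]

theorem collExp_le {M H : ℝ} {z : Fin (k + 1) → ℝ} (hρ : 0 < ρ) (hρ1 : ρ < 1) (hL : 1 ≤ L) (hδ : 0 ≤ δ)
    (hM : 0 ≤ M) (hH : 1 ≤ H) (hz : ∀ i : Fin (k + 1), (1 - δ) * (ρ ^ (i : ℕ) * L) ≤ z i)
    (hb : ∀ m, ∑ r ∈ Finset.Icc 1 m, ((1 + δ) * incr r + 3 * δ) * ρ ^ r ≤ 1 - 4 * δ)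
    {j : Fin (k + 1)} (hjJ : j ∈ J) (hj : ∀ i ∈ J, j ≤ i) :
    collExp ρ δ L M H z J ≤
      (M + 18) * (k + 1) ^ 2 + 2 * (k + 1) * Real.log (H * L ^ 2) - 2 * δ * (ρ ^ (j : ℕ) * L) := by
  have h1 : ∑ i ∈ J, ρ ^ (i : ℕ) * L = ∑ l ∈ Finset.range (k + 1), cnt J l * lam ρ L k l := by
    rw [← sum_mem_sum_Icc]
    exact Finset.sum_congr rfl fun i _ => (sum_lam _ (Nat.lt_succ_iff.1 i.2)).symm
  have h2 : ∑ i ∈ J, (Real.log (H * L ^ 2) - z i) ≤ (k + 1) * Real.log (H * L ^ 2) -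
      (1 - δ) * ∑ l ∈ Finset.range (k + 1), cnt J l * lam ρ L k l := by
    rw [Finset.sum_sub_distrib, Finset.sum_const, nsmul_eq_mul, ← h1, Finset.mul_sum]
    refine sub_le_sub (mul_le_mul_of_nonneg_right ?_ (Real.log_nonneg (one_le_mul_of_one_le_of_one_le hH (one_le_pow₀ hL))))
      (Finset.sum_le_sum fun i _ => hz i)
    · have := Finset.card_le_univ J
      rw [Fintype.card_fin] at this
      exact_mod_cast this
  have h3 : ∑ l ∈ Finset.range (k + 1), (cnt J l : ℝ) * M ≤ (k + 1) * ((k + 1) * M) := by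
    refine (Finset.sum_le_card_nsmul _ _ ((k + 1) * M) fun l _ => mul_le_mul_of_nonneg_right ?_ hM).trans
      (le_of_eq ?_)
    · exact_mod_cast cnt_le_succ l
    · rw [Finset.card_range, nsmul_eq_mul]; push_cast; ring
  have h4 := sum_lam_psiFun_cnt_le hρ hρ1 (zero_le_one.trans hL) hδ hb hjJ hj
  have h5 : ∑ l ∈ Finset.range (k + 1), lam ρ L k l * psiFun δ (cnt J l) =
      ∑ l ∈ Finset.range (k + 1), cnt J l * ((1 + δ) * lam ρ L k l * Real.log (cnt J l)) -
      (1 - 2 * δ) * ∑ l ∈ Finset.range (k + 1), cnt J l * lam ρ L k l := by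
    rw [Finset.mul_sum, ← Finset.sum_sub_distrib]
    refine Finset.sum_congr rfl fun l _ => ?_
    unfold psiFun; ring
  unfold collExp
  simp_rw [mul_add, Finset.sum_add_distrib]
  nlinarith

end

theorem log_le_of_sq_le {a b x : ℝ} (hx : 0 ≤ x) (hx1 : x < 1) (hb : 0 < b)
    (h : a ^ 2 = b * ((1 + x) / (1 - x))) :
    2 * Real.log a ≤ Real.log b + 2 * (x + x ^ 3 / 3 + x ^ 5 / (1 - x ^ 2)) := by
  have h1 := Real.log_div_le_sum_range_add hx hx1 2
  have h2 : Real.log (a ^ 2) = 2 * Real.log a := by rw [Real.log_pow]; push_cast; ring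
  have h3 : (0 : ℝ) < (1 + x) / (1 - x) := div_pos (by linarith) (by linarith)
  rw [← h2, h, Real.log_mul hb.ne' h3.ne']
  simp only [Finset.sum_range_succ, Finset.sum_range_zero] at h1
  norm_num at h1
  linarith

theorem log_bounds : Real.log 7 ≤ 1.945911 ∧ Real.log 11 ≤ 2.397896 ∧ Real.log 13 ≤ 2.564950 ∧
    Real.log 17 ≤ 2.833214 ∧ Real.log 19 ≤ 2.944439 ∧ Real.log 23 ≤ 3.135495 := by
  have h2 := Real.log_two_lt_d9
  have h3 := Real.log_three_lt_d9
  have h5 := Real.log_five_lt_d9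
  have e : ∀ a b : ℝ, 0 < a → 0 < b → Real.log (a * b) = Real.log a + Real.log b :=
    fun a b ha hb => Real.log_mul ha.ne' hb.ne'
  have l48 : Real.log 48 = 4 * Real.log 2 + Real.log 3 := by
    rw [show (48 : ℝ) = 2 ^ 4 * 3 by norm_num, e _ _ (by norm_num) (by norm_num), Real.log_pow]; norm_num
  have l120 : Real.log 120 = 3 * Real.log 2 + Real.log 3 + Real.log 5 := by
    rw [show (120 : ℝ) = 2 ^ 3 * 3 * 5 by norm_num, e _ _ (by norm_num) (by norm_num),
      e _ _ (by norm_num) (by norm_num), Real.log_pow]; norm_num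
  have l168 : Real.log 168 = 3 * Real.log 2 + Real.log 3 + Real.log 7 := by
    rw [show (168 : ℝ) = 2 ^ 3 * 3 * 7 by norm_num, e _ _ (by norm_num) (by norm_num),
      e _ _ (by norm_num) (by norm_num), Real.log_pow]; norm_num
  have l288 : Real.log 288 = 5 * Real.log 2 + 2 * Real.log 3 := by
    rw [show (288 : ℝ) = 2 ^ 5 * 3 ^ 2 by norm_num, e _ _ (by norm_num) (by norm_num),
      Real.log_pow, Real.log_pow]; norm_num
  have l360 : Real.log 360 = 3 * Real.log 2 + 2 * Real.log 3 + Real.log 5 := by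
    rw [show (360 : ℝ) = 2 ^ 3 * 3 ^ 2 * 5 by norm_num, e _ _ (by norm_num) (by norm_num),
      e _ _ (by norm_num) (by norm_num), Real.log_pow, Real.log_pow]; norm_num
  have l528 : Real.log 528 = 4 * Real.log 2 + Real.log 3 + Real.log 11 := by
    rw [show (528 : ℝ) = 2 ^ 4 * 3 * 11 by norm_num, e _ _ (by norm_num) (by norm_num),
      e _ _ (by norm_num) (by norm_num), Real.log_pow]; norm_num
  have b7 := log_le_of_sq_le (a := 7) (b := 48) (x := 1 / 97) (by norm_num) (by norm_num) (by norm_num)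
    (by norm_num)
  have b11 := log_le_of_sq_le (a := 11) (b := 120) (x := 1 / 241) (by norm_num) (by norm_num)
    (by norm_num) (by norm_num)
  have b13 := log_le_of_sq_le (a := 13) (b := 168) (x := 1 / 337) (by norm_num) (by norm_num)
    (by norm_num) (by norm_num)
  have b17 := log_le_of_sq_le (a := 17) (b := 288) (x := 1 / 577) (by norm_num) (by norm_num)
    (by norm_num) (by norm_num)
  have b19 := log_le_of_sq_le (a := 19) (b := 360) (x := 1 / 721) (by norm_num) (by norm_num)
    (by norm_num) (by norm_num)
  have b23 := log_le_of_sq_le (a := 23) (b := 528) (x := 1 / 1057) (by norm_num) (by norm_num)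
    (by norm_num) (by norm_num)
  norm_num at b7 b11 b13 b17 b19 b23 h2 h3 h5
  refine ⟨?_, ?_, ?_, ?_, ?_, ?_⟩ <;> norm_num <;> linarith

theorem sum_incr_base : ∑ r ∈ Finset.Icc 1 24, incr r * 0.542593 ^ r ≤ 1 - 0.000032 := by
  obtain ⟨h7, h11, h13, h17, h19, h23⟩ := log_bounds
  have h2 := Real.log_two_lt_d9
  have h3 := Real.log_three_lt_d9
  have h5 := Real.log_five_lt_d9
  have e : ∀ a b : ℝ, 0 < a → 0 < b → Real.log (a * b) = Real.log a + Real.log b :=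
    fun a b ha hb => Real.log_mul ha.ne' hb.ne'
  have l4 : Real.log 4 = 2 * Real.log 2 := by
    rw [show (4 : ℝ) = 2 * 2 by norm_num, e _ _ (by norm_num) (by norm_num)]; ring
  have l6 : Real.log 6 = Real.log 2 + Real.log 3 := by
    rw [show (6 : ℝ) = 2 * 3 by norm_num, e _ _ (by norm_num) (by norm_num)]
  have l8 : Real.log 8 = 3 * Real.log 2 := by
    rw [show (8 : ℝ) = 2 * 4 by norm_num, e _ _ (by norm_num) (by norm_num), l4]; ring
  have l9 : Real.log 9 = 2 * Real.log 3 := by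
    rw [show (9 : ℝ) = 3 * 3 by norm_num, e _ _ (by norm_num) (by norm_num)]; ring
  have l10 : Real.log 10 = Real.log 2 + Real.log 5 := by
    rw [show (10 : ℝ) = 2 * 5 by norm_num, e _ _ (by norm_num) (by norm_num)]
  have l12 : Real.log 12 = 2 * Real.log 2 + Real.log 3 := by
    rw [show (12 : ℝ) = 4 * 3 by norm_num, e _ _ (by norm_num) (by norm_num), l4]
  have l14 : Real.log 14 = Real.log 2 + Real.log 7 := by
    rw [show (14 : ℝ) = 2 * 7 by norm_num, e _ _ (by norm_num) (by norm_num)]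
  have l15 : Real.log 15 = Real.log 3 + Real.log 5 := by
    rw [show (15 : ℝ) = 3 * 5 by norm_num, e _ _ (by norm_num) (by norm_num)]
  have l16 : Real.log 16 = 4 * Real.log 2 := by
    rw [show (16 : ℝ) = 4 * 4 by norm_num, e _ _ (by norm_num) (by norm_num), l4]; ring
  have l18 : Real.log 18 = Real.log 2 + 2 * Real.log 3 := by
    rw [show (18 : ℝ) = 2 * 9 by norm_num, e _ _ (by norm_num) (by norm_num), l9]
  have l20 : Real.log 20 = 2 * Real.log 2 + Real.log 5 := by
    rw [show (20 : ℝ) = 4 * 5 by norm_num, e _ _ (by norm_num) (by norm_num), l4]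
  have l21 : Real.log 21 = Real.log 3 + Real.log 7 := by
    rw [show (21 : ℝ) = 3 * 7 by norm_num, e _ _ (by norm_num) (by norm_num)]
  have l22 : Real.log 22 = Real.log 2 + Real.log 11 := by
    rw [show (22 : ℝ) = 2 * 11 by norm_num, e _ _ (by norm_num) (by norm_num)]
  have l24 : Real.log 24 = 3 * Real.log 2 + Real.log 3 := by
    rw [show (24 : ℝ) = 8 * 3 by norm_num, e _ _ (by norm_num) (by norm_num), l8]
  have l25 : Real.log 25 = 2 * Real.log 5 := by
    rw [show (25 : ℝ) = 5 * 5 by norm_num, e _ _ (by norm_num) (by norm_num)]; ring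
  rw [show Finset.Icc 1 24 = Finset.Ico 1 25 from rfl, Finset.sum_Ico_eq_sum_range]
  simp only [Finset.sum_range_succ, Finset.sum_range_zero, incr]
  norm_num [l4, l6, l8, l9, l10, l12, l14, l15, l16, l18, l20, l21, l22, l24, l25, Real.log_one]
  norm_num at h2 h3 h5 h7 h11 h13 h17 h19 h23
  linarith

theorem incr_le_log {n : ℕ} (hn : 1 ≤ n) : incr n ≤ Real.log (n + 1) := by
  have h1 : (1 : ℝ) ≤ n := by exact_mod_cast hn
  have h2 := Real.log_le_sub_one_of_pos (show (0 : ℝ) < (n + 1) / n by positivity)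
  rw [Real.log_div (by positivity) (by positivity)] at h2
  have h3 : (n : ℝ) * ((n + 1) / n - 1) = 1 := by field_simp; ring
  have h4 := mul_le_mul_of_nonneg_left h2 (show (0 : ℝ) ≤ n by linarith)
  unfold incr
  push_cast
  linarith

theorem sum_incr_tail (m : ℕ) (hm : 24 ≤ m) :
    ∑ r ∈ Finset.Icc 1 m, incr r * 0.542593 ^ r ≤ 1 - 0.05 * (m + 55) * 0.542593 ^ m := by
  induction m, hm using Nat.le_induction with
  | base => exact sum_incr_base.trans (by norm_num)
  | succ m hm ih =>
    have hm' : (24 : ℝ) ≤ m := by exact_mod_cast hm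
    rw [Finset.sum_Icc_succ_top (by omega)]
    have h1 := incr_le_log (n := m + 1) (by omega)
    have h2 : Real.log ((m + 1 : ℕ) + 1) ≤ 2.26 + (m + 2) / 26 := by
      have h3 := Real.log_le_sub_one_of_pos (show (0 : ℝ) < (m + 2) / 26 by positivity)
      rw [Real.log_div (by positivity) (by norm_num)] at h3
      have h4 : Real.log 26 = Real.log 2 + Real.log 13 := by
        rw [show (26 : ℝ) = 2 * 13 by norm_num, Real.log_mul (by norm_num) (by norm_num)]
      have h5 := Real.log_two_lt_d9
      have h6 := log_bounds.2.2.1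
      push_cast
      rw [show (m : ℝ) + 1 + 1 = m + 2 by ring]
      norm_num at h5 h6 ⊢
      linarith
    have h7 : (0 : ℝ) < 0.542593 ^ m := by positivity
    have h8 := mul_le_mul_of_nonneg_right (h1.trans h2) (show (0 : ℝ) ≤ 0.542593 ^ (m + 1) by positivity)
    refine (add_le_add ih h8).trans ?_
    push_cast
    rw [pow_succ]
    nlinarith

theorem sum_incr_le (m : ℕ) : ∑ r ∈ Finset.Icc 1 m, incr r * 0.542593 ^ r ≤ 1 := by
  have h1 : ∑ r ∈ Finset.Icc 1 m, incr r * 0.542593 ^ r ≤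
      ∑ r ∈ Finset.Icc 1 (m + 24), incr r * 0.542593 ^ r :=
    Finset.sum_le_sum_of_subset_of_nonneg (Finset.Icc_subset_Icc_right (by omega)) fun r hr _ =>
      mul_nonneg (incr_nonneg (Finset.mem_Icc.1 hr).1) (by positivity)
  refine h1.trans ((sum_incr_tail (m + 24) (by omega)).trans ?_)
  have : (0 : ℝ) ≤ 0.05 * ((m + 24 : ℕ) + 55) * 0.542593 ^ (m + 24) := by positivity
  linarith

theorem exp_neg_inv_le : Real.exp (-(1 / (2 * 0.8178))) ≤ 0.542593 := by
  have h := Real.sum_le_exp_of_nonneg (x := 1 / (2 * 0.8178)) (by norm_num) 10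
  rw [Real.exp_neg]
  refine inv_le_of_inv_le₀ (by norm_num) (le_trans ?_ h)
  simp only [Finset.sum_range_succ, Finset.sum_range_zero, Nat.factorial]
  norm_num

theorem Finset.card_le_card_image_add {α β : Type*} [DecidableEq α] [DecidableEq β] (T : Finset α)
    (g : α → β) : T.card ≤ (T.image g).card +
      ((T ×ˢ T).filter (fun p => p.1 ≠ p.2 ∧ g p.1 = g p.2)).card := by
  rcases T.eq_empty_or_nonempty with rfl | ⟨a₀, ha₀⟩
  · simp
  have : Nonempty α := ⟨a₀⟩
  set rep : α → α := fun a => Function.invFunOn g (T : Set α) (g a) with hrep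
  have hex : ∀ a ∈ T, ∃ b ∈ (T : Set α), g b = g a := fun a ha => ⟨a, ha, rfl⟩
  have h1 : ∀ a ∈ T, rep a ∈ T := fun a ha => Function.invFunOn_mem (hex a ha)
  have h2 : ∀ a ∈ T, g (rep a) = g a := fun a ha => Function.invFunOn_eq (hex a ha)
  rw [← Finset.card_filter_add_card_filter_not (s := T) (fun a => rep a = a)]
  refine add_le_add ?_ ?_
  · refine Finset.card_le_card_of_injOn g (fun a ha => Finset.mem_coe.2 (Finset.mem_image_of_mem _
      (Finset.mem_filter.1 ha).1)) fun a ha b hb hab => ?_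
    rw [← (Finset.mem_filter.1 ha).2, ← (Finset.mem_filter.1 hb).2, hrep]
    exact congrArg (Function.invFunOn g (T : Set α)) hab
  · refine Finset.card_le_card_of_injOn (fun a => (a, rep a)) (fun a ha => ?_) fun a _ b _ hab =>
      congrArg Prod.fst hab
    obtain ⟨ha1, ha2⟩ := Finset.mem_filter.1 ha
    exact Finset.mem_coe.2 (Finset.mem_filter.2 ⟨Finset.mem_product.2 ⟨ha1, h1 a ha1⟩,
      fun h => ha2 h.symm, (h2 a ha1).symm⟩)

section Tuples

variable {k : ℕ} {G : Fin (k + 1) → Finset ℕ} {B Y S U E c : ℝ}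

/-- The vectors with entries from `G` and product in `(Y / B, Y]`. -/
noncomputable def tuples {k : ℕ} (G : Fin (k + 1) → Finset ℕ) (B Y : ℝ) : Finset (Fin (k + 1) → ℕ) :=
  (Fintype.piFinset G).filter fun f => Y / B < ((∏ i, f i : ℕ) : ℝ) ∧ ((∏ i, f i : ℕ) : ℝ) ≤ Y

theorem sum_rowFam_le (hS : 1 ≤ S) (hG : ∀ i, ∑ n ∈ G i, (1 : ℝ) / n ≤ S) (J : Finset (Fin (k + 1))) :
    ∑ f ∈ rowFam G J, 1 / ((∏ i, f i : ℕ) : ℝ) ≤ S ^ (k + 1) := by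
  have h1 : ∑ f ∈ rowFam G J, 1 / ((∏ i, f i : ℕ) : ℝ) =
      ∏ i, ∑ n ∈ (if i ∈ J then G i else {1}), (1 : ℝ) / n := by
    rw [Finset.prod_univ_sum]
    refine Finset.sum_congr rfl fun f _ => ?_
    rw [Finset.prod_div_distrib, Finset.prod_const_one, Nat.cast_prod]
  rw [h1]
  refine (Finset.prod_le_prod (fun i _ => Finset.sum_nonneg fun n _ => by positivity)
    (g := fun _ => S) fun i _ => ?_).trans (le_of_eq (by simp))
  split_ifs
  · exact hG i
  · simpa using hS

/-- Restriction of a vector, with `1` elsewhere. -/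
def restr {k : ℕ} (J : Finset (Fin (k + 1))) (f : Fin (k + 1) → ℕ) : Fin (k + 1) → ℕ :=
  fun i => if i ∈ J then f i else 1

theorem restr_mem_rowFam {J : Finset (Fin (k + 1))} {f : Fin (k + 1) → ℕ} (hf : ∀ i, f i ∈ G i) :
    restr J f ∈ rowFam G J := by
  refine Fintype.mem_piFinset.2 fun i => ?_
  unfold restr
  split_ifs
  · exact hf i
  · exact Finset.mem_singleton_self 1

/-- Pairs of vectors with the same product, differing exactly on `J`. -/
noncomputable def diffPairs {k : ℕ} (G : Fin (k + 1) → Finset ℕ) (B Y : ℝ) (J : Finset (Fin (k + 1))) :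
    Finset ((Fin (k + 1) → ℕ) × (Fin (k + 1) → ℕ)) :=
  (tuples G B Y ×ˢ tuples G B Y).filter fun p =>
    (∏ i, p.1 i = ∏ i, p.2 i) ∧ Finset.univ.filter (fun i => p.1 i ≠ p.2 i) = J

theorem restr_mem_collPairs (hG : ∀ i, ∀ n ∈ G i, 1 ≤ n) {J : Finset (Fin (k + 1))}
    {p : (Fin (k + 1) → ℕ) × (Fin (k + 1) → ℕ)} (hp : p ∈ diffPairs G B Y J) :
    (restr J p.1, restr J p.2) ∈ collPairs G J ∧ restr Jᶜ p.1 * restr J p.1 = p.1 ∧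
      restr Jᶜ p.1 * restr J p.2 = p.2 := by
  obtain ⟨hp1, hp2, rfl⟩ := Finset.mem_filter.1 hp
  obtain ⟨ha, hb⟩ := Finset.mem_product.1 hp1
  have ha1 := Fintype.mem_piFinset.1 (Finset.mem_filter.1 ha).1
  have hb1 := Fintype.mem_piFinset.1 (Finset.mem_filter.1 hb).1
  set J := Finset.univ.filter (fun i => p.1 i ≠ p.2 i) with hJ
  have e1 : restr Jᶜ p.1 * restr J p.1 = p.1 := by
    funext i; simp only [restr, Pi.mul_apply, Finset.mem_compl]; by_cases h : i ∈ J <;> simp [h]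
  have e2 : restr Jᶜ p.1 * restr J p.2 = p.2 := by
    funext i; simp only [restr, Pi.mul_apply, Finset.mem_compl]; by_cases h : i ∈ J
    · simp [h]
    · have : p.1 i = p.2 i := by simpa [hJ] using h
      simp [h, this]
  refine ⟨mem_collPairs.2 ⟨⟨fun i => ?_, fun i => ?_⟩, fun i hi => ?_, ?_⟩, e1, e2⟩
  · exact Fintype.mem_piFinset.1 (restr_mem_rowFam (J := J) ha1) i
  · exact Fintype.mem_piFinset.1 (restr_mem_rowFam (J := J) hb1) i
  · simpa [restr, hi] using (Finset.mem_filter.1 hi).2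
  · have h0 : ∏ i, restr Jᶜ p.1 i ≠ 0 := Finset.prod_ne_zero_iff.2 fun i _ => by
      unfold restr; split_ifs
      · have := hG i _ (ha1 i); omega
      · exact one_ne_zero
    have h3 : (∏ i, restr Jᶜ p.1 i) * ∏ i, restr J p.1 i = (∏ i, restr Jᶜ p.1 i) * ∏ i, restr J p.2 i := by
      rw [← Finset.prod_mul_distrib, ← Finset.prod_mul_distrib]
      have e1' := fun i => congrFun e1 i
      have e2' := fun i => congrFun e2 i
      simp only [Pi.mul_apply] at e1' e2'
      simp only [e1', e2']
      exact hp2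
    exact Nat.eq_of_mul_eq_mul_left (Nat.pos_of_ne_zero h0) h3

theorem card_diffPairs_le_sum (hG : ∀ i, ∀ n ∈ G i, 1 ≤ n) (J : Finset (Fin (k + 1))) :
    ((diffPairs G B Y J).card : ℝ) ≤ Y * ∑ p ∈ diffPairs G B Y J, 1 / ((∏ i, p.1 i : ℕ) : ℝ) := by
  rw [Finset.mul_sum, Finset.card_eq_sum_ones, Nat.cast_sum]
  refine Finset.sum_le_sum fun p hp => ?_
  obtain ⟨h1, h2⟩ := Finset.mem_filter.1 (Finset.mem_product.1 (Finset.mem_filter.1 hp).1).1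
  have h3 : 0 < ∏ i, p.1 i := Finset.prod_pos fun i _ => hG i _ (Fintype.mem_piFinset.1 h1 i)
  have h4 : (0 : ℝ) < ((∏ i, p.1 i : ℕ) : ℝ) := by exact_mod_cast h3
  rw [Nat.cast_one, mul_one_div, le_div_iff₀ h4, one_mul]
  exact h2.2

theorem sum_diffPairs_le_of_zero_mem (hG : ∀ i, ∀ n ∈ G i, 1 ≤ n) (hS : 1 ≤ S)
    (hGS : ∀ i, ∑ n ∈ G i, (1 : ℝ) / n ≤ S) {J : Finset (Fin (k + 1))} {D : ℝ} (hD : 0 ≤ D)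
    (htop : ∀ Y, ∑ x ∈ (collPairs G J).filter (fun x => Y / B < ((∏ i, x.1 i : ℕ) : ℝ) ∧
      ((∏ i, x.1 i : ℕ) : ℝ) ≤ Y), 1 / ((∏ i, x.1 i : ℕ) : ℝ) ≤ D) :
    ∑ p ∈ diffPairs G B Y J, 1 / ((∏ i, p.1 i : ℕ) : ℝ) ≤ S ^ (k + 1) * D := by
  have h1 := Finset.sum_le_sum_of_surj (s := diffPairs G B Y J)
    (t := (rowFam G Jᶜ).sigma fun h => (collPairs G J).filter (fun x =>
      Y / ((∏ i, h i : ℕ) : ℝ) / B < ((∏ i, x.1 i : ℕ) : ℝ) ∧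
      ((∏ i, x.1 i : ℕ) : ℝ) ≤ Y / ((∏ i, h i : ℕ) : ℝ)))
    (fun b => ((b.1 * b.2.1, b.1 * b.2.2) : (Fin (k + 1) → ℕ) × (Fin (k + 1) → ℕ)))
    (fun p => 1 / ((∏ i, p.1 i : ℕ) : ℝ)) (fun p => by positivity) (fun p hp => by
      obtain ⟨hc, e1, e2⟩ := restr_mem_collPairs hG hp
      obtain ⟨ha, hw1, hw2⟩ := Finset.mem_filter.1 (Finset.mem_product.1 (Finset.mem_filter.1 hp).1).1
      have hpG := Fintype.mem_piFinset.1 ha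
      have hpos : 0 < ∏ i, restr Jᶜ p.1 i := Finset.prod_pos fun i _ => by
        unfold restr; split_ifs
        · exact hG i _ (hpG i)
        · exact one_pos
      have hpos' : (0 : ℝ) < ((∏ i, restr Jᶜ p.1 i : ℕ) : ℝ) := by exact_mod_cast hpos
      have hprod : ((∏ i, p.1 i : ℕ) : ℝ) = ((∏ i, restr J p.1 i : ℕ) : ℝ) * ((∏ i, restr Jᶜ p.1 i : ℕ) : ℝ) := by
        rw [← Nat.cast_mul, ← Finset.prod_mul_distrib]
        congr 1
        refine Finset.prod_congr rfl fun i _ => ?_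
        rw [mul_comm]; exact (congrFun e1 i).symm
      refine ⟨⟨restr Jᶜ p.1, restr J p.1, restr J p.2⟩, Finset.mem_sigma.2 ⟨restr_mem_rowFam hpG,
        Finset.mem_filter.2 ⟨hc, ?_, ?_⟩⟩, Prod.ext e1 e2⟩
      · rw [div_right_comm, div_lt_iff₀ hpos', ← hprod]; exact hw1
      · rw [le_div_iff₀ hpos', ← hprod]; exact hw2)
  refine h1.trans ?_
  rw [Finset.sum_sigma]
  refine le_trans (Finset.sum_le_sum (g := fun h : Fin (k + 1) → ℕ => 1 / ((∏ i, h i : ℕ) : ℝ) * D)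
    fun h _ => ?_) ?_
  · refine le_trans (le_of_eq ?_) (mul_le_mul_of_nonneg_left (htop (Y / ((∏ i, h i : ℕ) : ℝ)))
      (by positivity))
    rw [Finset.mul_sum]
    refine Finset.sum_congr rfl fun x _ => ?_
    simp only [Pi.mul_apply, Finset.prod_mul_distrib, Nat.cast_mul]
    rw [one_div_mul_one_div]
  · rw [← Finset.sum_mul]
    exact mul_le_mul_of_nonneg_right (sum_rowFam_le hS hGS _) hD

theorem sum_diffPairs_le_of_zero_notMem (hG : ∀ i, ∀ n ∈ G i, 1 ≤ n) (hS : 1 ≤ S)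
    (hGS : ∀ i, ∑ n ∈ G i, (1 : ℝ) / n ≤ S) {J : Finset (Fin (k + 1))} (hJ : 0 ∉ J)
    (hU0 : 0 ≤ U)
    (hE : ∑ x ∈ collPairs G J, 1 / ((∏ i, x.1 i : ℕ) : ℝ) ≤ E)
    (hU : ∀ Y, ∑ n ∈ (G 0).filter (fun n : ℕ => Y / B < n ∧ n ≤ Y), (1 : ℝ) / n ≤ U) :
    ∑ p ∈ diffPairs G B Y J, 1 / ((∏ i, p.1 i : ℕ) : ℝ) ≤ S ^ (k + 1) * (U * E) := by
  have h1 := Finset.sum_le_sum_of_surj (s := diffPairs G B Y J)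
    (t := (rowFam G (Jᶜ.erase 0) ×ˢ collPairs G J).sigma fun b => (G 0).filter (fun n : ℕ =>
      Y / (((∏ i, b.1 i : ℕ) : ℝ) * ((∏ i, b.2.1 i : ℕ) : ℝ)) / B < n ∧
      n ≤ Y / (((∏ i, b.1 i : ℕ) : ℝ) * ((∏ i, b.2.1 i : ℕ) : ℝ))))
    (fun b => ((Pi.mulSingle 0 b.2 * (b.1.1 * b.1.2.1), Pi.mulSingle 0 b.2 * (b.1.1 * b.1.2.2)) :
      (Fin (k + 1) → ℕ) × (Fin (k + 1) → ℕ)))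
    (fun p => 1 / ((∏ i, p.1 i : ℕ) : ℝ)) (fun p => by positivity) (fun p hp => by
      obtain ⟨hc, e1, e2⟩ := restr_mem_collPairs hG hp
      obtain ⟨ha, hw1, hw2⟩ := Finset.mem_filter.1 (Finset.mem_product.1 (Finset.mem_filter.1 hp).1).1
      have hpG := Fintype.mem_piFinset.1 ha
      have hs : (Pi.mulSingle 0 (p.1 0) : Fin (k + 1) → ℕ) * restr (Jᶜ.erase 0) p.1 = restr Jᶜ p.1 := by
        funext i
        by_cases hi : i = 0
        · subst hi; simp [restr, hJ]
        · simp [restr, hi]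
      have hpos : ∀ I, 0 < ∏ i, restr I p.1 i := fun I => Finset.prod_pos fun i _ => by
        unfold restr; split_ifs
        · exact hG i _ (hpG i)
        · exact one_pos
      have hpos' : ∀ I, (0 : ℝ) < ((∏ i, restr I p.1 i : ℕ) : ℝ) := fun I => by exact_mod_cast hpos I
      have hprod : ((∏ i, p.1 i : ℕ) : ℝ) = (p.1 0 : ℝ) *
          (((∏ i, restr (Jᶜ.erase 0) p.1 i : ℕ) : ℝ) * ((∏ i, restr J p.1 i : ℕ) : ℝ)) := by
        have h2 : ∏ i, (Pi.mulSingle 0 (p.1 0) : Fin (k + 1) → ℕ) i = p.1 0 := by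
          rw [Finset.prod_pi_mulSingle']; simp
        rw [← Nat.cast_mul, ← Nat.cast_mul, ← mul_assoc]
        rw [← h2]
        rw [← Finset.prod_mul_distrib, ← Finset.prod_mul_distrib]
        congr 1
        refine Finset.prod_congr rfl fun i _ => ?_
        have := congrFun e1 i
        rw [← hs] at this
        exact this.symm
      have hpp := mul_pos (hpos' (Jᶜ.erase 0)) (hpos' J)
      refine ⟨⟨⟨restr (Jᶜ.erase 0) p.1, restr J p.1, restr J p.2⟩, p.1 0⟩, Finset.mem_sigma.2
        ⟨Finset.mem_product.2 ⟨restr_mem_rowFam hpG, hc⟩, Finset.mem_filter.2 ⟨hpG 0, ?_, ?_⟩⟩,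
        Prod.ext ?_ ?_⟩
      · rw [div_right_comm, div_lt_iff₀ hpp, ← hprod]; exact hw1
      · rw [le_div_iff₀ hpp, ← hprod]; exact hw2
      · rw [← mul_assoc, hs, e1]
      · show Pi.mulSingle 0 (p.1 0) * (restr (Jᶜ.erase 0) p.1 * restr J p.2) = p.2
        rw [← mul_assoc, hs, e2])
  refine h1.trans ?_
  rw [Finset.sum_sigma]
  refine le_trans (Finset.sum_le_sum (g := fun b : (Fin (k + 1) → ℕ) × (Fin (k + 1) → ℕ) × (Fin (k + 1) → ℕ) =>
    (1 / ((∏ i, b.1 i : ℕ) : ℝ) * (1 / ((∏ i, b.2.1 i : ℕ) : ℝ))) * U) fun b _ => ?_) ?_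
  · refine le_trans (le_of_eq ?_) (mul_le_mul_of_nonneg_left (hU
      (Y / (((∏ i, b.1 i : ℕ) : ℝ) * ((∏ i, b.2.1 i : ℕ) : ℝ)))) (by positivity))
    rw [Finset.mul_sum]
    refine Finset.sum_congr rfl fun n _ => ?_
    simp only [Pi.mul_apply, Finset.prod_mul_distrib, Nat.cast_mul, Finset.prod_pi_mulSingle',
      Finset.mem_univ, if_true]
    rw [one_div_mul_one_div, one_div_mul_one_div, mul_comm]
  · rw [← Finset.sum_mul, Finset.sum_product, mul_comm U E, ← mul_assoc]
    refine mul_le_mul_of_nonneg_right ?_ hU0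
    simp_rw [← Finset.mul_sum]
    rw [← Finset.sum_mul]
    exact mul_le_mul (sum_rowFam_le hS hGS _) hE (Finset.sum_nonneg fun x _ => by positivity)
      (by positivity)

theorem card_collisions_le (hG : ∀ i, ∀ n ∈ G i, 1 ≤ n) (hS : 1 ≤ S) (hY : 0 ≤ Y)
    (hGS : ∀ i, ∑ n ∈ G i, (1 : ℝ) / n ≤ S) (hE0 : 0 ≤ E) (hU0 : 0 ≤ U)
    (hE : ∀ J : Finset (Fin (k + 1)), J.Nonempty →
      ∑ x ∈ collPairs G J, 1 / ((∏ i, x.1 i : ℕ) : ℝ) ≤ E)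
    (htop : ∀ J : Finset (Fin (k + 1)), 0 ∈ J → ∀ Y, ∑ x ∈ (collPairs G J).filter (fun x =>
      Y / B < ((∏ i, x.1 i : ℕ) : ℝ) ∧ ((∏ i, x.1 i : ℕ) : ℝ) ≤ Y),
        1 / ((∏ i, x.1 i : ℕ) : ℝ) ≤ U * E)
    (hU : ∀ Y, ∑ n ∈ (G 0).filter (fun n : ℕ => Y / B < n ∧ n ≤ Y), (1 : ℝ) / n ≤ U) :
    (((tuples G B Y ×ˢ tuples G B Y).filter (fun p => p.1 ≠ p.2 ∧
      ∏ i, p.1 i = ∏ i, p.2 i)).card : ℝ) ≤ 2 ^ (k + 1) * (Y * (S ^ (k + 1) * (U * E))) := by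
  have hsub : (tuples G B Y ×ˢ tuples G B Y).filter (fun p => p.1 ≠ p.2 ∧
      ∏ i, p.1 i = ∏ i, p.2 i) ⊆ ((Finset.univ : Finset (Finset (Fin (k + 1)))).filter
        fun J => J.Nonempty).biUnion fun J => diffPairs G B Y J := by
    intro p hp
    obtain ⟨h1, h2, h3⟩ := Finset.mem_filter.1 hp
    refine Finset.mem_biUnion.2 ⟨Finset.univ.filter (fun i => p.1 i ≠ p.2 i),
      Finset.mem_filter.2 ⟨Finset.mem_univ _, ?_⟩, Finset.mem_filter.2 ⟨h1, h3, rfl⟩⟩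
    obtain ⟨i, hi⟩ := Function.ne_iff.1 h2
    exact ⟨i, Finset.mem_filter.2 ⟨Finset.mem_univ _, hi⟩⟩
  have h1 : (((tuples G B Y ×ˢ tuples G B Y).filter (fun p => p.1 ≠ p.2 ∧
      ∏ i, p.1 i = ∏ i, p.2 i)).card : ℝ) ≤ ∑ J ∈ (Finset.univ : Finset (Finset (Fin (k + 1)))).filter
        (fun J => J.Nonempty), ((diffPairs G B Y J).card : ℝ) := by
    exact_mod_cast (Finset.card_le_card hsub).trans Finset.card_biUnion_le
  refine h1.trans ((Finset.sum_le_card_nsmul _ _ (Y * (S ^ (k + 1) * (U * E))) fun J hJ => ?_).trans ?_)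
  · refine (card_diffPairs_le_sum hG J).trans (mul_le_mul_of_nonneg_left ?_ hY)
    by_cases h0 : 0 ∈ J
    · exact sum_diffPairs_le_of_zero_mem hG hS hGS (mul_nonneg hU0 hE0) (htop J h0)
    · exact sum_diffPairs_le_of_zero_notMem hG hS hGS h0 hU0 (hE J (Finset.mem_filter.1 hJ).2) hU
  · rw [nsmul_eq_mul]
    refine mul_le_mul_of_nonneg_right ?_ (by positivity)
    have := Finset.card_filter_le (Finset.univ : Finset (Finset (Fin (k + 1)))) fun J => J.Nonempty
    rw [Finset.card_univ, Fintype.card_finset, Fintype.card_fin] at this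
    exact_mod_cast this

theorem le_card_tuples (hG : ∀ i, ∀ n ∈ G i, 1 ≤ n)
    (hc : ∀ g ∈ Fintype.piFinset fun i : Fin k => G i.succ, c * (Y / ((∏ i, g i : ℕ) : ℝ)) ≤
      ((G 0).filter (fun n : ℕ => Y / ((∏ i, g i : ℕ) : ℝ) / B < n ∧
        n ≤ Y / ((∏ i, g i : ℕ) : ℝ))).card) :
    c * Y * ∏ i : Fin k, ∑ n ∈ G i.succ, (1 : ℝ) / n ≤ (tuples G B Y).card := by
  set D := (Fintype.piFinset fun i : Fin k => G i.succ).sigma fun g => (G 0).filter (fun n : ℕ =>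
    Y / ((∏ i, g i : ℕ) : ℝ) / B < n ∧ n ≤ Y / ((∏ i, g i : ℕ) : ℝ)) with hD
  have h1 : D.card ≤ (tuples G B Y).card := by
    refine Finset.card_le_card_of_injOn (fun a => Fin.cons a.2 a.1) (fun a ha => ?_) ?_
    · obtain ⟨ha1, ha2⟩ := Finset.mem_sigma.1 ha
      obtain ⟨ha2, ha3, ha4⟩ := Finset.mem_filter.1 ha2
      have hg := Fintype.mem_piFinset.1 ha1
      have hpos : 0 < ∏ i, a.1 i := Finset.prod_pos fun i _ => hG _ _ (hg i)
      have hpos' : (0 : ℝ) < ((∏ i, a.1 i : ℕ) : ℝ) := by exact_mod_cast hpos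
      have hprod : ((∏ i, (Fin.cons a.2 a.1 : Fin (k + 1) → ℕ) i : ℕ) : ℝ) =
          (a.2 : ℝ) * ((∏ i, a.1 i : ℕ) : ℝ) := by
        rw [Fin.prod_univ_succ]; simp
      refine Finset.mem_coe.2 (Finset.mem_filter.2 ⟨Fintype.mem_piFinset.2 fun i => ?_, ?_, ?_⟩)
      · refine Fin.cases ?_ (fun i => ?_) i
        · simpa using ha2
        · simpa using hg i
      · rw [hprod, ← div_lt_iff₀ hpos', div_right_comm]; exact ha3
      · rw [hprod, ← le_div_iff₀ hpos']; exact ha4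
    · rintro ⟨g, n⟩ _ ⟨g', n'⟩ _ h
      obtain ⟨h2, h3⟩ := Fin.cons_injective2 h
      subst h2; subst h3; rfl
  refine le_trans ?_ (Nat.cast_le.2 h1)
  rw [hD, Finset.card_sigma, Nat.cast_sum, Finset.prod_univ_sum, Finset.mul_sum]
  refine Finset.sum_le_sum fun g hg => le_trans (le_of_eq ?_) (hc g hg)
  rw [Finset.prod_div_distrib, Finset.prod_const_one, Nat.cast_prod]
  ring

end Tuples

/-- The lower end of the range of levels in row `i`. -/
noncomputable def rowLow (ρ δ L : ℝ) {k : ℕ} (i : Fin (k + 1)) : ℝ :=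
  if i = 0 then L - 1 else (1 - δ) * (ρ ^ (i : ℕ) * L)

open Classical in
/-- Regular shifted primes with level in the `i`-th range. -/
noncomputable def goodRow (ρ δ L : ℝ) {k : ℕ} (N : ℕ) (i : Fin (k + 1)) : Finset ℕ :=
  (Finset.Icc 4 N).filter fun n => (n - 1).Prime ∧ (rowLow ρ δ L i < lev n ∧ lev n ≤ ρ ^ (i : ℕ) * L) ∧
    Regular ρ δ L k n

theorem mem_goodRow {ρ δ L : ℝ} {k N : ℕ} {i : Fin (k + 1)} {n : ℕ} :
    n ∈ goodRow ρ δ L N i ↔ n ∈ Finset.Icc 4 N ∧ (n - 1).Prime ∧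
      (rowLow ρ δ L i < lev n ∧ lev n ≤ ρ ^ (i : ℕ) * L) ∧ Regular ρ δ L k n := by
  classical
  exact Finset.mem_filter

theorem exp_lt_log_of_lt_lev {n : ℕ} {z : ℝ} (hn : 4 ≤ n) (hz : z < lev n) : Real.exp z < Real.log n := by
  have hn4 : (4 : ℝ) ≤ n := by exact_mod_cast hn
  exact (Real.lt_log_iff_exp_lt (Real.log_pos (by linarith))).1 hz

/-- Compatibility conditions between the parameters of the construction. -/
structure Scale (M ρ δ L : ℝ) (k : ℕ) : Prop where
  nonneg : 0 ≤ M
  sum_le : ∀ (N : ℕ) (b : ℝ), 0 ≤ b →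
    ∑ q ∈ (primesUpTo N).filter (fun q => lev q ≤ b), (1 : ℝ) / q ≤ b + M
  sum_le' : ∀ (N : ℕ) (a b : ℝ), 0 ≤ a → a ≤ b →
    ∑ q ∈ (primesUpTo N).filter (fun q => a < lev q ∧ lev q ≤ b), (1 : ℝ) / q ≤ b - a + M
  le_sum : ∀ (N : ℕ) (a b : ℝ), 0 ≤ a → a ≤ b → ⌊Real.exp (Real.exp b)⌋₊ ≤ N →
    b - a - M ≤ ∑ q ∈ (primesUpTo N).filter (fun q => a < lev q ∧ lev q ≤ b), (1 : ℝ) / q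
  ρ_pos : 0 < ρ
  ρ_le : ρ ≤ 1 - δ
  δ_pos : 0 < δ
  δ_le : δ ≤ 1 / 2
  L_ge : 80 ≤ L
  M_le : M ≤ L
  δL_ge : 1 ≤ δ * L
  sieve : ∀ N : ℕ, Real.log N ≤ Real.exp L → SieveBound N (L ^ 40)
  row : 8 * (1 + M) ≤ δ * (ρ ^ k * L)
  sq_le : L ^ 2 ≤ Real.exp ((1 - δ) * (ρ ^ k * L) - 1)
  irregular : (L + 1) * (Real.exp (2 * (L + M) + 18 - L ^ 2 / 12) +
        (k + 1) * (Real.exp (19 + 2 * M - ((1 + δ) * Real.log (1 + δ) - δ) * ((1 - ρ) * (ρ ^ k * L))) *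
        ((2 * L ^ 40 + 1) * L ^ 2))) ≤ 1
  irregular_top : Real.exp (2 * (L + M) + 18 - L ^ 2 / 12) +
        (k + 1) * (Real.exp (20 + 2 * M - ((1 + δ) * Real.log (1 + δ) - δ) *
          ((1 - ρ) * (ρ ^ k * L)) - L) * (L * (2 * L ^ 40 + 1) * L ^ 4)) ≤ Real.exp (-L) / 20
  k_le : (k + 1 : ℝ) ≤ L
  exp_le : (k + 1) * Real.exp (ρ * L) ≤ Real.exp L / 4
  gain : 2 ^ (k + 1) * ((L ^ 2) ^ (k + 1) * (3 * Real.exp (M + 20) * L ^ 45 *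
    Real.exp ((M + 18) * (k + 1) ^ 2 + 2 * (k + 1) * Real.log (L ^ 43 * L ^ 2) -
      2 * δ * (ρ ^ k * L)))) ≤ 1 / 8

namespace Scale

variable {M ρ δ L : ℝ} {k N : ℕ} (h : Scale M ρ δ L k)

include h

theorem ρ_lt : ρ < 1 := by linarith [h.ρ_le, h.δ_pos]

theorem L_pos : 0 < L := by linarith [h.L_ge]

theorem pow_mul_le (i : ℕ) : ρ ^ i * L ≤ L :=
  mul_le_of_le_one_left h.L_pos.le (pow_le_one₀ h.ρ_pos.le h.ρ_lt.le)

theorem le_pow_mul {i : ℕ} (hi : i ≤ k) : ρ ^ k * L ≤ ρ ^ i * L :=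
  mul_le_mul_of_nonneg_right (pow_le_pow_of_le_one h.ρ_pos.le h.ρ_lt.le hi) h.L_pos.le

theorem le_rowLow (i : Fin (k + 1)) : (1 - δ) * (ρ ^ (i : ℕ) * L) ≤ rowLow ρ δ L i := by
  unfold rowLow
  split_ifs with hi
  · subst hi
    have := h.δL_ge
    simp only [Fin.val_zero, pow_zero, one_mul]
    linarith
  · exact le_rfl

theorem sq_le_exp_rowLow (i : Fin (k + 1)) : 1 ≤ Real.exp (rowLow ρ δ L i) / L ^ 2 := by
  have hL := h.L_pos
  rw [le_div_iff₀ (by positivity), one_mul]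
  refine h.sq_le.trans (Real.exp_le_exp.2 (le_trans ?_ (h.le_rowLow i)))
  have := mul_le_mul_of_nonneg_left (h.le_pow_mul (Nat.lt_succ_iff.1 i.2))
    (show 0 ≤ 1 - δ by linarith [h.δ_le])
  linarith

theorem rowHyp : RowHyp ρ δ L k N (rowLow ρ δ L) (goodRow ρ δ L N) := by
  have hdis : ∀ i j : Fin (k + 1), i < j → ∀ n ∈ goodRow ρ δ L N i, n ∉ goodRow ρ δ L N j := by
    intro i j hij n hn hn'
    obtain ⟨-, -, ⟨hi, -⟩, -⟩ := mem_goodRow.1 hn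
    obtain ⟨-, -, ⟨-, hj⟩, -⟩ := mem_goodRow.1 hn'
    have h1 := h.le_rowLow i
    have h2 : ρ ^ (j : ℕ) * L ≤ ρ ^ (i + 1 : ℕ) * L :=
      mul_le_mul_of_nonneg_right (pow_le_pow_of_le_one h.ρ_pos.le h.ρ_lt.le hij) h.L_pos.le
    have h3 := mul_le_mul_of_nonneg_right h.ρ_le
      (mul_nonneg (pow_pos h.ρ_pos (i : ℕ)).le h.L_pos.le)
    rw [pow_succ] at h2
    linarith
  refine ⟨fun i n hn => (Finset.mem_Icc.1 (mem_goodRow.1 hn).1).1,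
    fun i n hn => (mem_goodRow.1 hn).2.1,
    fun i n hn => (Finset.mem_Icc.1 (mem_goodRow.1 hn).1).2, fun i n hn => ?_,
    fun i n hn => (mem_goodRow.1 hn).2.2.1.2, fun i n hn => (mem_goodRow.1 hn).2.2.2.2,
    fun i j hij n hn hn' => ?_⟩
  · obtain ⟨hn1, -, ⟨hi, -⟩, hr, -⟩ := mem_goodRow.1 hn
    have hL := h.L_pos
    rw [div_le_iff₀ (by positivity), mul_comm]
    exact (exp_lt_log_of_lt_lev (Finset.mem_Icc.1 hn1).1 hi).le.trans hr
  · rcases lt_or_gt_of_ne hij with hlt | hlt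
    · exact hdis i j hlt n hn hn'
    · exact hdis j i hlt n hn' hn

theorem sum_goodRow_le (i : Fin (k + 1)) : ∑ n ∈ goodRow ρ δ L N i, (1 : ℝ) / n ≤ L ^ 2 := by
  have h1 := h.sum_le N L h.L_pos.le
  refine (Finset.sum_le_sum_of_surj (t := (primesUpTo N).filter (fun q => lev q ≤ L)) (fun p => p + 1)
    (fun n : ℕ => (1 : ℝ) / n) (fun n => by positivity) fun n hn => ?_).trans ?_
  · obtain ⟨hn1, hn2, ⟨-, hn3⟩, -⟩ := mem_goodRow.1 hn
    obtain ⟨hn4, hnN⟩ := Finset.mem_Icc.1 hn1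
    refine ⟨n - 1, Finset.mem_filter.2 ⟨mem_primesUpTo.2 ⟨hn2, by omega⟩, ?_⟩, by omega⟩
    exact (lev_mono (by omega) (by omega)).trans (hn3.trans (h.pow_mul_le i))
  · refine le_trans (Finset.sum_le_sum fun p hp => ?_) (h1.trans ?_)
    · have hp0 : (0 : ℝ) < p := by
        exact_mod_cast (mem_primesUpTo.1 (Finset.mem_filter.1 hp).1).1.pos
      exact one_div_le_one_div_of_le hp0 (by push_cast; linarith)
    · nlinarith [h.M_le, h.L_ge]

theorem sieve' (s : ℝ) (hs : s ≤ L) : SieveBound ⌊Real.exp (Real.exp s)⌋₊ (L ^ 40) := by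
  refine h.sieve _ (le_trans ?_ (Real.exp_le_exp.2 hs))
  have h0 : (0 : ℝ) < ⌊Real.exp (Real.exp s)⌋₊ := by
    exact_mod_cast Nat.floor_pos.2 (Real.one_le_exp (Real.exp_pos s).le)
  exact (Real.log_le_log h0 (Nat.floor_le (Real.exp_pos _).le)).trans (le_of_eq (Real.log_exp _))

theorem le_sum_goodRow {i : Fin (k + 1)} (hi : i ≠ 0) (hN : ⌊Real.exp (Real.exp L)⌋₊ ≤ N) :
    δ / 8 * (ρ ^ (i : ℕ) * L) ≤ ∑ n ∈ goodRow ρ δ L N i, (1 : ℝ) / n := by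
  classical
  have hδ := h.δ_pos
  have hδ2 := h.δ_le
  have hM := h.nonneg
  have hik := Nat.lt_succ_iff.1 i.2
  set b := ρ ^ (i : ℕ) * L with hb
  have hbk : ρ ^ k * L ≤ b := h.le_pow_mul hik
  have hbL : b ≤ L := h.pow_mul_le i
  have hδb : 8 * (1 + M) ≤ δ * b := h.row.trans (mul_le_mul_of_nonneg_left hbk hδ.le)
  have hb16 : 16 ≤ b := by nlinarith
  have ha1 : 1 ≤ (1 - δ) * b := by nlinarith
  have h1 := le_sum_shifted (N := N) ha1 (by nlinarith) h.le_sum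
    ((Nat.floor_mono (Real.exp_le_exp.2 (Real.exp_le_exp.2 hbL))).trans hN)
  have h2 := sum_irregular_le (k := k) h.ρ_pos h.ρ_lt (zero_le_one.trans ha1) hbL hδ hδ2 hM h.sum_le h.sum_le'
    h.sieve' (by positivity) (h.sq_le.trans (Real.exp_le_exp.2 (by
      have := mul_le_mul_of_nonneg_left hbk (show 0 ≤ 1 - δ by linarith)
      linarith))) (by linarith [h.L_ge]) N
  have h3 := h2.trans h.irregular
  have h4 := Finset.sum_le_sum_add_sum
    (A := (Finset.Icc 4 N).filter (fun n => (n - 1).Prime ∧ ((1 - δ) * b < lev n ∧ lev n ≤ b)))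
    (A₁ := goodRow ρ δ L N i) (A₂ := (Finset.Icc 4 N).filter (fun n => (n - 1).Prime ∧
      ((1 - δ) * b < lev n ∧ lev n ≤ b) ∧ ¬ Regular ρ δ L k n)) (fun n : ℕ => (1 : ℝ) / n)
    (fun n => by positivity) (fun n hn => by
      obtain ⟨hn1, hn2, hn3⟩ := Finset.mem_filter.1 hn
      by_cases hr : Regular ρ δ L k n
      · refine Or.inl (mem_goodRow.2 ⟨hn1, hn2, ?_, hr⟩)
        rw [rowLow, if_neg hi]
        exact hn3
      · exact Or.inr (Finset.mem_filter.2 ⟨hn1, hn2, hn3, hr⟩))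
  have h5 := h1.trans (h4.trans (add_le_add_right h3 _))
  nlinarith

end Scale

theorem card_le_card_shifted_primes (m X : ℕ) :
    X.primeCounting ≤ m.primeCounting + 1 +
      ((Finset.Icc 1 X).filter fun n => (n - 1).Prime ∧ m + 1 < n).card := by
  have hc : ∀ n : ℕ, n.primeCounting = ((Finset.range (n + 1)).filter Nat.Prime).card := fun n => by
    rw [Nat.primeCounting, Nat.primeCounting', Nat.count_eq_card_filter_range]
  rw [hc, hc, ← Finset.card_singleton X]
  have hsub : (Finset.range (X + 1)).filter Nat.Prime ⊆ ((Finset.range (m + 1)).filter Nat.Prime ∪ {X}) ∪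
      ((Finset.Icc 1 X).filter fun n => (n - 1).Prime ∧ m + 1 < n).image fun n => n - 1 := by
    intro p hp
    obtain ⟨hp1, hp2⟩ := Finset.mem_filter.1 hp
    rw [Finset.mem_range] at hp1
    rw [Finset.mem_union, Finset.mem_union, Finset.mem_filter, Finset.mem_range, Finset.mem_singleton,
      Finset.mem_image]
    by_cases h1 : p < m + 1
    · exact Or.inl (Or.inl ⟨h1, hp2⟩)
    by_cases h2 : p = X
    · exact Or.inl (Or.inr h2)
    · refine Or.inr ⟨p + 1, Finset.mem_filter.2 ⟨Finset.mem_Icc.2 ⟨by omega, by omega⟩, ?_, by omega⟩,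
        by omega⟩
      rwa [Nat.add_sub_cancel]
  refine (Finset.card_le_card hsub).trans ((Finset.card_union_le _ _).trans ?_)
  exact add_le_add (Finset.card_union_le _ _) Finset.card_image_le

namespace Scale

variable {M ρ δ L : ℝ} {k N : ℕ} (h : Scale M ρ δ L k)

include h

theorem sum_goodRow_zero_top_le (hN : Real.log N ≤ Real.exp L) (hlev : lev N ≤ L) (Y : ℝ) :
    ∑ n ∈ (goodRow ρ δ L N (0 : Fin (k + 1))).filter (fun n : ℕ => Y / L < n ∧ n ≤ Y), (1 : ℝ) / n ≤
      Real.exp (-L) * (3 * Real.exp (M + 20) * L ^ 45) := by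
  have hL := h.L_pos
  have hL1 : 1 ≤ L := by linarith [h.L_ge]
  have hZ := h.sq_le_exp_rowLow 0
  have hr : rowLow ρ δ L (0 : Fin (k + 1)) = L - 1 := if_pos rfl
  rw [hr] at hZ
  have h1 := sum_shifted_top_le (h.sieve N hN) (by positivity) hZ (w := fun _ => 1)
    (fun _ => zero_le_one) (fun _ => by norm_num) (B := L) (Y := Y) hL1
  have h2 : ∑ q ∈ primesUpTo N, (1 : ℝ) / q ≤ L + M := by
    refine le_trans (le_of_eq ?_) (h.sum_le N L hL.le)
    rw [Finset.filter_true_of_mem]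
    intro q hq
    obtain ⟨hq1, hq2⟩ := mem_primesUpTo.1 hq
    exact (lev_mono hq1.two_le hq2).trans hlev
  refine le_trans (Finset.sum_le_sum_of_subset_of_nonneg (fun n hn => ?_) fun n _ _ => by positivity)
    ((le_of_eq (Finset.sum_congr rfl fun n _ => ?_)).trans (h1.trans ?_))
  · obtain ⟨hn, hn1⟩ := Finset.mem_filter.1 hn
    obtain ⟨hn2, hn3, -⟩ := mem_goodRow.1 hn
    obtain ⟨hn4, hn5⟩ := Finset.mem_Icc.1 hn2
    refine Finset.mem_filter.2 ⟨Finset.mem_Icc.2 ⟨by omega, hn5⟩, ⟨hn3, ?_⟩, hn1⟩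
    have := (h.rowHyp (N := N)).gpf_le 0 n hn
    rwa [hr] at this
  · simp [cm]
  · calc L / (Real.exp (L - 1) / L ^ 2) * (Real.exp (∑ q ∈ primesUpTo N, (1 : ℝ) / q + 18) *
          ((2 * L ^ 40 + 1) / (Real.exp (L - 1) / L ^ 2)))
        ≤ L / (Real.exp (L - 1) / L ^ 2) * (Real.exp (L + M + 18) *
          ((3 * L ^ 40) / (Real.exp (L - 1) / L ^ 2))) := by
          have : 1 ≤ L ^ 40 := one_le_pow₀ hL1
          have h3 : 2 * L ^ 40 + 1 ≤ 3 * L ^ 40 := by linarith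
          gcongr
      _ = 3 * L ^ 45 * (Real.exp (L + M + 18) / (Real.exp (L - 1) * Real.exp (L - 1))) := by
          field_simp
      _ = _ := by
          rw [← Real.exp_add, ← Real.exp_sub, show L + M + 18 - (L - 1 + (L - 1)) = -L + (M + 20) by ring,
            Real.exp_add]
          ring

theorem card_goodRow_zero_aux : 1000 ≤ Real.exp L ∧ 40 * L ≤ Real.exp L := by
  have hL := h.L_ge
  have h1 := Real.quadratic_le_exp_of_nonneg h.L_pos.le
  constructor <;> nlinarith

set_option maxHeartbeats 1000000 in
theorem le_card_goodRow_zero {X : ℝ} (hX : Real.exp (Real.exp L / 2) ≤ X)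
    (hX' : X ≤ Real.exp (Real.exp L)) :
    Real.exp (-L) / 4 * X ≤ ((goodRow ρ δ L ⌊Real.exp (Real.exp L)⌋₊ (0 : Fin (k + 1))).filter
      (fun n : ℕ => X / L < n ∧ n ≤ X)).card := by
  classical
  have hL := h.L_ge
  have hL0 := h.L_pos
  obtain ⟨he1, he2⟩ := h.card_goodRow_zero_aux
  set ℓ := Real.exp L with hℓ
  have hℓ0 : 0 < ℓ := Real.exp_pos L
  have hX0 : 0 < X := (Real.exp_pos _).trans_le hX
  have hlogX : Real.log X ≤ ℓ := (Real.log_le_iff_le_exp hX0).2 hX'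
  have hlogX2 : ℓ / 2 ≤ Real.log X := (Real.le_log_iff_exp_le hX0).2 hX
  have hsq : ℓ ^ 2 / 32 ≤ √X := by
    refine Real.le_sqrt_of_sq_le (le_trans ?_ hX)
    have h1 := Real.quadratic_le_exp_of_nonneg (show 0 ≤ ℓ / 4 by positivity)
    have h2 : ℓ ^ 2 / 32 ≤ Real.exp (ℓ / 4) := by nlinarith
    calc (ℓ ^ 2 / 32) ^ 2 ≤ Real.exp (ℓ / 4) ^ 2 := by gcongr
      _ = Real.exp (ℓ / 2) := by rw [← Real.exp_nat_mul]; congr 1; push_cast; ring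
  have hsq2 : 30 * ℓ ≤ √X := by nlinarith
  have hXs : √X * √X = X := Real.mul_self_sqrt hX0.le
  have hX30 : 30 * √X ≤ X / ℓ := by
    rw [le_div_iff₀ hℓ0]
    nlinarith
  have hX1000 : 900000 ≤ X := by nlinarith
  have hlogL : Real.log L ≤ L := (Real.log_le_sub_one_of_pos hL0).trans (by linarith)
  have hy : ℓ / 4 + ℓ * 0.2 ≤ Real.log (X / L) := by
    rw [Real.log_div hX0.ne' hL0.ne']
    nlinarith
  have hy1 : 1 < X / L := (Real.log_pos_iff (by positivity)).1 (by nlinarith)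
  have hpi1 : 0.6 * (X / ℓ) ≤ (⌊X⌋₊.primeCounting : ℝ) := by
    refine le_trans ?_ (Chebyshev.pi_ge' (by linarith : 1 < X))
    have hlog : Real.log (X + 2) ≤ 0.01 * X := by
      have h1 : Real.log (X + 2) = 2 * Real.log √(X + 2) := by
        rw [Real.log_sqrt (by linarith)]; ring
      have h2 := Real.log_le_sub_one_of_pos (Real.sqrt_pos.2 (by linarith : 0 < X + 2))
      have h3 : √(X + 2) ≤ 0.005 * X := by
        refine Real.sqrt_le_iff.2 ⟨by linarith, ?_⟩
        nlinarith
      linarith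
    have hl2 := Real.log_two_gt_d9
    have hnum : 0.6 * X ≤ (X - 1) * Real.log 2 - Real.log (X + 2) := by nlinarith
    calc 0.6 * (X / ℓ) = 0.6 * X / ℓ := by ring
      _ ≤ 0.6 * X / Real.log X := by
          refine div_le_div_of_nonneg_left (by positivity) (by linarith) hlogX
      _ ≤ _ := div_le_div_of_nonneg_right hnum (by linarith)
  have hpi2 : (⌊X / L⌋₊.primeCounting : ℝ) ≤ 0.15 * (X / ℓ) + √X := by
    refine (Chebyshev.pi_le_log4_mul_div hy1).trans (add_le_add ?_ (Real.sqrt_le_sqrt ?_))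
    · rw [Real.log_sqrt (by positivity)]
      have hl4 : Real.log 4 ≤ 1.4 := by
        rw [show (4 : ℝ) = 2 ^ 2 by norm_num, Real.log_pow]
        have := Real.log_two_lt_d9
        push_cast
        linarith
      calc Real.log 4 * (X / L) / (Real.log (X / L) / 2) ≤ 1.4 * (X / 80) / (ℓ / 4 / 2) := by
            have h4 : ℓ / 4 ≤ Real.log (X / L) := by linarith
            gcongr
        _ = 0.14 * (X / ℓ) := by field_simp; norm_num
        _ ≤ _ := by
            have : 0 < X / ℓ := by positivity
            linarith
    · exact div_le_self hX0.le (by linarith)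
  have hcount := card_le_card_shifted_primes ⌊X / L⌋₊ ⌊X⌋₊
  have hirr := card_irregular_le (k := k) (B := L) (X := X) h.ρ_pos h.ρ_lt h.δ_pos h.δ_le h.nonneg h.sum_le
    h.sum_le' h.sieve' (by positivity) (by
      have := h.sq_le_exp_rowLow 0
      rwa [rowLow, if_pos rfl, le_div_iff₀ (by positivity), one_mul] at this) (by linarith)
      ⌊Real.exp ℓ⌋₊ (by linarith) hX0.le
  have hirr2 := hirr.trans (mul_le_mul_of_nonneg_left h.irregular_top hX0.le)
  have hsub : (Finset.Icc 1 ⌊X⌋₊).filter (fun n => (n - 1).Prime ∧ ⌊X / L⌋₊ + 1 < n) ⊆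
      (goodRow ρ δ L ⌊Real.exp ℓ⌋₊ (0 : Fin (k + 1))).filter (fun n : ℕ => X / L < n ∧ n ≤ X) ∪
      (Finset.Icc 4 ⌊Real.exp ℓ⌋₊).filter (fun n => (n - 1).Prime ∧ (L - 1 < lev n ∧ lev n ≤ L) ∧
        (X / L < n ∧ n ≤ X) ∧ ¬Regular ρ δ L k n) := by
    intro n hn
    obtain ⟨hn1, hn2, hn3⟩ := Finset.mem_filter.1 hn
    have hnX : (n : ℝ) ≤ X := (Nat.le_floor_iff hX0.le).1 (Finset.mem_Icc.1 hn1).2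
    have hnX2 : X / L < n := (Nat.floor_lt (by positivity)).1 (by omega)
    have hlogn : Real.log (X / L) ≤ Real.log n := Real.log_le_log (by positivity) hnX2.le
    have hn0 : (0 : ℝ) < n := (by positivity : 0 < X / L).trans hnX2
    have hn4 : n ∈ Finset.Icc 4 ⌊Real.exp ℓ⌋₊ := by
      refine Finset.mem_Icc.2 ⟨?_, Nat.le_floor (hnX.trans hX')⟩
      have h1 : (4 : ℝ) ≤ n := by
        have := Real.log_le_sub_one_of_pos hn0
        linarith
      exact_mod_cast h1
    have hlev1 : L - 1 < lev n := by
      refine (Real.lt_log_iff_exp_lt (by linarith)).2 ?_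
      rw [Real.exp_sub, ← hℓ, div_lt_iff₀ (Real.exp_pos 1)]
      have := Real.exp_one_gt_d9
      nlinarith
    have hlev2 : lev n ≤ L := by
      refine (Real.log_le_iff_le_exp (by linarith)).2 ?_
      exact (Real.log_le_log hn0 hnX).trans hlogX
    rw [Finset.mem_union, Finset.mem_filter, Finset.mem_filter, mem_goodRow]
    by_cases hr : Regular ρ δ L k n
    · refine Or.inl ⟨⟨hn4, hn2, ⟨?_, ?_⟩, hr⟩, hnX2, hnX⟩
      · rwa [rowLow, if_pos rfl]
      · simpa using hlev2
    · exact Or.inr ⟨hn4, hn2, ⟨hlev1, hlev2⟩, ⟨hnX2, hnX⟩, hr⟩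
  have hc2 := (Finset.card_le_card hsub).trans (Finset.card_union_le _ _)
  have hc3 := (Nat.cast_le (α := ℝ)).2 (hcount.trans (add_le_add_right hc2 _))
  push_cast at hc3
  have hexp : Real.exp (-L) = 1 / ℓ := by rw [Real.exp_neg, one_div]
  rw [hexp] at hirr2 ⊢
  have e1 : X * (1 / ℓ / 20) = 0.05 * (X / ℓ) := by ring
  have e2 : 1 / ℓ / 4 * X = 0.25 * (X / ℓ) := by ring
  rw [e1] at hirr2
  rw [e2]
  have h1s : 1 ≤ √X := by linarith
  linarith

end Scale

theorem le_S_of_card (k : ℕ) {x : ℝ} {T : Finset (Fin (k + 1) → ℕ)}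
    (hT : ∀ f ∈ T, ∀ i, 4 ≤ f i ∧ (f i - 1).Prime)
    (hx : ∀ f ∈ T, ((∏ i, f i : ℕ) : ℝ) ≤ x / 2 ^ (k + 1)) :
    (T.image fun f => ∏ i, f i).card ≤ S x := by
  rw [← Finset.card_image_of_injective (T.image fun f => ∏ i, f i)
    (mul_right_injective₀ (show 2 ^ (k + 1) ≠ 0 by positivity)), ← Set.ncard_coe_finset]
  refine Set.ncard_le_ncard (fun n hn => ?_) ?_
  · obtain ⟨m, hm, rfl⟩ := Finset.mem_image.1 (Finset.mem_coe.1 hn)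
    obtain ⟨f, hf, rfl⟩ := Finset.mem_image.1 hm
    have hpos : 0 < ∏ i, f i := Finset.prod_pos fun i _ => by have := (hT f hf i).1; omega
    refine ⟨by positivity, ?_, ?_⟩
    · have := hx f hf
      rw [le_div_iff₀ (by positivity)] at this
      rw [Nat.cast_mul, mul_comm]
      push_cast at this ⊢
      exact this
    · have h1 := HadamardOrder.prod Finset.univ (fun i => 2 * f i) fun i _ => by
        obtain ⟨h4, hp⟩ := hT f hf i
        have := HadamardOrder.two_mul_prime_add_one hp (by omega)
        rwa [Nat.sub_add_cancel (by omega)] at this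
      rwa [Finset.prod_mul_distrib, Finset.prod_const, Finset.card_univ, Fintype.card_fin] at h1
  · refine (Set.finite_Iic ⌊x⌋₊).subset fun n hn => Nat.le_floor hn.2.1

namespace Scale

variable {M ρ δ L : ℝ} {k N : ℕ} (h : Scale M ρ δ L k)

include h

theorem collExp_le_of_nonempty
    (hb : ∀ m, ∑ r ∈ Finset.Icc 1 m, ((1 + δ) * incr r + 3 * δ) * ρ ^ r ≤ 1 - 4 * δ)
    {J : Finset (Fin (k + 1))} (hJ : J.Nonempty) :
    Real.exp (collExp ρ δ L M (L ^ 43) (rowLow ρ δ L) J) ≤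
      Real.exp ((M + 18) * (k + 1) ^ 2 + 2 * (k + 1) * Real.log (L ^ 43 * L ^ 2) - 2 * δ * (ρ ^ k * L)) := by
  have hL1 : 1 ≤ L := by linarith [h.L_ge]
  have h1 := collExp_le h.ρ_pos h.ρ_lt hL1 h.δ_pos.le h.nonneg (one_le_pow₀ hL1) h.le_rowLow hb
    (J.min'_mem hJ) (fun i hi => J.min'_le i hi) (H := L ^ 43)
  have h2 := mul_le_mul_of_nonneg_left (h.le_pow_mul (Nat.lt_succ_iff.1 (J.min' hJ).2))
    (mul_nonneg zero_le_two h.δ_pos.le)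
  refine Real.exp_le_exp.2 (h1.trans ?_)
  linarith

theorem le_L_pow : 2 * (k + 1 : ℝ) ^ 2 * L ^ 40 ≤ L ^ 43 := by
  have hL := h.L_ge
  calc 2 * (k + 1 : ℝ) ^ 2 * L ^ 40 ≤ L * L ^ 2 * L ^ 40 := by
        have := h.k_le
        gcongr
        linarith
    _ = L ^ 43 := by ring

theorem prod_goodRow_le {g : Fin k → ℕ} (hg : ∀ i, g i ∈ goodRow ρ δ L N i.succ) :
    2 ^ (k + 1) * ((∏ i, g i : ℕ) : ℝ) ≤ Real.exp (Real.exp L / 2) := by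
  have h1 : ((∏ i, g i : ℕ) : ℝ) ≤ Real.exp (k * Real.exp (ρ * L)) := by
    rw [Nat.cast_prod]
    refine (Finset.prod_le_prod (g := fun _ => Real.exp (Real.exp (ρ * L)))
      (fun i _ => Nat.cast_nonneg (g i)) fun i _ => ?_).trans (le_of_eq ?_)
    · obtain ⟨hi, -, ⟨-, hi2⟩, -⟩ := mem_goodRow.1 (hg i)
      have hn4 : (4 : ℝ) ≤ g i := by exact_mod_cast (Finset.mem_Icc.1 hi).1
      have h2 : ρ ^ (i.succ : ℕ) * L ≤ ρ * L := by
        refine mul_le_mul_of_nonneg_right ?_ h.L_pos.le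
        exact pow_le_of_le_one h.ρ_pos.le h.ρ_lt.le (by simp)
      refine (Real.log_le_iff_le_exp (by linarith)).1 ?_
      exact (Real.log_le_iff_le_exp (Real.log_pos (by linarith))).1 (hi2.trans h2)
    · rw [Finset.prod_const, Finset.card_univ, Fintype.card_fin, ← Real.exp_nat_mul]
  have h2 : (2 : ℝ) ^ (k + 1) ≤ Real.exp (k + 1) := by
    rw [show Real.exp ((k : ℝ) + 1) = Real.exp 1 ^ (k + 1) by
      rw [← Real.exp_nat_mul]; push_cast; rw [mul_one]]
    have := Real.exp_one_gt_d9
    gcongr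
    linarith
  have h3 := h.exp_le
  have h4 : 1 ≤ Real.exp (ρ * L) := Real.one_le_exp (mul_pos h.ρ_pos h.L_pos).le
  have hk : (0 : ℝ) ≤ k := Nat.cast_nonneg k
  calc (2 : ℝ) ^ (k + 1) * ((∏ i, g i : ℕ) : ℝ)
      ≤ Real.exp (k + 1) * Real.exp (k * Real.exp (ρ * L)) := by gcongr
    _ = Real.exp (k + 1 + k * Real.exp (ρ * L)) := (Real.exp_add _ _).symm
    _ ≤ _ := Real.exp_le_exp.2 (by nlinarith)

set_option maxHeartbeats 1000000 in
theorem le_S (hb : ∀ m, ∑ r ∈ Finset.Icc 1 m, ((1 + δ) * incr r + 3 * δ) * ρ ^ r ≤ 1 - 4 * δ) :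
    Real.exp (Real.exp L) / 2 ^ (k + 1) * (Real.exp (-L) / 8) *
      ∏ i : Fin k, δ / 8 * (ρ ^ (i + 1 : ℕ) * L) ≤ S (Real.exp (Real.exp L)) := by
  classical
  have hL := h.L_ge
  have hL0 := h.L_pos
  have hL1 : 1 ≤ L := by linarith
  set N := ⌊Real.exp (Real.exp L)⌋₊ with hN
  set x := Real.exp (Real.exp L) with hx
  have hx0 : 0 < x := Real.exp_pos _
  set Y := x / 2 ^ (k + 1) with hY
  have hY0 : 0 < Y := by positivity
  set G : Fin (k + 1) → Finset ℕ := goodRow ρ δ L N with hG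
  have hG4 : ∀ i, ∀ n ∈ G i, 4 ≤ n := fun i n hn => (Finset.mem_Icc.1 (mem_goodRow.1 hn).1).1
  have hG1 : ∀ i, ∀ n ∈ G i, 1 ≤ n := fun i n hn => le_trans (by norm_num) (hG4 i n hn)
  have hN1 : 1 ≤ N := Nat.floor_pos.2 (Real.one_le_exp (Real.exp_pos L).le)
  have hNlog : Real.log N ≤ Real.exp L := by
    have h0 : (0 : ℝ) < N := by exact_mod_cast hN1
    exact (Real.log_le_log h0 (Nat.floor_le hx0.le)).trans (le_of_eq (Real.log_exp _))
  have hNlev : lev N ≤ L := lev_floor_le hL0.le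
  have hrow := h.rowHyp (N := N)
  have hr : rowLow ρ δ L (0 : Fin (k + 1)) = L - 1 := if_pos rfl
  set E := Real.exp ((M + 18) * (k + 1) ^ 2 + 2 * (k + 1) * Real.log (L ^ 43 * L ^ 2) -
    2 * δ * (ρ ^ k * L)) with hE
  set U := Real.exp (-L) * (3 * Real.exp (M + 20) * L ^ 45) with hU
  have hU0 : 0 ≤ U := by positivity
  have hcoll := card_collisions_le (G := G) (B := L) (Y := Y) (S := L ^ 2) (E := E) (U := U) hG1
    (one_le_pow₀ hL1) hY0.le (fun i => h.sum_goodRow_le i) (Real.exp_pos _).le hU0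
    (fun J hJ => (hrow.sum_collPairs_le_exp hN1 h.ρ_pos h.ρ_lt hL1 hNlev h.sum_le h.sum_le'
      (h.sieve N hNlog) (by positivity) h.sq_le_exp_rowLow (one_le_pow₀ hL1) h.le_L_pow).trans
      (h.collExp_le_of_nonempty hb hJ))
    (fun J hJ Y => (hrow.sum_collPairs_top_le_exp hN1 h.ρ_pos h.ρ_lt hL1 hNlev h.sum_le h.sum_le'
      (h.sieve N hNlog) (by positivity) h.sq_le_exp_rowLow (one_le_pow₀ hL1) h.le_L_pow hL1 hJ).trans (by
        refine mul_le_mul ?_ (h.collExp_le_of_nonempty hb ⟨0, hJ⟩) (Real.exp_pos _).le hU0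
        rw [hr, hU]
        calc L / (Real.exp (L - 1) / L ^ 2) = Real.exp (-L) * (Real.exp 1 * L ^ 3) := by
              rw [Real.exp_sub, Real.exp_neg]; field_simp
          _ ≤ Real.exp (-L) * (3 * Real.exp (M + 20) * L ^ 45) := by
              have h1 : Real.exp 1 ≤ Real.exp (M + 20) := Real.exp_le_exp.2 (by linarith [h.nonneg])
              have h2 : L ^ 3 ≤ L ^ 45 := pow_le_pow_right₀ hL1 (by norm_num)
              have h3 := Real.exp_pos (M + 20)
              have h4 : Real.exp 1 ≤ 3 * Real.exp (M + 20) := by linarith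
              gcongr))
    (fun Y => h.sum_goodRow_zero_top_le hNlog hNlev Y)
  have hcoll2 : 2 ^ (k + 1) * (Y * ((L ^ 2) ^ (k + 1) * (U * E))) ≤ Y * (Real.exp (-L) / 8) := by
    have := mul_le_mul_of_nonneg_left h.gain (mul_nonneg hY0.le (Real.exp_pos (-L)).le)
    calc _ = Y * Real.exp (-L) * (2 ^ (k + 1) * ((L ^ 2) ^ (k + 1) * (3 * Real.exp (M + 20) * L ^ 45 * E))) := by
          rw [hU]; ring
      _ ≤ _ := this
      _ = _ := by ring
  have hcard := le_card_tuples (k := k) (G := G) (B := L) (Y := Y) (c := Real.exp (-L) / 4) hG1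
    fun g hg => by
      have hg' := Fintype.mem_piFinset.1 hg
      have hP := h.prod_goodRow_le hg'
      have hpos : 0 < ∏ i, g i := Finset.prod_pos fun i _ => hG1 _ _ (hg' i)
      have hpos' : (1 : ℝ) ≤ ((∏ i, g i : ℕ) : ℝ) := by exact_mod_cast hpos
      refine h.le_card_goodRow_zero ?_ ?_
      · rw [hY, div_div, le_div_iff₀ (by positivity)]
        calc _ ≤ Real.exp (Real.exp L / 2) * Real.exp (Real.exp L / 2) := by gcongr
          _ = x := by rw [← Real.exp_add, add_halves]
      · rw [hY, div_div]
        exact div_le_self hx0.le (one_le_mul_of_one_le_of_one_le (one_le_pow₀ one_le_two) hpos')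
  set W := ∏ i : Fin k, δ / 8 * (ρ ^ (i + 1 : ℕ) * L) with hW
  have hδ := h.δ_pos
  have hW1 : 1 ≤ W := by
    rw [← Finset.prod_const_one (s := (Finset.univ : Finset (Fin k)))]
    refine Finset.prod_le_prod (fun _ _ => zero_le_one) fun i _ => ?_
    have h1 := h.le_pow_mul (show (i : ℕ) + 1 ≤ k from i.2)
    have h2 := mul_le_mul_of_nonneg_left h1 hδ.le
    have := h.row
    have := h.nonneg
    linarith
  have hWS : W ≤ ∏ i : Fin k, ∑ n ∈ G i.succ, (1 : ℝ) / n := by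
    refine Finset.prod_le_prod (fun i _ => ?_) fun i _ => ?_
    · have := h.ρ_pos
      positivity
    · have := h.le_sum_goodRow (N := N) (Fin.succ_ne_zero i) le_rfl
      rwa [Fin.val_succ] at this
  have hcard2 : Real.exp (-L) / 4 * Y * W ≤ (tuples G L Y).card :=
    (mul_le_mul_of_nonneg_left hWS (by positivity)).trans hcard
  have himg := Finset.card_le_card_image_add (tuples G L Y) fun f => ∏ i, f i
  have himg2 : ((tuples G L Y).card : ℝ) ≤ _ := Nat.cast_le.2 himg
  push_cast at himg2
  have hS := le_S_of_card k (x := x) (T := tuples G L Y) (fun f hf i => by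
      have := Fintype.mem_piFinset.1 (Finset.mem_filter.1 hf).1 i
      exact ⟨hG4 i _ this, (mem_goodRow.1 this).2.1⟩) fun f hf => (Finset.mem_filter.1 hf).2.2
  have hS' : (((tuples G L Y).image fun f => ∏ i, f i).card : ℝ) ≤ S x := Nat.cast_le.2 hS
  have hYe : 0 < Y * (Real.exp (-L) / 8) := by positivity
  have hfin := hcoll.trans hcoll2
  have key : Y * (Real.exp (-L) / 8) ≤ Y * (Real.exp (-L) / 8) * W := le_mul_of_one_le_right hYe.le hW1
  have e1 : Real.exp (-L) / 4 * Y * W = 2 * (Y * (Real.exp (-L) / 8) * W) := by ring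
  linarith

end Scale

set_option maxHeartbeats 1000000 in
theorem Scale.of_le {M ρ δ L : ℝ} {k : ℕ} (nonneg : 0 ≤ M)
    (sum_le : ∀ (N : ℕ) (b : ℝ), 0 ≤ b →
      ∑ q ∈ (primesUpTo N).filter (fun q => lev q ≤ b), (1 : ℝ) / q ≤ b + M)
    (sum_le' : ∀ (N : ℕ) (a b : ℝ), 0 ≤ a → a ≤ b →
      ∑ q ∈ (primesUpTo N).filter (fun q => a < lev q ∧ lev q ≤ b), (1 : ℝ) / q ≤ b - a + M)
    (le_sum : ∀ (N : ℕ) (a b : ℝ), 0 ≤ a → a ≤ b → ⌊Real.exp (Real.exp b)⌋₊ ≤ N →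
      b - a - M ≤ ∑ q ∈ (primesUpTo N).filter (fun q => a < lev q ∧ lev q ≤ b), (1 : ℝ) / q)
    (ρ_pos : 0 < ρ) (ρ_le : ρ ≤ 1 - δ) (δ_pos : 0 < δ) (δ_le : δ ≤ 1 / 2)
    (L_ge : 80 ≤ L) (M_le : M ≤ L) (δL_ge : 1 ≤ δ * L)
    (sieve : ∀ N : ℕ, Real.log N ≤ Real.exp L → SieveBound N (L ^ 40))
    (row : 8 * (1 + M) ≤ δ * (ρ ^ k * L)) (hsq : 4 * Real.log L + 2 ≤ ρ ^ k * L)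
    (hirr : 2 * M + 46 * Real.log L + 25 ≤
      ((1 + δ) * Real.log (1 + δ) - δ) * ((1 - ρ) * (ρ ^ k * L)))
    (hgain : (10 * M + 600) * Real.log L ^ 2 ≤ 2 * δ * (ρ ^ k * L))
    (hk : (k + 1 : ℝ) ≤ 3 * Real.log L) (hlog : 3 * Real.log L ≤ L)
    (hexp : Real.log L + 2 ≤ (1 - ρ) * L) : Scale M ρ δ L k := by
  have hL0 : 0 < L := by linarith
  have hL1 : 1 ≤ L := by linarith
  have hEL : Real.exp (Real.log L) = L := Real.exp_log hL0
  have hkL : (k + 1 : ℝ) ≤ L := hk.trans hlog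
  set y := ρ ^ k * L with hy
  have hy0 : 0 < y := by positivity
  set lL := Real.log L with hlL
  have hpow : ∀ m : ℕ, L ^ m = Real.exp (m * lL) := fun m => by rw [Real.exp_nat_mul, hEL]
  have hl1 : 1 ≤ lL := by
    rw [hlL, Real.le_log_iff_exp_le hL0]
    have := Real.exp_one_lt_d9
    linarith
  have h2e : ∀ a : ℝ, a + 1 ≤ Real.exp a := Real.add_one_le_exp
  have he5 : (140 : ℝ) ≤ Real.exp 5 := by
    rw [show (5 : ℝ) = (5 : ℕ) * 1 by norm_num, Real.exp_nat_mul]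
    have := Real.exp_one_gt_d9
    calc (140 : ℝ) ≤ 2.7 ^ 5 := by norm_num
      _ ≤ _ := by gcongr; linarith
  have he4 : (40 : ℝ) ≤ Real.exp 4 := by
    rw [show (4 : ℝ) = (4 : ℕ) * 1 by norm_num, Real.exp_nat_mul]
    have := Real.exp_one_gt_d9
    calc (40 : ℝ) ≤ 2.7 ^ 4 := by norm_num
      _ ≤ _ := by gcongr; linarith
  have he2 : (4 : ℝ) ≤ Real.exp 2 := by
    rw [show (2 : ℝ) = (2 : ℕ) * 1 by norm_num, Real.exp_nat_mul]
    have := Real.exp_one_gt_d9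
    calc (4 : ℝ) ≤ 2.7 ^ 2 := by norm_num
      _ ≤ _ := by gcongr; linarith
  set c := ((1 + δ) * Real.log (1 + δ) - δ) * ((1 - ρ) * y) with hc
  set Q := Real.exp (20 + 2 * M - c) with hQ
  have hQ0 : 0 < Q := Real.exp_pos _
  have hQL : Q * L ^ 46 ≤ 1 / 140 := by
    rw [hpow, hQ, ← Real.exp_add]
    calc _ ≤ Real.exp (-5) := Real.exp_le_exp.2 (by push_cast; linarith)
      _ = 1 / Real.exp 5 := by rw [Real.exp_neg, one_div]
      _ ≤ _ := one_div_le_one_div_of_le (by norm_num) he5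
  have hA : Real.exp (2 * (L + M) + 18 - L ^ 2 / 12) ≤ Real.exp (-L) / 40 := by
    calc Real.exp (2 * (L + M) + 18 - L ^ 2 / 12) ≤ Real.exp (-L - 4) :=
          Real.exp_le_exp.2 (by nlinarith)
      _ = Real.exp (-L) / Real.exp 4 := Real.exp_sub _ _
      _ ≤ _ := div_le_div_of_nonneg_left (Real.exp_pos _).le (by norm_num) he4
  have hL40 : 2 * L ^ 40 + 1 ≤ 3 * L ^ 40 := by
    have : 1 ≤ L ^ 40 := one_le_pow₀ hL1
    linarith
  refine ⟨nonneg, sum_le, sum_le', le_sum, ρ_pos, ρ_le, δ_pos, δ_le, L_ge, M_le, δL_ge, sieve, row,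
    ?_, ?_, ?_, hkL, ?_, ?_⟩
  · rw [hpow]
    refine Real.exp_le_exp.2 ?_
    push_cast
    nlinarith
  · have h1 : Real.exp (19 + 2 * M - c) ≤ Q := Real.exp_le_exp.2 (by linarith)
    have h2 : (k + 1) * (Real.exp (19 + 2 * M - c) * ((2 * L ^ 40 + 1) * L ^ 2)) ≤
        L * (Q * ((3 * L ^ 40) * L ^ 2)) := by gcongr
    have h3 : (L + 1) * Real.exp (2 * (L + M) + 18 - L ^ 2 / 12) ≤ 1 / 40 := by
      calc _ ≤ Real.exp L * (Real.exp (-L) / 40) := by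
            refine mul_le_mul (h2e L) hA (Real.exp_pos _).le (Real.exp_pos _).le
        _ = 1 / 40 := by rw [Real.exp_neg]; field_simp
    have h4 : (L + 1) * (L * (Q * ((3 * L ^ 40) * L ^ 2))) ≤ 6 * (Q * L ^ 46) := by
      have h5 : L + 1 ≤ 2 * L := by linarith
      have h6 : L ^ 44 ≤ L ^ 46 := pow_le_pow_right₀ hL1 (by norm_num)
      calc (L + 1) * (L * (Q * ((3 * L ^ 40) * L ^ 2))) ≤ 2 * L * (L * (Q * ((3 * L ^ 40) * L ^ 2))) := by
            gcongr
        _ = 6 * (Q * L ^ 44) := by ring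
        _ ≤ _ := by gcongr
    have h7 := mul_le_mul_of_nonneg_left h2 (by linarith : 0 ≤ L + 1)
    rw [mul_add]
    linarith
  · have h1 : (k + 1) * (Real.exp (20 + 2 * M - c - L) * (L * (2 * L ^ 40 + 1) * L ^ 4)) ≤
        Real.exp (-L) / 40 := by
      calc (k + 1) * (Real.exp (20 + 2 * M - c - L) * (L * (2 * L ^ 40 + 1) * L ^ 4))
          ≤ L * (Real.exp (20 + 2 * M - c - L) * (L * (3 * L ^ 40) * L ^ 4)) := by gcongr
        _ = Real.exp (-L) * (3 * (Q * L ^ 46)) := by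
            rw [sub_eq_add_neg _ L, Real.exp_add, ← hQ]; ring
        _ ≤ Real.exp (-L) * (1 / 40) := by gcongr; linarith
        _ = _ := by ring
    linarith
  · calc (k + 1) * Real.exp (ρ * L) ≤ Real.exp lL * Real.exp (ρ * L) := by rw [hEL]; gcongr
      _ = Real.exp (lL + ρ * L) := (Real.exp_add _ _).symm
      _ ≤ Real.exp (L - 2) := Real.exp_le_exp.2 (by linarith)
      _ = Real.exp L / Real.exp 2 := Real.exp_sub _ _
      _ ≤ _ := div_le_div_of_nonneg_left (Real.exp_pos _).le (by norm_num) he2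
  · have hk0 : (0 : ℝ) ≤ k := Nat.cast_nonneg k
    have e1 : (2 : ℝ) ^ (k + 1) ≤ Real.exp (k + 1) := by
      rw [show ((k : ℝ) + 1) = ((k + 1 : ℕ) : ℝ) * 1 by push_cast; ring, Real.exp_nat_mul]
      have := Real.exp_one_gt_d9
      gcongr
      linarith
    have e2 : (L ^ 2) ^ (k + 1) = Real.exp (2 * (k + 1) * lL) := by
      rw [← pow_mul, hpow]; push_cast; ring_nf
    have e3 : (3 : ℝ) ≤ Real.exp 2 := by linarith
    have e4 : Real.log (L ^ 43 * L ^ 2) = 45 * lL := by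
      rw [← pow_add, Real.log_pow]; push_cast; ring
    rw [e2, e4, hpow 45]
    calc _ ≤ Real.exp (k + 1) * (Real.exp (2 * (k + 1) * lL) * (Real.exp 2 * Real.exp (M + 20) *
          Real.exp ((45 : ℕ) * lL) * Real.exp ((M + 18) * (k + 1) ^ 2 + 2 * (k + 1) * (45 * lL) -
            2 * δ * y))) := by gcongr
      _ = Real.exp (k + 1 + 2 * (k + 1) * lL + 2 + (M + 20) + 45 * lL + ((M + 18) * (k + 1) ^ 2 +
          2 * (k + 1) * (45 * lL) - 2 * δ * y)) := by
          simp only [← Real.exp_add]; congr 1; push_cast; ring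
      _ ≤ Real.exp (-4) := Real.exp_le_exp.2 (by
          have f1 : (k + 1 : ℝ) ^ 2 ≤ 9 * lL ^ 2 := by nlinarith
          have f2 : (k + 1 : ℝ) * lL ≤ 3 * lL ^ 2 := by nlinarith
          have f3 : lL ≤ lL ^ 2 := by nlinarith
          have f4 := mul_le_mul_of_nonneg_left f1 (show 0 ≤ M + 18 by linarith)
          have f5 : M ≤ M * lL ^ 2 := le_mul_of_one_le_right nonneg (by nlinarith)
          nlinarith)
      _ = 1 / Real.exp 4 := by rw [Real.exp_neg, one_div]
      _ ≤ _ := one_div_le_one_div_of_le (by norm_num) (by linarith)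

theorem prod_row_eq {D L t : ℝ} (hD : 0 < D) (hL : 0 < L) (k : ℕ) :
    ∏ i : Fin k, D * (Real.exp (-t) ^ (i + 1 : ℕ) * L) =
      Real.exp (k * (Real.log D + Real.log L) - t * (k * (k + 1) / 2)) := by
  induction k with
  | zero => simp
  | succ k ih =>
    rw [Fin.prod_univ_castSucc]
    simp only [Fin.val_castSucc, Fin.val_last]
    have h : D * (Real.exp (-t) ^ (k + 1) * L) =
        Real.exp (Real.log D + ((k + 1 : ℕ) * -t + Real.log L)) := by
      rw [Real.exp_add, Real.exp_add, Real.exp_log hD, Real.exp_log hL, Real.exp_nat_mul]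
    rw [ih, h, ← Real.exp_add]
    congr 1
    push_cast
    ring

theorem one_add_mul_log_sub_pos {δ : ℝ} (hδ : 0 < δ) : 0 < (1 + δ) * Real.log (1 + δ) - δ := by
  have h1 : Real.log (1 + δ) ≠ 0 := (Real.log_pos (by linarith)).ne'
  have h2 := Real.add_one_lt_exp (neg_ne_zero.2 h1)
  rw [Real.exp_neg, Real.exp_log (by linarith)] at h2
  have h3 := mul_lt_mul_of_pos_left h2 (show 0 < 1 + δ by linarith)
  rw [mul_inv_cancel₀ (by linarith)] at h3
  linarith

theorem sum_incr_exp_le {t δ : ℝ} (ht : 1 / (2 * 0.8178) ≤ t) (hδ : 0 ≤ δ)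
    (hδt : Real.exp (1 / (2 * 0.8178) - t) + 11 * δ ≤ 1) (m : ℕ) :
    ∑ r ∈ Finset.Icc 1 m, ((1 + δ) * incr r + 3 * δ) * Real.exp (-t) ^ r ≤ 1 - 4 * δ := by
  set τ := Real.exp (1 / (2 * 0.8178) - t) with hτ
  have hτ0 : 0 < τ := Real.exp_pos _
  have hτ1 : τ ≤ 1 := Real.exp_le_one_iff.2 (by linarith)
  have hρ : Real.exp (-t) ≤ τ * 0.542593 := by
    rw [show -t = (1 / (2 * 0.8178) - t) + -(1 / (2 * 0.8178)) by ring, Real.exp_add]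
    exact mul_le_mul_of_nonneg_left exp_neg_inv_le hτ0.le
  set ρ := Real.exp (-t) with hρd
  have hρ0 : 0 < ρ := Real.exp_pos _
  have hρ2 : ρ ≤ 0.55 := by nlinarith
  have h1 : ∑ r ∈ Finset.Icc 1 m, incr r * ρ ^ r ≤ τ := by
    calc ∑ r ∈ Finset.Icc 1 m, incr r * ρ ^ r ≤ ∑ r ∈ Finset.Icc 1 m, τ * (incr r * 0.542593 ^ r) := by
          refine Finset.sum_le_sum fun r hr => ?_
          have hr1 := (Finset.mem_Icc.1 hr).1
          have h2 : ρ ^ r ≤ τ * 0.542593 ^ r := by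
            calc ρ ^ r ≤ (τ * 0.542593) ^ r := pow_le_pow_left₀ hρ0.le hρ r
              _ = τ ^ r * 0.542593 ^ r := mul_pow _ _ _
              _ ≤ τ * 0.542593 ^ r := mul_le_mul_of_nonneg_right
                (pow_le_of_le_one hτ0.le hτ1 (by omega)) (by positivity)
          have := mul_le_mul_of_nonneg_left h2 (incr_nonneg hr1)
          linarith
      _ ≤ τ := by
          rw [← Finset.mul_sum]
          exact mul_le_of_le_one_right hτ0.le (sum_incr_le m)
  have h2 : ∑ r ∈ Finset.Icc 1 m, ρ ^ r ≤ 2 := by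
    have h3 : ∑ r ∈ Finset.Icc 1 m, ρ ^ r ≤ ∑ r ∈ Finset.range (m + 1), ρ ^ r - 1 := by
      rw [Finset.range_eq_Ico, Finset.sum_eq_sum_Ico_succ_bot (by omega), pow_zero, add_sub_cancel_left]
      exact Finset.sum_le_sum_of_subset_of_nonneg (fun r hr => by
        rw [Finset.mem_Icc] at hr; exact Finset.mem_Ico.2 ⟨by omega, by omega⟩) fun r _ _ => by positivity
    have h4 := geom_sum_mul_neg ρ (m + 1)
    have h5 : 0 < ρ ^ (m + 1) := by positivity
    nlinarith
  calc ∑ r ∈ Finset.Icc 1 m, ((1 + δ) * incr r + 3 * δ) * ρ ^ r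
      = (1 + δ) * ∑ r ∈ Finset.Icc 1 m, incr r * ρ ^ r + 3 * δ * ∑ r ∈ Finset.Icc 1 m, ρ ^ r := by
        rw [Finset.mul_sum, Finset.mul_sum, ← Finset.sum_add_distrib]
        exact Finset.sum_congr rfl fun r _ => by ring
    _ ≤ (1 + δ) * τ + 3 * δ * 2 := by gcongr
    _ ≤ 1 - 4 * δ := by nlinarith

theorem eventually_mul_log_sq_le (A : ℝ) {θ : ℝ} (hθ : 0 < θ) :
    ∀ᶠ L : ℝ in Filter.atTop, A * Real.log L ^ 2 ≤ L ^ θ := by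
  have h := (isLittleO_log_rpow_rpow_atTop 2 hθ).bound (show 0 < 1 / (|A| + 1) by positivity)
  filter_upwards [h, Filter.eventually_ge_atTop 1] with L hL hL1
  rw [Real.rpow_two, Real.norm_of_nonneg (sq_nonneg _),
    Real.norm_of_nonneg (Real.rpow_nonneg (by linarith) _), one_div,
    inv_mul_eq_div, le_div_iff₀ (by positivity)] at hL
  have := le_abs_self A
  nlinarith [sq_nonneg (Real.log L)]

theorem floor_main_le {a D ε t θ l : ℝ} (hε : 0 < ε) (hε1 : ε ≤ 0.1) (ha : a = 0.8178 - ε / 2)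
    (ht : t = 1 / (2 * a)) (hθ : θ = ε / 2) (hD : 0 ≤ D) (hl : 4 * (2 * D + 8) ≤ ε * l) :
    (0.8178 - ε) * l ^ 2 ≤ (⌊(1 - θ) * l / t⌋₊ : ℝ) * (-D + l) -
      t * (⌊(1 - θ) * l / t⌋₊ * (⌊(1 - θ) * l / t⌋₊ + 1) / 2) -
        (⌊(1 - θ) * l / t⌋₊ + 1) * Real.log 2 - Real.log 8 := by
  have hl0 : 0 < l := by nlinarith
  have hl1 : 1 ≤ l := by nlinarith
  have ha0 : 0.7 ≤ a := by linarith
  have ht0 : 0 < t := by rw [ht]; positivity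
  have hu0 : 0 ≤ (1 - θ) * l / t := div_nonneg (mul_nonneg (by linarith) hl0.le) ht0.le
  have hk1 := Nat.floor_le hu0
  have hk2 := Nat.lt_floor_add_one ((1 - θ) * l / t)
  set u := (1 - θ) * l / t with hu
  have hta : t * a = 1 / 2 := by rw [ht]; field_simp
  have huv : u = 2 * a * ((1 - θ) * l) := by rw [hu, ht]; field_simp
  have htu : t * u = (1 - θ) * l := by rw [hu]; field_simp
  have hu2 : u ≤ 2 * l := by
    rw [huv]
    nlinarith [mul_nonneg (by linarith : 0 ≤ θ) hl0.le]
  have hk0 : (0 : ℝ) ≤ ⌊u⌋₊ := Nat.cast_nonneg _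
  generalize (⌊u⌋₊ : ℝ) = κ at *
  have hl2 : Real.log 2 ≤ 1 := by linarith [Real.log_two_lt_d9]
  have hl20 : 0 < Real.log 2 := Real.log_pos (by norm_num)
  have hl8 : Real.log 8 ≤ 3 := by
    rw [show (8 : ℝ) = 2 ^ 3 by norm_num, Real.log_pow]
    push_cast
    linarith
  have f1 : (u - 1) * l ≤ κ * l := mul_le_mul_of_nonneg_right (by linarith) hl0.le
  have f2 : κ * D ≤ 2 * l * D := mul_le_mul_of_nonneg_right (hk1.trans hu2) hD
  have f3 : t * (κ * (κ + 1) / 2) ≤ t * (u * (u + 1) / 2) := by gcongr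
  have f4 : t * (u * (u + 1) / 2) = (1 - θ) * l * u / 2 + (1 - θ) * l / 2 := by
    calc _ = (t * u) * u / 2 + (t * u) / 2 := by ring
      _ = _ := by rw [htu]
  have f5 : (κ + 1) * Real.log 2 ≤ (2 * l + 1) * 1 := by gcongr; linarith
  have f6 : u * l - (1 - θ) * l * u / 2 = a * (1 - θ ^ 2) * l ^ 2 := by rw [huv]; ring
  have f7 : (0.8178 - ε + ε / 4) * l ^ 2 ≤ a * (1 - θ ^ 2) * l ^ 2 := by
    refine mul_le_mul_of_nonneg_right ?_ (sq_nonneg l)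
    rw [hθ, ha]
    nlinarith
  have f8 : (1 - θ) * l ≤ l := by nlinarith
  have f9 : (2 * D + 8) * l ≤ ε / 4 * l ^ 2 := by nlinarith
  nlinarith

set_option maxHeartbeats 1000000 in
theorem eventually_le_S_exp_exp {ε : ℝ} (hε : 0 < ε) (hε1 : ε ≤ 0.1) :
    ∀ᶠ L : ℝ in Filter.atTop, Real.exp (Real.exp L) / Real.exp L *
      Real.exp ((0.8178 - ε) * Real.log L ^ 2) ≤ S (Real.exp (Real.exp L)) := by
  obtain ⟨M, hM, h1, h2, h3⟩ := exists_sum_lev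
  obtain ⟨L₀, -, hsv⟩ := exists_sieveBound
  obtain ⟨a, ha⟩ : ∃ a : ℝ, a = 0.8178 - ε / 2 := ⟨_, rfl⟩
  obtain ⟨t, ht⟩ : ∃ t : ℝ, t = 1 / (2 * a) := ⟨_, rfl⟩
  obtain ⟨θ, hθ⟩ : ∃ θ : ℝ, θ = ε / 2 := ⟨_, rfl⟩
  have ha0 : 0.7 ≤ a := by linarith
  have ht0 : 0 < t := by rw [ht]; positivity
  have ht1 : 1 / (2 * 0.8178) < t := by
    rw [ht]
    exact one_div_lt_one_div_of_lt (by linarith) (by linarith)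
  have hθ0 : 0 < θ := by linarith
  set τ := Real.exp (1 / (2 * 0.8178) - t) with hτ
  have hτ0 : 0 < τ := Real.exp_pos _
  have hτ1 : τ < 1 := (Real.exp_lt_exp.2 (by linarith)).trans_eq Real.exp_zero
  obtain ⟨δ, hδ⟩ : ∃ δ : ℝ, δ = (1 - τ) / 11 := ⟨_, rfl⟩
  have hδ0 : 0 < δ := by rw [hδ]; linarith
  have hδ1 : δ ≤ 1 / 11 := by rw [hδ]; linarith
  have hb := sum_incr_exp_le ht1.le hδ0.le (by rw [← hτ, hδ]; linarith)
  set ρ := Real.exp (-t) with hρ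
  have hρ0 : 0 < ρ := Real.exp_pos _
  have hρ1 : ρ ≤ 0.6 :=
    (Real.exp_le_exp.2 (by linarith)).trans (exp_neg_inv_le.trans (by norm_num))
  have hc := mul_pos (one_add_mul_log_sub_pos hδ0) (show 0 < 1 - ρ by linarith)
  set c := ((1 + δ) * Real.log (1 + δ) - δ) * (1 - ρ) with hcd
  have hlog : Filter.Tendsto Real.log Filter.atTop Filter.atTop := Real.tendsto_log_atTop
  filter_upwards [Filter.eventually_ge_atTop 80, Filter.eventually_ge_atTop M,
    Filter.eventually_ge_atTop (1 / δ), Filter.eventually_ge_atTop L₀,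
    eventually_mul_log_sq_le (8 * (1 + M) / δ) hθ0, eventually_mul_log_sq_le 6 hθ0,
    eventually_mul_log_sq_le ((2 * M + 71) / c) hθ0,
    eventually_mul_log_sq_le ((10 * M + 600) / (2 * δ)) hθ0,
    eventually_mul_log_sq_le 6 zero_lt_one,
    hlog.eventually_ge_atTop (4 * (2 * (-Real.log (δ / 8)) + 8) / ε)]
    with L hL80 hLM hLδ hL0 e1 e2 e3 e4 e5 e6
  have hLpos : 0 < L := by linarith
  rw [Real.rpow_one] at e5
  set l := Real.log L with hl
  have hl1 : 1 ≤ l := by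
    rw [hl, Real.le_log_iff_exp_le hLpos]
    have := Real.exp_one_lt_d9
    linarith
  have hl2 : l ≤ l ^ 2 := by nlinarith
  have hl3 : 1 ≤ l ^ 2 := by nlinarith
  have hD : 0 ≤ -Real.log (δ / 8) := by
    have := Real.log_nonpos (by positivity : 0 ≤ δ / 8) (by linarith)
    linarith
  have hmain := floor_main_le hε hε1 ha ht hθ hD (l := l) (by
    rw [div_le_iff₀ hε] at e6
    linarith)
  have hu0 : 0 ≤ (1 - θ) * l / t := div_nonneg (mul_nonneg (by linarith) (by linarith)) ht0.le
  have hk1 := Nat.floor_le hu0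
  set k := ⌊(1 - θ) * l / t⌋₊ with hk
  have hkt : t * k ≤ (1 - θ) * l := by
    rw [le_div_iff₀ ht0] at hk1
    linarith
  have ht2 : 1 / 2 ≤ t := by
    rw [ht]
    exact one_div_le_one_div_of_le (by linarith) (by linarith)
  have hk3 : (k + 1 : ℝ) ≤ 3 * l := by
    have : (0 : ℝ) ≤ k := Nat.cast_nonneg k
    nlinarith
  have hy : L ^ θ ≤ ρ ^ k * L := by
    rw [Real.rpow_def_of_pos hLpos, hρ, ← Real.exp_nat_mul]
    calc Real.exp (l * θ) ≤ Real.exp (k * -t + l) := Real.exp_le_exp.2 (by linarith)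
      _ = _ := by rw [Real.exp_add, hl, Real.exp_log hLpos]
  set y := ρ ^ k * L with hyd
  have hsc : Scale M ρ δ L k := by
    refine Scale.of_le hM h1 h2 h3 hρ0 (by linarith) hδ0 (by linarith) hL80 hLM ?_ (hsv L hL0) ?_ ?_ ?_ ?_
      hk3 ?_ ?_
    · rwa [div_le_iff₀' hδ0] at hLδ
    · have := e1.trans hy
      rw [div_mul_eq_mul_div, div_le_iff₀' hδ0] at this
      exact (le_mul_of_one_le_right (by linarith) hl3).trans this
    · have := e2.trans hy
      linarith
    · have := e3.trans hy
      rw [div_mul_eq_mul_div, div_le_iff₀' hc, hcd, mul_assoc] at this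
      have hMl := le_mul_of_one_le_right hM hl3
      linarith
    · have := e4.trans hy
      rwa [div_mul_eq_mul_div, div_le_iff₀' (by positivity)] at this
    · linarith
    · nlinarith
  refine le_trans ?_ (hsc.le_S hb)
  rw [prod_row_eq (by positivity) hLpos, Real.exp_neg, ← hl]
  have h8 : (8 : ℝ) = Real.exp (Real.log 8) := (Real.exp_log (by norm_num)).symm
  have h2k : (2 : ℝ) ^ (k + 1) = Real.exp ((k + 1) * Real.log 2) := by
    rw [show ((k : ℝ) + 1) * Real.log 2 = ((k + 1 : ℕ) : ℝ) * Real.log 2 by push_cast; ring,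
      Real.exp_nat_mul, Real.exp_log zero_lt_two]
  calc Real.exp (Real.exp L) / Real.exp L * Real.exp ((0.8178 - ε) * l ^ 2)
      ≤ Real.exp (Real.exp L) / Real.exp L * Real.exp (k * (Real.log (δ / 8) + l) -
          t * (k * (k + 1) / 2) - (k + 1) * Real.log 2 - Real.log 8) := by
        refine mul_le_mul_of_nonneg_left (Real.exp_le_exp.2 ?_) (by positivity)
        rw [neg_neg] at hmain
        exact hmain
    _ = _ := by
        rw [Real.exp_sub _ (Real.log 8), Real.exp_sub _ ((k + 1) * Real.log 2), ← h8, ← h2k]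
        field_simp

theorem hadamard_count_ford_lower :
    ∀ ε : ℝ, ε > 0 → ∃ xε : ℝ, ∀ x : ℝ, x > xε →
      (S x : ℝ) ≥ x / Real.log x *
        Real.exp ((0.8178 - ε) * Real.log (Real.log (Real.log x)) ^ 2) := by
  intro ε hε
  have h := eventually_le_S_exp_exp (ε := min ε 0.1) (lt_min hε (by norm_num)) (min_le_right _ _)
  have h2 := (Real.tendsto_log_atTop.comp Real.tendsto_log_atTop).eventually h
  obtain ⟨x₀, hx₀⟩ := Filter.eventually_atTop.1 h2
  refine ⟨max x₀ (Real.exp 1), fun x hx => ?_⟩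
  have hx1 : Real.exp 1 < x := (le_max_right _ _).trans_lt hx
  have hx0 : 0 < x := (Real.exp_pos 1).trans hx1
  have hlx : 1 < Real.log x := (Real.lt_log_iff_exp_lt hx0).2 hx1
  have h3 := hx₀ x ((le_max_left _ _).trans hx.le)
  simp only [Function.comp_apply] at h3
  rw [Real.exp_log (by linarith : 0 < Real.log x), Real.exp_log hx0] at h3
  refine le_trans (mul_le_mul_of_nonneg_left (Real.exp_le_exp.2 ?_) (by positivity)) h3
  exact mul_le_mul_of_nonneg_right (by linarith [min_le_left ε 0.1]) (sq_nonneg _)
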